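/- arXiv:0809.2511 — 3 statements merged into one kernel-verified Lean document; each statement's English description precedes it below -/
import Mathlib

section
/- Let n ≥ 3. For every constant C > 0 there exist ρ > 0 and an open set Ω contained in the open unit ball of ℝⁿ such that Ω is starshaped with respect to the ball B(0,ρ) and Λ(Ω) > C·γ(Ω)². Consequently, no inequality of the form γ(Ω)² ≥ C·Λ(Ω) can hold with a constant C independent of the radius ρ in the class of domains in the unit ball starshaped with respect to a concentric ball. -/
open MeasureTheory Metric Set Filter
open scoped ENNReal Topology

noncomputable section

/-- Smooth compactly supported test function in an open set `Ω`. -/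
def TestFun {n : ℕ} (Ω : Set (EuclideanSpace ℝ (Fin n)))
    (u : EuclideanSpace ℝ (Fin n) → ℝ) : Prop :=
  ContDiff ℝ (⊤ : ℕ∞) u ∧ HasCompactSupport u ∧ tsupport u ⊆ Ω

/-- The fundamental Dirichlet–Laplace constant
`Λ(Ω) = inf { ∫_Ω |∇u|² / ∫_Ω u² : u ∈ C_0^∞(Ω), u ≠ 0 }`. -/
def Lambda {n : ℕ} (Ω : Set (EuclideanSpace ℝ (Fin n))) : ℝ :=
  sInf {r : ℝ | ∃ u : EuclideanSpace ℝ (Fin n) → ℝ, TestFun Ω u ∧ u ≠ 0 ∧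
    r = (∫ x in Ω, ‖fderiv ℝ u x‖ ^ 2) / ∫ x in Ω, (u x) ^ 2}

/-- The Cheeger (isoperimetric) constant
`γ(Ω) = inf { ∫_Ω |∇u| / ∫_Ω |u| : u ∈ C_0^∞(Ω), u ≠ 0 }`. -/
def cheegerConst {n : ℕ} (Ω : Set (EuclideanSpace ℝ (Fin n))) : ℝ :=
  sInf {r : ℝ | ∃ u : EuclideanSpace ℝ (Fin n) → ℝ, TestFun Ω u ∧ u ≠ 0 ∧
    r = (∫ x in Ω, ‖fderiv ℝ u x‖) / ∫ x in Ω, |u x|}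

/-- Jensen's inequality for the square on an interval of length at most one. -/
lemma sq_intervalIntegral_le {f : ℝ → ℝ} (hf : Continuous f) {τ : ℝ} (h0 : 0 ≤ τ) (h1 : τ ≤ 1) :
    (∫ s in (0 : ℝ)..τ, f s) ^ 2 ≤ ∫ s in (0 : ℝ)..τ, f s ^ 2 := by
  set m := ∫ s in (0 : ℝ)..τ, f s with hm
  have h : 0 ≤ ∫ s in (0 : ℝ)..τ, (f s - m) ^ 2 :=
    intervalIntegral.integral_nonneg h0 fun s _ => sq_nonneg _
  have hexp : ∫ s in (0 : ℝ)..τ, (f s - m) ^ 2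
      = (∫ s in (0 : ℝ)..τ, f s ^ 2) - 2 * m * m + τ * m ^ 2 := by
    have : ∀ s, (f s - m) ^ 2 = f s ^ 2 - 2 * m * f s + m ^ 2 := fun s => by ring
    simp_rw [this]
    rw [intervalIntegral.integral_add, intervalIntegral.integral_sub,
      intervalIntegral.integral_const_mul, intervalIntegral.integral_const]
    · simp [hm]
    all_goals exact Continuous.intervalIntegrable (by fun_prop) _ _
  nlinarith [sq_nonneg m]

section Paths

variable {E : Type*} [NormedAddCommGroup E] [NormedSpace ℝ E]

lemma sq_sub_le_intervalIntegral_fderiv {u : E → ℝ} (hu : ContDiff ℝ 1 u) (x w : E) {τ : ℝ}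
    (h0 : 0 ≤ τ) (h1 : τ ≤ 1) :
    (u x - u (x + τ • w)) ^ 2 ≤ ‖w‖ ^ 2 * ∫ s in (0 : ℝ)..τ, ‖fderiv ℝ u (x + s • w)‖ ^ 2 := by
  have hcont : Continuous fun s : ℝ => fderiv ℝ u (x + s • w) :=
    (hu.continuous_fderiv one_ne_zero).comp (by fun_prop)
  have hderiv : ∀ s : ℝ, HasDerivAt (fun s : ℝ => u (x + s • w)) (fderiv ℝ u (x + s • w) w) s := by
    intro s
    have hpath : HasDerivAt (fun s : ℝ => x + s • w) w s := by
      simpa using ((hasDerivAt_id s).smul_const w).const_add x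
    exact ((hu.differentiable one_ne_zero _).hasFDerivAt).comp_hasDerivAt s hpath
  have hftc : ∫ s in (0 : ℝ)..τ, fderiv ℝ u (x + s • w) w = u (x + τ • w) - u x := by
    rw [intervalIntegral.integral_eq_sub_of_hasDerivAt (fun s _ => hderiv s)]
    · simp
    · exact (hcont.clm_apply continuous_const).intervalIntegrable _ _
  calc (u x - u (x + τ • w)) ^ 2 = (∫ s in (0 : ℝ)..τ, fderiv ℝ u (x + s • w) w) ^ 2 := by
        rw [hftc]; ring
    _ ≤ ∫ s in (0 : ℝ)..τ, (fderiv ℝ u (x + s • w) w) ^ 2 :=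
        sq_intervalIntegral_le (hcont.clm_apply continuous_const) h0 h1
    _ ≤ ∫ s in (0 : ℝ)..τ, ‖w‖ ^ 2 * ‖fderiv ℝ u (x + s • w)‖ ^ 2 := by
        apply intervalIntegral.integral_mono_on h0
        · exact ((hcont.clm_apply continuous_const).pow 2).intervalIntegrable _ _
        · exact (continuous_const.mul (hcont.norm.pow 2)).intervalIntegrable _ _
        · intro s _
          have := (fderiv ℝ u (x + s • w)).le_opNorm w
          rw [← sq_abs, ← mul_pow, mul_comm]
          exact pow_le_pow_left₀ (abs_nonneg _) this 2
    _ = _ := intervalIntegral.integral_const_mul _ _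

variable [MeasurableSpace E] [BorelSpace E] {μ : Measure E} [SFinite μ]

lemma lintegral_sq_sub_le {u : E → ℝ} (hu : ContDiff ℝ 1 u) {A : Set E} (hA : MeasurableSet A)
    {w : E → E} (hw : Continuous w) {κ τ : ℝ} (hκ : ∀ x ∈ A, ‖w x‖ ≤ κ) (h0 : 0 ≤ τ) (h1 : τ ≤ 1) :
    ∫⁻ x in A, ENNReal.ofReal ((u x - u (x + τ • w x)) ^ 2) ∂μ ≤
      ENNReal.ofReal (κ ^ 2) * ∫⁻ s in Ioc 0 τ, ∫⁻ x in A,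
        ENNReal.ofReal (‖fderiv ℝ u (x + s • w x)‖ ^ 2) ∂μ := by
  have hfd := hu.continuous_fderiv one_ne_zero
  have hpt : ∀ x ∈ A, ENNReal.ofReal ((u x - u (x + τ • w x)) ^ 2) ≤
      ENNReal.ofReal (κ ^ 2) *
        ∫⁻ s in Ioc 0 τ, ENNReal.ofReal (‖fderiv ℝ u (x + s • w x)‖ ^ 2) := by
    intro x hx
    have hc : Continuous fun s : ℝ => ‖fderiv ℝ u (x + s • w x)‖ ^ 2 :=
      (hfd.comp (by fun_prop : Continuous fun s : ℝ => x + s • w x)).norm.pow 2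
    rw [← ofReal_integral_eq_lintegral_ofReal, ← ENNReal.ofReal_mul (sq_nonneg _),
      ← intervalIntegral.integral_of_le h0]
    · apply ENNReal.ofReal_le_ofReal
      refine (sq_sub_le_intervalIntegral_fderiv hu x (w x) h0 h1).trans ?_
      gcongr
      · exact intervalIntegral.integral_nonneg h0 fun s _ => sq_nonneg _
      · exact hκ x hx
    · exact (hc.intervalIntegrable 0 τ).1
    · exact Eventually.of_forall fun s => sq_nonneg _
  calc _ ≤ ∫⁻ x in A, ENNReal.ofReal (κ ^ 2) *
        (∫⁻ s in Ioc 0 τ, ENNReal.ofReal (‖fderiv ℝ u (x + s • w x)‖ ^ 2)) ∂μ :=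
        setLIntegral_mono' hA hpt
    _ = ENNReal.ofReal (κ ^ 2) * ∫⁻ x in A,
        (∫⁻ s in Ioc 0 τ, ENNReal.ofReal (‖fderiv ℝ u (x + s • w x)‖ ^ 2)) ∂μ :=
        lintegral_const_mul' _ _ ENNReal.ofReal_ne_top
    _ = _ := by
        rw [lintegral_lintegral_swap]
        apply Continuous.aemeasurable
        exact ENNReal.continuous_ofReal.comp
          ((hfd.comp (by fun_prop : Continuous fun p : E × ℝ => p.1 + p.2 • w p.1)).norm.pow 2)

lemma lintegral_sq_sub_translate_le [SecondCountableTopology E] [μ.IsAddRightInvariant]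
    {u : E → ℝ} (hu : ContDiff ℝ 1 u)
    {A : Set E} (hA : MeasurableSet A) (v : E) :
    ∫⁻ x in A, ENNReal.ofReal ((u x - u (x + v)) ^ 2) ∂μ ≤
      ENNReal.ofReal (‖v‖ ^ 2) * ∫⁻ x, ENNReal.ofReal (‖fderiv ℝ u x‖ ^ 2) ∂μ := by
  have h := lintegral_sq_sub_le (μ := μ) hu hA (w := fun _ => v) continuous_const
    (fun x _ => le_refl ‖v‖) zero_le_one le_rfl
  simp only [one_smul] at h
  refine h.trans ?_
  gcongr
  calc _ ≤ ∫⁻ s in Ioc (0 : ℝ) 1, ∫⁻ x, ENNReal.ofReal (‖fderiv ℝ u x‖ ^ 2) ∂μ := by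
        refine lintegral_mono fun s => (setLIntegral_le_lintegral _ _).trans ?_
        exact (lintegral_add_right_eq_self
          (fun x => ENNReal.ofReal (‖fderiv ℝ u x‖ ^ 2)) (s • v)).le
    _ = _ := by simp

end Paths

lemma lintegral_inv_sq_one_sub_le {τ : ℝ} (h0 : 0 ≤ τ) (h1 : τ < 1) :
    ∫⁻ s in Ioc 0 τ, ENNReal.ofReal (((1 - s) ^ 2)⁻¹) ≤ ENNReal.ofReal ((1 - τ)⁻¹) := by
  have hne : ∀ s ∈ uIcc 0 τ, 1 - s ≠ 0 := by
    intro s hs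
    rw [uIcc_of_le h0] at hs
    linarith [hs.2]
  have hderiv : ∀ s ∈ uIcc 0 τ, HasDerivAt (fun s : ℝ => (1 - s)⁻¹) (((1 - s) ^ 2)⁻¹) s := by
    intro s hs
    have := ((hasDerivAt_id s).const_sub 1).inv (hne s hs)
    simpa [div_eq_mul_inv, Pi.inv_def] using this
  have hInt : IntervalIntegrable (fun s : ℝ => ((1 - s) ^ 2)⁻¹) volume 0 τ := by
    apply ContinuousOn.intervalIntegrable
    exact ContinuousOn.inv₀ (by fun_prop) fun s hs => pow_ne_zero 2 (hne s hs)
  rw [← ofReal_integral_eq_lintegral_ofReal hInt.1 (Eventually.of_forall fun s => by positivity),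
    ← intervalIntegral.integral_of_le h0,
    intervalIntegral.integral_eq_sub_of_hasDerivAt hderiv hInt]
  apply ENNReal.ofReal_le_ofReal
  simp

section Geometry

variable {n : ℕ}

/-- The linear functional `x ↦ x i - a * x k`. -/
def offset (i k : Fin n) (a : ℝ) : EuclideanSpace ℝ (Fin n) →L[ℝ] ℝ :=
  EuclideanSpace.proj i - a • EuclideanSpace.proj k

/-- The component of `x` transversal to the codimension-two subspace
`{x | x i = a * x k, x j = b * x k}`, along the coordinate directions `i` and `j`. -/
def lateral (i j k : Fin n) (a b : ℝ) :
    EuclideanSpace ℝ (Fin n) →L[ℝ] EuclideanSpace ℝ (Fin n) :=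
  (offset i k a).smulRight (EuclideanSpace.single i 1) +
    (offset j k b).smulRight (EuclideanSpace.single j 1)

lemma offset_apply (i k : Fin n) (a : ℝ) (x : EuclideanSpace ℝ (Fin n)) :
    offset i k a x = x i - a * x k := by
  simp [offset]

lemma abs_offset_le (i k : Fin n) (a : ℝ) (x : EuclideanSpace ℝ (Fin n)) :
    |offset i k a x| ≤ (1 + |a|) * ‖x‖ := by
  rw [offset_apply]
  have hi : |x i| ≤ ‖x‖ := PiLp.norm_apply_le x i
  have hk : |x k| ≤ ‖x‖ := PiLp.norm_apply_le x k
  calc |x i - a * x k| ≤ |x i| + |a * x k| := abs_sub _ _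
    _ = |x i| + |a| * |x k| := by rw [abs_mul]
    _ ≤ ‖x‖ + |a| * ‖x‖ := by gcongr
    _ = _ := by ring

lemma norm_offset_le (i k : Fin n) (a : ℝ) : ‖offset i k a‖ ≤ 1 + |a| :=
  ContinuousLinearMap.opNorm_le_bound _ (by positivity) fun x => abs_offset_le i k a x

lemma lateral_apply (i j k : Fin n) (a b : ℝ) (x : EuclideanSpace ℝ (Fin n)) :
    lateral i j k a b x = offset i k a x • EuclideanSpace.single i 1 +
      offset j k b x • EuclideanSpace.single j 1 := rfl

lemma norm_lateral_le (i j k : Fin n) (a b : ℝ) (x : EuclideanSpace ℝ (Fin n)) :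
    ‖lateral i j k a b x‖ ≤ |offset i k a x| + |offset j k b x| := by
  rw [lateral_apply]
  refine (norm_add_le _ _).trans ?_
  simp [norm_smul]

section Distinct

variable {i j k : Fin n}

lemma lateral_apply_axis (hik : i ≠ k) (hjk : j ≠ k) (a b : ℝ) (x : EuclideanSpace ℝ (Fin n)) :
    lateral i j k a b x k = 0 := by
  simp [lateral_apply, hik.symm, hjk.symm]

lemma offset_lateral_fst (hij : i ≠ j) (hik : i ≠ k) (hjk : j ≠ k) (a b : ℝ)
    (x : EuclideanSpace ℝ (Fin n)) :
    offset i k a (lateral i j k a b x) = offset i k a x := by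
  rw [offset_apply, lateral_apply_axis hik hjk]
  simp [lateral_apply, hij]

lemma offset_lateral_snd (hij : i ≠ j) (hik : i ≠ k) (hjk : j ≠ k) (a b : ℝ)
    (x : EuclideanSpace ℝ (Fin n)) :
    offset j k b (lateral i j k a b x) = offset j k b x := by
  rw [offset_apply, lateral_apply_axis hik hjk]
  simp [lateral_apply, hij.symm]

lemma det_id_sub_smul_lateral (hij : i ≠ j) (hik : i ≠ k) (hjk : j ≠ k) (a b : ℝ)
    (s : ℝ) :
    LinearMap.det (LinearMap.id - s • (lateral i j k a b : EuclideanSpace ℝ (Fin n) →ₗ[ℝ]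
      EuclideanSpace ℝ (Fin n))) = (1 - s) ^ 2 := by
  have hfac : LinearMap.id - s • (lateral i j k a b : EuclideanSpace ℝ (Fin n) →ₗ[ℝ]
      EuclideanSpace ℝ (Fin n)) =
      LinearMap.transvection ((-s) • (offset i k a : EuclideanSpace ℝ (Fin n) →ₗ[ℝ] ℝ))
        (EuclideanSpace.single i 1) ∘ₗ
      LinearMap.transvection ((-s) • (offset j k b : EuclideanSpace ℝ (Fin n) →ₗ[ℝ] ℝ))
        (EuclideanSpace.single j 1) := by
    have h0 : offset i k a (EuclideanSpace.single j 1) = 0 := by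
      simp [offset_apply, hij, hjk.symm]
    ext1 x
    simp only [LinearMap.comp_apply, LinearMap.transvection.apply, LinearMap.sub_apply,
      LinearMap.id_apply, LinearMap.smul_apply, ContinuousLinearMap.coe_coe, lateral_apply,
      map_add, map_smul, h0, smul_eq_mul, mul_zero]
    module
  rw [hfac, LinearMap.det_comp, LinearMap.transvection.det, LinearMap.transvection.det]
  have h1 : offset i k a (EuclideanSpace.single i 1) = 1 := by
    simp [offset_apply, hik.symm]
  have h2 : offset j k b (EuclideanSpace.single j 1) = 1 := by
    simp [offset_apply, hjk.symm]
  simp only [LinearMap.smul_apply, ContinuousLinearMap.coe_coe, h1, h2]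
  simp only [smul_eq_mul]
  ring

lemma lintegral_comp_sub_smul_lateral (hij : i ≠ j) (hik : i ≠ k) (hjk : j ≠ k) (a b : ℝ)
    {s : ℝ} (hs : s < 1) {g : EuclideanSpace ℝ (Fin n) → ℝ≥0∞}
    (hg : Measurable g) :
    ∫⁻ x, g (x - s • lateral i j k a b x) = ENNReal.ofReal (((1 - s) ^ 2)⁻¹) * ∫⁻ x, g x := by
  have hdet := det_id_sub_smul_lateral hij hik hjk a b s
  set f := LinearMap.id - s • (lateral i j k a b : EuclideanSpace ℝ (Fin n) →ₗ[ℝ]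
      EuclideanSpace ℝ (Fin n)) with hf
  have hne : LinearMap.det f ≠ 0 := by
    rw [hdet]; exact pow_ne_zero 2 (by linarith)
  have hfx : ∀ x, x - s • lateral i j k a b x = f x := fun x => by simp [hf]
  have hmeas : Measurable f := f.continuous_of_finiteDimensional.measurable
  simp_rw [hfx]
  rw [← lintegral_map hg hmeas, Measure.map_linearMap_addHaar_eq_smul_addHaar volume hne, hdet,
    lintegral_smul_measure, smul_eq_mul, abs_of_nonneg (by positivity)]

/-- A function vanishing on the `(1 - τ)`-shrinking of `A` satisfies a Poincaré inequality on `A`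
with a constant linear in `(1 - τ)⁻¹`. -/
lemma lintegral_sq_le_of_eq_zero_on_shrinking (hij : i ≠ j) (hik : i ≠ k) (hjk : j ≠ k) (a b : ℝ)
    {u : EuclideanSpace ℝ (Fin n) → ℝ}
    (hu : ContDiff ℝ 1 u) {A : Set (EuclideanSpace ℝ (Fin n))} (hA : MeasurableSet A) {κ τ : ℝ}
    (hκ : ∀ x ∈ A, ‖lateral i j k a b x‖ ≤ κ) (h0 : 0 ≤ τ) (h1 : τ < 1)
    (hmem : ∀ x ∈ A, ∀ s ∈ Icc 0 τ, x - s • lateral i j k a b x ∈ A)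
    (hzero : ∀ x ∈ A, u (x - τ • lateral i j k a b x) = 0) :
    ∫⁻ x in A, ENNReal.ofReal (u x ^ 2) ≤
      ENNReal.ofReal (κ ^ 2 * (1 - τ)⁻¹) * ∫⁻ x in A, ENNReal.ofReal (‖fderiv ℝ u x‖ ^ 2) := by
  have hg : Measurable fun x => ENNReal.ofReal (‖fderiv ℝ u x‖ ^ 2) :=
    (ENNReal.continuous_ofReal.comp
      ((hu.continuous_fderiv one_ne_zero).norm.pow 2)).measurable
  have h := lintegral_sq_sub_le (μ := volume) hu hA (w := fun x => - lateral i j k a b x)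
    (by fun_prop) (fun x hx => (norm_neg _).trans_le (hκ x hx)) h0 h1.le
  simp only [smul_neg, ← sub_eq_add_neg] at h
  calc ∫⁻ x in A, ENNReal.ofReal (u x ^ 2)
      = ∫⁻ x in A, ENNReal.ofReal ((u x - u (x - τ • lateral i j k a b x)) ^ 2) :=
        setLIntegral_congr_fun hA fun x hx => by simp only [hzero x hx, sub_zero]
    _ ≤ _ := h
    _ ≤ ENNReal.ofReal (κ ^ 2) * ∫⁻ s in Ioc 0 τ, ENNReal.ofReal (((1 - s) ^ 2)⁻¹) *
        ∫⁻ x in A, ENNReal.ofReal (‖fderiv ℝ u x‖ ^ 2) := by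
        refine mul_le_mul' le_rfl (setLIntegral_mono' measurableSet_Ioc fun s hs => ?_)
        rw [← lintegral_indicator hA, ← lintegral_indicator hA,
          ← lintegral_comp_sub_smul_lateral hij hik hjk a b (hs.2.trans_lt h1)
            (hg.indicator hA)]
        refine lintegral_mono fun x => ?_
        by_cases hx : x ∈ A
        · rw [indicator_of_mem hx, indicator_of_mem (hmem x hx s ⟨hs.1.le, hs.2⟩)]
        · rw [indicator_of_notMem hx]
          exact zero_le
    _ = ENNReal.ofReal (κ ^ 2) * ((∫⁻ s in Ioc 0 τ, ENNReal.ofReal (((1 - s) ^ 2)⁻¹)) *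
        ∫⁻ x in A, ENNReal.ofReal (‖fderiv ℝ u x‖ ^ 2)) := by
        rw [lintegral_mul_const _ (by fun_prop)]
    _ ≤ ENNReal.ofReal (κ ^ 2) * (ENNReal.ofReal ((1 - τ)⁻¹) *
        ∫⁻ x in A, ENNReal.ofReal (‖fderiv ℝ u x‖ ^ 2)) := by
        gcongr
        exact lintegral_inv_sq_one_sub_le h0 h1
    _ = _ := by rw [ENNReal.ofReal_mul (sq_nonneg _), mul_assoc]

lemma volume_tube_le (hij : i ≠ j) (hik : i ≠ k) (hjk : j ≠ k) (a b : ℝ)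
    {r : ℝ} (h0 : 0 < r) (h1 : r ≤ 1) :
    volume {x ∈ ball (0 : EuclideanSpace ℝ (Fin n)) 1 | |offset i k a x| ≤ r ∧ |offset j k b x| ≤ r}
      ≤ ENNReal.ofReal (r ^ 2) * volume (ball (0 : EuclideanSpace ℝ (Fin n)) 3) := by
  have hdet := det_id_sub_smul_lateral hij hik hjk a b (1 - r)
  set f := LinearMap.id - (1 - r) • (lateral i j k a b : EuclideanSpace ℝ (Fin n) →ₗ[ℝ]
      EuclideanSpace ℝ (Fin n)) with hf
  have hfx : ∀ x, f x = x - (1 - r) • lateral i j k a b x := fun x => by simp [hf]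
  have hsub : {x ∈ ball (0 : EuclideanSpace ℝ (Fin n)) 1 |
      |offset i k a x| ≤ r ∧ |offset j k b x| ≤ r} ⊆ f '' ball 0 3 := by
    rintro x ⟨hx, hxi, hxj⟩
    have hinv : ∀ t : ℝ, lateral i j k a b (x + t • lateral i j k a b x) =
        (1 + t) • lateral i j k a b x := by
      intro t
      rw [map_add, map_smul, lateral_apply _ _ _ _ _ (lateral i j k a b x),
        offset_lateral_fst hij hik hjk, offset_lateral_snd hij hik hjk, ← lateral_apply]
      module
    have hnorm : ‖lateral i j k a b x‖ ≤ 2 * r :=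
      (norm_lateral_le i j k a b x).trans (by linarith)
    refine ⟨x + (r⁻¹ - 1) • lateral i j k a b x, ?_, ?_⟩
    · rw [mem_ball_zero_iff] at hx ⊢
      have hr : 0 ≤ r⁻¹ - 1 := by linarith [(one_le_inv₀ h0).2 h1]
      calc ‖x + (r⁻¹ - 1) • lateral i j k a b x‖
          ≤ ‖x‖ + ‖(r⁻¹ - 1) • lateral i j k a b x‖ := norm_add_le _ _
        _ = ‖x‖ + (r⁻¹ - 1) * ‖lateral i j k a b x‖ := by
            rw [norm_smul, Real.norm_of_nonneg hr]
        _ ≤ ‖x‖ + (r⁻¹ - 1) * (2 * r) := by gcongr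
        _ = ‖x‖ + 2 - 2 * r := by field_simp; ring
        _ < 3 := by linarith
    · rw [hfx, hinv, show (1 : ℝ) + (r⁻¹ - 1) = r⁻¹ by ring, smul_smul]
      have : (1 - r) * r⁻¹ = r⁻¹ - 1 := by field_simp
      rw [this, add_sub_cancel_right]
  calc _ ≤ volume (f '' ball 0 3) := measure_mono hsub
    _ = _ := by
      rw [Measure.addHaar_image_linearMap, hdet, sub_sub_cancel, abs_of_nonneg (sq_nonneg r)]

end Distinct

end Geometry

section Domain

variable {n : ℕ}

/-- A closed spike around the codimension-two subspace `{x | x i = a * x k, x j = b * x k}`,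
starting at distance `δ` from the origin in the direction `k` and of opening `σ`. -/
def spike (i j k : Fin n) (δ σ a b : ℝ) : Set (EuclideanSpace ℝ (Fin n)) :=
  {x | δ ≤ |x k| ∧ |offset i k a x| ≤ σ * (|x k| - δ) ∧ |offset j k b x| ≤ σ * (|x k| - δ)}

/-- The unit ball with the spikes of slopes `ε * p.1, ε * p.2` removed, for `p` in the finite set
`S`. -/
def spikedBall (i j k : Fin n) (δ ε σ : ℝ) (S : Finset (ℤ × ℤ)) :
    Set (EuclideanSpace ℝ (Fin n)) :=
  ball 0 1 \ ⋃ p ∈ S, spike i j k δ σ (ε * p.1) (ε * p.2)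

lemma isClosed_spike (i j k : Fin n) (δ σ a b : ℝ) : IsClosed (spike i j k δ σ a b) := by
  have hk : Continuous fun x : EuclideanSpace ℝ (Fin n) => |x k| := by fun_prop
  have hl : ∀ (l : Fin n) (c : ℝ),
      IsClosed {x : EuclideanSpace ℝ (Fin n) | |offset l k c x| ≤ σ * (|x k| - δ)} := fun l c =>
    isClosed_le (offset l k c).continuous.abs (by fun_prop)
  exact (isClosed_le continuous_const hk).inter ((hl i a).inter (hl j b))

lemma isOpen_spikedBall (i j k : Fin n) (δ ε σ : ℝ) (S : Finset (ℤ × ℤ)) :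
    IsOpen (spikedBall i j k δ ε σ S) :=
  isOpen_ball.sdiff (S.finite_toSet.isClosed_biUnion fun _ _ => isClosed_spike _ _ _ _ _ _ _)

/-- Spikes contain the shadows of their points when lit from a small ball around the origin. -/
lemma add_smul_sub_mem_spike {i j k : Fin n} {δ σ a b ρ : ℝ} (hσ : 0 ≤ σ)
    (ha : (1 + |a|) * ρ ≤ σ * (δ - ρ)) (hb : (1 + |b|) * ρ ≤ σ * (δ - ρ)) (hρ : ρ ≤ δ)
    {x y : EuclideanSpace ℝ (Fin n)} (hx : x ∈ spike i j k δ σ a b) (hy : ‖y‖ ≤ ρ) {t : ℝ}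
    (ht : 0 ≤ t) : x + t • (x - y) ∈ spike i j k δ σ a b := by
  obtain ⟨h1, h2, h3⟩ := hx
  have hk : (1 + t) * |x k| - t * ρ ≤ |(x + t • (x - y)) k| := by
    have hyk : |y k| ≤ ρ := (PiLp.norm_apply_le y k).trans hy
    have e : (x + t • (x - y)) k = (1 + t) * x k - t * y k := by
      simp only [PiLp.add_apply, PiLp.smul_apply, PiLp.sub_apply, smul_eq_mul]; ring
    rw [e]
    have := abs_sub_abs_le_abs_sub ((1 + t) * x k) (t * y k)
    rw [abs_mul, abs_mul, abs_of_nonneg ht, abs_of_nonneg (by linarith : 0 ≤ 1 + t)] at this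
    nlinarith
  have key : ∀ (l : Fin n) (c : ℝ), (1 + |c|) * ρ ≤ σ * (δ - ρ) →
      |offset l k c x| ≤ σ * (|x k| - δ) →
      |offset l k c (x + t • (x - y))| ≤ σ * (|(x + t • (x - y)) k| - δ) := by
    intro l c hc hl
    have e : offset l k c (x + t • (x - y)) =
        (1 + t) * offset l k c x - t * offset l k c y := by
      simp only [map_add, map_smul, map_sub, smul_eq_mul]; ring
    have hyl : |offset l k c y| ≤ σ * (δ - ρ) :=
      (abs_offset_le l k c y).trans ((mul_le_mul_of_nonneg_left hy (by positivity)).trans hc)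
    calc |offset l k c (x + t • (x - y))|
        ≤ |(1 + t) * offset l k c x| + |t * offset l k c y| := by rw [e]; exact abs_sub _ _
      _ = (1 + t) * |offset l k c x| + t * |offset l k c y| := by
          rw [abs_mul, abs_mul, abs_of_nonneg ht, abs_of_nonneg (by linarith : 0 ≤ 1 + t)]
      _ ≤ (1 + t) * (σ * (|x k| - δ)) + t * (σ * (δ - ρ)) := by gcongr
      _ = σ * (((1 + t) * |x k| - t * ρ) - δ) := by ring
      _ ≤ _ := by gcongr
  refine ⟨?_, key i a ha h2, key j b hb h3⟩
  nlinarith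

lemma convexHull_subset_spikedBall {i j k : Fin n} {δ ε σ B : ℝ} {S : Finset (ℤ × ℤ)}
    (hδ : 0 < δ) (hδ1 : δ ≤ 1) (hσ : 0 < σ) (hB : 0 ≤ B)
    (hS : ∀ p ∈ S, |ε * p.1| ≤ B ∧ |ε * p.2| ≤ B) :
    ∃ ρ : ℝ, 0 < ρ ∧ ∀ x ∈ spikedBall i j k δ ε σ S,
      convexHull ℝ ({x} ∪ ball (0 : EuclideanSpace ℝ (Fin n)) ρ) ⊆ spikedBall i j k δ ε σ S := by
  set ρ := σ * δ / (1 + B + σ) with hρ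
  have hden : 0 < 1 + B + σ := by positivity
  have hρ0 : 0 < ρ := by positivity
  have hρeq : (1 + B) * ρ = σ * (δ - ρ) := by
    rw [hρ]; field_simp; ring
  have hρδ : ρ < δ := by
    by_contra! h
    have := mul_nonpos_of_nonneg_of_nonpos hσ.le (sub_nonpos.2 h)
    have : 0 < (1 + B) * ρ := by positivity
    linarith
  refine ⟨ρ, hρ0, fun x hx z hz => ?_⟩
  have hne : (ball (0 : EuclideanSpace ℝ (Fin n)) ρ).Nonempty := ⟨0, mem_ball_self hρ0⟩
  rw [singleton_union, convexHull_insert hne, (convex_ball _ _).convexHull_eq,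
    mem_convexJoin] at hz
  obtain ⟨x', hx', y, hy, hz⟩ := hz
  obtain rfl : x' = x := hx'
  have hy1 : y ∈ ball (0 : EuclideanSpace ℝ (Fin n)) 1 :=
    ball_subset_ball (by linarith) hy
  refine ⟨(convex_ball _ _).segment_subset hx.1 hy1 hz, fun hmem => ?_⟩
  simp only [mem_iUnion] at hmem
  obtain ⟨p, hp, hzp⟩ := hmem
  rw [mem_ball_zero_iff] at hy
  obtain ⟨s, t, hs, ht, hst, rfl⟩ := hz
  rcases hs.eq_or_lt with rfl | hs
  · obtain rfl : t = 1 := by linarith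
    have h1 := hzp.1
    have h2 : |y k| ≤ ‖y‖ := PiLp.norm_apply_le y k
    simp only [zero_smul, one_smul, zero_add] at h1
    linarith
  · refine hx.2 ?_
    simp only [mem_iUnion]
    refine ⟨p, hp, ?_⟩
    have hbound : ∀ c : ℝ, |c| ≤ B → (1 + |c|) * ρ ≤ σ * (δ - ρ) := by
      intro c hc
      rw [← hρeq]; gcongr
    have := add_smul_sub_mem_spike hσ.le (hbound _ (hS p hp).1) (hbound _ (hS p hp).2) hρδ.le
      hzp hy.le (div_nonneg ht hs.le)
    convert this using 1
    obtain rfl : t = 1 - s := by linarith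
    match_scalars <;> field_simp <;> ring

/-- The part of the region `2 * δ ≤ |x k| ≤ 1` whose points are closest to the spike of index
`p`. -/
def cell (i j k : Fin n) (δ ε : ℝ) (p : ℤ × ℤ) : Set (EuclideanSpace ℝ (Fin n)) :=
  {x | (2 * δ ≤ |x k| ∧ |x k| ≤ 1) ∧
    offset i k (ε * p.1) x / (ε * x k) ∈ Ico (-1 / 2 : ℝ) (1 / 2) ∧
    offset j k (ε * p.2) x / (ε * x k) ∈ Ico (-1 / 2 : ℝ) (1 / 2)}

lemma measurableSet_cell (i j k : Fin n) (δ ε : ℝ) (p : ℤ × ℤ) :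
    MeasurableSet (cell i j k δ ε p) := by
  have hk : Measurable fun x : EuclideanSpace ℝ (Fin n) => x k :=
    Continuous.measurable (by fun_prop)
  have hdiv : ∀ (l : Fin n) (c : ℝ), Measurable fun x => offset l k c x / (ε * x k) := fun l c =>
    (offset l k c).continuous.measurable.div (hk.const_mul ε)
  exact ((measurableSet_le measurable_const hk.abs).inter
    (measurableSet_le hk.abs measurable_const)).inter
    ((hdiv i _ measurableSet_Ico).inter (hdiv j _ measurableSet_Ico))

lemma offset_div {i k : Fin n} {ε : ℝ} (hε : 0 < ε) (m : ℤ) {x : EuclideanSpace ℝ (Fin n)}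
    (hx : x k ≠ 0) : offset i k (ε * m) x / (ε * x k) = x i / (ε * x k) - m := by
  rw [offset_apply]; field_simp

lemma sub_intCast_mem_Ico_iff {r : ℝ} {m : ℤ} :
    r - m ∈ Ico (-1 / 2 : ℝ) (1 / 2) ↔ ⌊r + 1 / 2⌋ = m := by
  rw [Int.floor_eq_iff, mem_Ico]
  constructor <;> rintro ⟨h1, h2⟩ <;> constructor <;> linarith

lemma pairwise_disjoint_cell (i j k : Fin n) {δ ε : ℝ} (hδ : 0 < δ) (hε : 0 < ε) :
    Pairwise (Function.onFun Disjoint (cell i j k δ ε)) := by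
  intro p q hpq
  refine Set.disjoint_left.2 fun x hp hq => hpq ?_
  have hx : x k ≠ 0 := abs_pos.1 (by linarith [hp.1.1])
  have h := fun (l : Fin n) (m : ℤ) => offset_div (i := l) hε m hx
  obtain ⟨-, hp1, hp2⟩ := hp
  obtain ⟨-, hq1, hq2⟩ := hq
  rw [h, sub_intCast_mem_Ico_iff] at hp1 hp2 hq1 hq2
  exact Prod.ext (hp1.symm.trans hq1) (hp2.symm.trans hq2)

lemma exists_mem_cell (i j k : Fin n) {δ ε : ℝ} (hδ : 0 < δ) (hε : 0 < ε) {M : ℕ}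
    (hM1 : 1 ≤ M) (hM : 1 ≤ δ * ε * M) {x : EuclideanSpace ℝ (Fin n)} (hx : ‖x‖ < 1)
    (hk : 2 * δ ≤ |x k|) :
    ∃ p ∈ Finset.Icc (-(M : ℤ)) M ×ˢ Finset.Icc (-(M : ℤ)) M, x ∈ cell i j k δ ε p := by
  have hx0 : x k ≠ 0 := abs_pos.1 (by linarith)
  have hcoord : ∀ l, |x l| ≤ 1 := fun l => (PiLp.norm_apply_le x l).trans hx.le
  have hM1' : (1 : ℝ) ≤ M := by exact_mod_cast hM1
  have hfloor : ∀ l, ⌊x l / (ε * x k) + 1 / 2⌋ ∈ Finset.Icc (-(M : ℤ)) M := by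
    intro l
    have hr : |x l / (ε * x k)| ≤ M / 2 := by
      rw [abs_div, abs_mul, abs_of_pos hε, div_le_iff₀ (by positivity)]
      calc |x l| ≤ 1 := hcoord l
        _ ≤ δ * ε * M := hM
        _ = M / 2 * (ε * (2 * δ)) := by ring
        _ ≤ _ := by gcongr
    rw [abs_le] at hr
    rw [Finset.mem_Icc]
    constructor
    · rw [Int.le_floor]; push_cast; linarith [hr.1]
    · have : ⌊x l / (ε * x k) + 1 / 2⌋ < (M : ℤ) + 1 := by
        rw [Int.floor_lt]; push_cast; linarith [hr.2]
      exact Int.lt_add_one_iff.1 this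
  refine ⟨(⌊x i / (ε * x k) + 1 / 2⌋, ⌊x j / (ε * x k) + 1 / 2⌋),
    Finset.mem_product.2 ⟨hfloor i, hfloor j⟩, ⟨hk, hcoord k⟩, ?_, ?_⟩
  · rw [offset_div hε _ hx0, sub_intCast_mem_Ico_iff]
  · rw [offset_div hε _ hx0, sub_intCast_mem_Ico_iff]

lemma abs_offset_le_of_mem_Ico {l k : Fin n} {ε c : ℝ} (hε : 0 < ε)
    {x : EuclideanSpace ℝ (Fin n)} (hx : x k ≠ 0)
    (h : offset l k c x / (ε * x k) ∈ Ico (-1 / 2 : ℝ) (1 / 2)) :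
    |offset l k c x| ≤ ε * |x k| / 2 := by
  have h' : |offset l k c x / (ε * x k)| ≤ 1 / 2 := abs_le.2 ⟨by linarith [h.1], h.2.le⟩
  have hpos : 0 < |x k| := abs_pos.2 hx
  rw [abs_div, abs_mul, abs_of_pos hε, div_le_iff₀ (by positivity)] at h'
  linarith

lemma lintegral_cell_sq_le {i j k : Fin n} (hij : i ≠ j) (hik : i ≠ k) (hjk : j ≠ k)
    {δ ε σ : ℝ} (hδ : 0 < δ) (hσ : 0 < σ) (hσε : σ ≤ ε) {p : ℤ × ℤ}
    {u : EuclideanSpace ℝ (Fin n) → ℝ} (hu : ContDiff ℝ 1 u)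
    (hzero : ∀ x ∈ spike i j k δ σ (ε * p.1) (ε * p.2), u x = 0) :
    ∫⁻ x in cell i j k δ ε p, ENNReal.ofReal (u x ^ 2) ≤
      ENNReal.ofReal (ε ^ 3 / σ) *
        ∫⁻ x in cell i j k δ ε p, ENNReal.ofReal (‖fderiv ℝ u x‖ ^ 2) := by
  have hε : 0 < ε := hσ.trans_le hσε
  have hne : ∀ x ∈ cell i j k δ ε p, x k ≠ 0 := fun x hx => abs_pos.1 (by linarith [hx.1.1])
  have hoff1 := fun (s : ℝ) (x : EuclideanSpace ℝ (Fin n)) => show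
    offset i k (ε * p.1) (x - s • lateral i j k (ε * p.1) (ε * p.2) x) =
      (1 - s) * offset i k (ε * p.1) x by
    rw [map_sub, map_smul, offset_lateral_fst hij hik hjk, smul_eq_mul]; ring
  have hoff2 := fun (s : ℝ) (x : EuclideanSpace ℝ (Fin n)) => show
    offset j k (ε * p.2) (x - s • lateral i j k (ε * p.1) (ε * p.2) x) =
      (1 - s) * offset j k (ε * p.2) x by
    rw [map_sub, map_smul, offset_lateral_snd hij hik hjk, smul_eq_mul]; ring
  have hax := fun (s : ℝ) (x : EuclideanSpace ℝ (Fin n)) => show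
    (x - s • lateral i j k (ε * p.1) (ε * p.2) x) k = x k by
    simp [lateral_apply_axis hik hjk]
  have h := lintegral_sq_le_of_eq_zero_on_shrinking hij hik hjk (ε * p.1) (ε * p.2) hu
    (measurableSet_cell i j k δ ε p) (κ := ε) (τ := 1 - σ / ε) ?_ ?_ ?_ ?_ ?_
  · refine h.trans_eq ?_
    congr 2
    rw [sub_sub_cancel]; field_simp
  · intro x hx
    have h1 := abs_offset_le_of_mem_Ico hε (hne x hx) hx.2.1
    have h2 := abs_offset_le_of_mem_Ico hε (hne x hx) hx.2.2
    have h3 := mul_le_mul_of_nonneg_left hx.1.2 hε.le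
    exact (norm_lateral_le _ _ _ _ _ _).trans (by linarith)
  · rw [sub_nonneg, div_le_one hε]; exact hσε
  · have : 0 < σ / ε := by positivity
    linarith
  · intro x hx s hs
    have hs1 : s ≤ 1 := hs.2.trans (sub_le_self _ (by positivity))
    have hIco : ∀ c ∈ Ico (-1 / 2 : ℝ) (1 / 2), (1 - s) * c ∈ Ico (-1 / 2 : ℝ) (1 / 2) := by
      rintro c ⟨hc1, hc2⟩
      have hs0 := hs.1
      constructor
      · nlinarith
      · rcases le_or_gt c 0 with hc | hc <;> nlinarith
    refine ⟨?_, ?_, ?_⟩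
    · rw [hax]; exact hx.1
    · rw [hax, hoff1, mul_div_assoc]; exact hIco _ hx.2.1
    · rw [hax, hoff2, mul_div_assoc]; exact hIco _ hx.2.2
  · intro x hx
    apply hzero
    have hb : ∀ {l : Fin n} {c : ℝ}, |offset l k c x| ≤ ε * |x k| / 2 →
        |σ / ε * offset l k c x| ≤ σ * (|x k| - δ) := by
      intro l c hc
      rw [abs_mul, abs_of_pos (by positivity : 0 < σ / ε)]
      calc σ / ε * |offset l k c x| ≤ σ / ε * (ε * |x k| / 2) := by gcongr
        _ = σ * (|x k| - |x k| / 2) := by field_simp; ring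
        _ ≤ _ := by gcongr; linarith [hx.1.1]
    refine ⟨?_, ?_, ?_⟩
    · rw [hax]; linarith [hx.1.1]
    · rw [hax, hoff1, sub_sub_cancel]
      exact hb (abs_offset_le_of_mem_Ico hε (hne x hx) hx.2.1)
    · rw [hax, hoff2, sub_sub_cancel]
      exact hb (abs_offset_le_of_mem_Ico hε (hne x hx) hx.2.2)

/-- Poincaré inequality on the spiked ball, with a small constant when the spikes are dense. -/
lemma lintegral_sq_le_of_eq_zero_off_spikedBall {i j k : Fin n} (hij : i ≠ j) (hik : i ≠ k)
    (hjk : j ≠ k) {δ ε σ : ℝ} (hδ : 0 < δ) (hσ : 0 < σ) (hσε : σ ≤ ε) {M : ℕ} (hM1 : 1 ≤ M)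
    (hM : 1 ≤ δ * ε * M) {u : EuclideanSpace ℝ (Fin n) → ℝ} (hu : ContDiff ℝ 1 u)
    (hzero : ∀ x ∉ spikedBall i j k δ ε σ
      (Finset.Icc (-(M : ℤ)) M ×ˢ Finset.Icc (-(M : ℤ)) M), u x = 0) :
    ∫⁻ x, ENNReal.ofReal (u x ^ 2) ≤
      ENNReal.ofReal (3 * (ε ^ 3 / σ) + 32 * δ ^ 2) *
        ∫⁻ x, ENNReal.ofReal (‖fderiv ℝ u x‖ ^ 2) := by
  have hε : 0 < ε := hσ.trans_le hσε
  set S := Finset.Icc (-(M : ℤ)) M ×ˢ Finset.Icc (-(M : ℤ)) M with hS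
  set I := ∫⁻ x, ENNReal.ofReal (‖fderiv ℝ u x‖ ^ 2) with hI
  set T : Set (EuclideanSpace ℝ (Fin n)) := {x | 2 * δ ≤ |x k|} with hT
  have hTmeas : MeasurableSet T :=
    measurableSet_le measurable_const (Continuous.measurable (by fun_prop))
  have hcell : ∀ p ∈ S, MeasurableSet (cell i j k δ ε p) := fun p _ =>
    measurableSet_cell i j k δ ε p
  have hdisj : (S : Set (ℤ × ℤ)).PairwiseDisjoint (cell i j k δ ε) := fun p _ q _ hpq =>
    pairwise_disjoint_cell i j k hδ hε hpq
  have hmeas : Measurable fun x => ENNReal.ofReal (u x ^ 2) :=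
    (ENNReal.continuous_ofReal.comp (hu.continuous.pow 2)).measurable
  have houter : ∫⁻ x in T, ENNReal.ofReal (u x ^ 2) ≤ ENNReal.ofReal (ε ^ 3 / σ) * I := by
    calc ∫⁻ x in T, ENNReal.ofReal (u x ^ 2)
        ≤ ∫⁻ x in ⋃ p ∈ S, cell i j k δ ε p, ENNReal.ofReal (u x ^ 2) := by
          rw [← lintegral_indicator hTmeas, ← lintegral_indicator (S.measurableSet_biUnion hcell)]
          refine lintegral_mono fun x => ?_
          by_cases hx : x ∈ T
          · rw [indicator_of_mem hx]
            by_cases hx1 : ‖x‖ < 1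
            · obtain ⟨p, hp, hxp⟩ := exists_mem_cell i j k hδ hε hM1 hM hx1 hx
              rw [indicator_of_mem (s := ⋃ p ∈ S, cell i j k δ ε p) (mem_biUnion hp hxp)]
            · rw [hzero x fun h => hx1 (mem_ball_zero_iff.1 h.1)]
              simp
          · rw [indicator_of_notMem hx]
            exact zero_le
      _ = ∑ p ∈ S, ∫⁻ x in cell i j k δ ε p, ENNReal.ofReal (u x ^ 2) :=
          lintegral_biUnion_finset hdisj hcell _
      _ ≤ ∑ p ∈ S, ENNReal.ofReal (ε ^ 3 / σ) *
            ∫⁻ x in cell i j k δ ε p, ENNReal.ofReal (‖fderiv ℝ u x‖ ^ 2) :=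
          Finset.sum_le_sum fun p hp => lintegral_cell_sq_le hij hik hjk hδ hσ hσε hu
            fun x hx => hzero x fun h => h.2 (mem_biUnion hp hx)
      _ = ENNReal.ofReal (ε ^ 3 / σ) *
            ∫⁻ x in ⋃ p ∈ S, cell i j k δ ε p, ENNReal.ofReal (‖fderiv ℝ u x‖ ^ 2) := by
          rw [← Finset.mul_sum, lintegral_biUnion_finset hdisj hcell]
      _ ≤ _ := by gcongr; exact setLIntegral_le_lintegral _ _
  set v : EuclideanSpace ℝ (Fin n) := EuclideanSpace.single k (4 * δ) with hv
  have hvnorm : ‖v‖ = 4 * δ := by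
    rw [hv, PiLp.norm_single, Real.norm_of_nonneg (by positivity)]
  have hvT : ∀ x ∈ Tᶜ, x + v ∈ T := by
    intro x hx
    simp only [hT, mem_compl_iff, mem_ofPred_eq, not_le] at hx ⊢
    have : (x + v) k = x k + 4 * δ := by simp [hv]
    rw [this]
    exact le_trans (by linarith [(abs_lt.1 hx).1]) (le_abs_self _)
  have htrans : ∫⁻ x in Tᶜ, ENNReal.ofReal (u (x + v) ^ 2) ≤
      ∫⁻ x in T, ENNReal.ofReal (u x ^ 2) := by
    rw [← lintegral_indicator hTmeas, ← lintegral_indicator hTmeas.compl,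
      ← lintegral_add_right_eq_self (T.indicator _) v]
    refine lintegral_mono fun x => ?_
    by_cases hx : x ∈ Tᶜ
    · rw [indicator_of_mem hx, indicator_of_mem (hvT x hx)]
    · rw [indicator_of_notMem hx]
      exact zero_le
  have hinner : ∫⁻ x in Tᶜ, ENNReal.ofReal (u x ^ 2) ≤
      ENNReal.ofReal (32 * δ ^ 2) * I + ENNReal.ofReal 2 * (ENNReal.ofReal (ε ^ 3 / σ) * I) := by
    calc ∫⁻ x in Tᶜ, ENNReal.ofReal (u x ^ 2)
        ≤ ∫⁻ x in Tᶜ, (ENNReal.ofReal 2 * ENNReal.ofReal ((u x - u (x + v)) ^ 2) +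
            ENNReal.ofReal 2 * ENNReal.ofReal (u (x + v) ^ 2)) := by
          refine lintegral_mono fun x => ?_
          rw [← mul_add, ← ENNReal.ofReal_add (sq_nonneg _) (sq_nonneg _),
            ← ENNReal.ofReal_mul zero_le_two]
          apply ENNReal.ofReal_le_ofReal
          nlinarith [sq_nonneg (u x - 2 * u (x + v))]
      _ = ENNReal.ofReal 2 * (∫⁻ x in Tᶜ, ENNReal.ofReal ((u x - u (x + v)) ^ 2)) +
            ENNReal.ofReal 2 * ∫⁻ x in Tᶜ, ENNReal.ofReal (u (x + v) ^ 2) := by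
          have hshift : Measurable fun x => ENNReal.ofReal (u (x + v) ^ 2) :=
            hmeas.comp (measurable_add_const v)
          rw [lintegral_add_right _ (hshift.const_mul _),
            lintegral_const_mul' _ _ ENNReal.ofReal_ne_top,
            lintegral_const_mul' _ _ ENNReal.ofReal_ne_top]
      _ ≤ ENNReal.ofReal 2 * (ENNReal.ofReal (‖v‖ ^ 2) * I) +
            ENNReal.ofReal 2 * (ENNReal.ofReal (ε ^ 3 / σ) * I) := by
          gcongr
          · exact lintegral_sq_sub_translate_le hu hTmeas.compl v
          · exact htrans.trans houter
      _ = _ := by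
          rw [← mul_assoc, ← ENNReal.ofReal_mul zero_le_two, hvnorm,
            show 2 * (4 * δ) ^ 2 = 32 * δ ^ 2 by ring]
  rw [← lintegral_add_compl _ hTmeas, ENNReal.ofReal_add (by positivity) (by positivity),
    show 3 * (ε ^ 3 / σ) = ε ^ 3 / σ + 2 * (ε ^ 3 / σ) by ring,
    ENNReal.ofReal_add (by positivity) (by positivity), ENNReal.ofReal_mul zero_le_two]
  refine (add_le_add houter hinner).trans_eq ?_
  ring

end Domain

section Spectral

variable {n : ℕ} {Ω : Set (EuclideanSpace ℝ (Fin n))} {u : EuclideanSpace ℝ (Fin n) → ℝ}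

lemma TestFun.eq_zero (hu : TestFun Ω u) {x : EuclideanSpace ℝ (Fin n)} (hx : x ∉ Ω) : u x = 0 :=
  image_eq_zero_of_notMem_tsupport fun h => hx (hu.2.2 h)

lemma TestFun.contDiff_one (hu : TestFun Ω u) : ContDiff ℝ 1 u :=
  hu.1.of_le (by exact_mod_cast le_top)

lemma TestFun.fderiv_eq_zero (hu : TestFun Ω u) {x : EuclideanSpace ℝ (Fin n)} (hx : x ∉ Ω) :
    fderiv ℝ u x = 0 :=
  image_eq_zero_of_notMem_tsupport fun h => hx (hu.2.2 (tsupport_fderiv_subset ℝ h))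

/-- A Poincaré inequality with constant `K` bounds the fundamental frequency below by `1 / K`. -/
lemma inv_le_Lambda {K : ℝ} (hK : 0 < K) (hne : ∃ u, TestFun Ω u ∧ u ≠ 0)
    (h : ∀ u, TestFun Ω u → ∫⁻ x, ENNReal.ofReal (u x ^ 2) ≤
      ENNReal.ofReal K * ∫⁻ x, ENNReal.ofReal (‖fderiv ℝ u x‖ ^ 2)) : K⁻¹ ≤ Lambda Ω := by
  obtain ⟨u₀, hu₀, hu₀ne⟩ := hne
  refine le_csInf ⟨_, u₀, hu₀, hu₀ne, rfl⟩ ?_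
  rintro r ⟨u, hu, hune, rfl⟩
  have hcont : Continuous u := hu.contDiff_one.continuous
  have hdcont : Continuous (fderiv ℝ u) := hu.contDiff_one.continuous_fderiv one_ne_zero
  have hcs : HasCompactSupport fun x => u x ^ 2 := hu.2.1.comp_left (g := fun t => t ^ 2) (by simp)
  have hdcs : HasCompactSupport fun x => ‖fderiv ℝ u x‖ ^ 2 :=
    (hu.2.1.fderiv ℝ).comp_left (g := fun t => ‖t‖ ^ 2) (by simp)
  have hi : Integrable fun x => u x ^ 2 := (hcont.pow 2).integrable_of_hasCompactSupport hcs
  have hdi : Integrable fun x => ‖fderiv ℝ u x‖ ^ 2 :=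
    (hdcont.norm.pow 2).integrable_of_hasCompactSupport hdcs
  obtain ⟨x₀, hx₀⟩ := Function.ne_iff.1 hune
  have hpos : 0 < ∫ x, u x ^ 2 :=
    (hcont.pow 2).integral_pos_of_hasCompactSupport_nonneg_nonzero hcs (fun x => sq_nonneg _)
      (x := x₀) (pow_ne_zero 2 hx₀)
  rw [setIntegral_eq_integral_of_forall_compl_eq_zero fun x hx => by simp [hu.fderiv_eq_zero hx],
    setIntegral_eq_integral_of_forall_compl_eq_zero fun x hx => by simp [hu.eq_zero hx]]
  have hle := h u hu
  rw [← ofReal_integral_eq_lintegral_ofReal hi (Eventually.of_forall fun x => sq_nonneg _),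
    ← ofReal_integral_eq_lintegral_ofReal hdi (Eventually.of_forall fun x => sq_nonneg _),
    ← ENNReal.ofReal_mul hK.le, ENNReal.ofReal_le_ofReal_iff
      (mul_nonneg hK.le (integral_nonneg fun x => sq_nonneg _))] at hle
  rw [le_div_iff₀ hpos, inv_mul_le_iff₀ hK]
  exact hle

lemma cheegerConst_nonneg : 0 ≤ cheegerConst Ω := by
  refine Real.sInf_nonneg ?_
  rintro r ⟨u, -, -, rfl⟩
  exact div_nonneg (integral_nonneg fun x => norm_nonneg _) (integral_nonneg fun x => abs_nonneg _)

lemma cheegerConst_le (hu : TestFun Ω u) (hne : u ≠ 0) :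
    cheegerConst Ω ≤ (∫ x in Ω, ‖fderiv ℝ u x‖) / ∫ x in Ω, |u x| := by
  refine csInf_le ⟨0, ?_⟩ ⟨u, hu, hne, rfl⟩
  rintro r ⟨u, -, -, rfl⟩
  exact div_nonneg (integral_nonneg fun x => norm_nonneg _) (integral_nonneg fun x => abs_nonneg _)

end Spectral

section Cutoff

variable {n : ℕ}

lemma exists_bound_deriv_smoothTransition :
    ∃ D : ℝ, 0 < D ∧ ∀ t ∈ Icc (-3 : ℝ) 1, |deriv Real.smoothTransition t| ≤ D := by
  have hc : Continuous (deriv Real.smoothTransition) :=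
    (Real.smoothTransition.contDiff (n := 1)).continuous_deriv le_rfl
  obtain ⟨D, hD⟩ := isCompact_Icc.exists_bound_of_continuousOn (s := Icc (-3 : ℝ) 1) hc.continuousOn
  exact ⟨max D 1, by positivity, fun t ht => (hD t ht).trans (le_max_left _ _)⟩

/-- The points of the unit ball near the codimension-two subspace
`{x | x i = a * x k, x j = b * x k}`. -/
def tube (i j k : Fin n) (r a b : ℝ) : Set (EuclideanSpace ℝ (Fin n)) :=
  {x ∈ ball (0 : EuclideanSpace ℝ (Fin n)) 1 | |offset i k a x| ≤ r ∧ |offset j k b x| ≤ r}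

/-- A smooth function vanishing near the subspace `{x | x i = a * x k, x j = b * x k}` and equal
to `1` at distance about `r` from it. -/
def tubeCutoff (i j k : Fin n) (r a b : ℝ) (x : EuclideanSpace ℝ (Fin n)) : ℝ :=
  Real.smoothTransition (4 / r ^ 2 * (offset i k a x ^ 2 + offset j k b x ^ 2) - 3)

lemma measurableSet_tube (i j k : Fin n) (r a b : ℝ) : MeasurableSet (tube i j k r a b) :=
  measurableSet_ball.inter
    ((measurableSet_le (offset i k a).continuous.abs.measurable measurable_const).inter
      (measurableSet_le (offset j k b).continuous.abs.measurable measurable_const))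

lemma volume_real_tube_le {i j k : Fin n} (hij : i ≠ j) (hik : i ≠ k) (hjk : j ≠ k) {r : ℝ}
    (a b : ℝ) (h0 : 0 < r) (h1 : r ≤ 1) :
    volume.real (tube i j k r a b) ≤
      r ^ 2 * volume.real (ball (0 : EuclideanSpace ℝ (Fin n)) 3) := by
  have h := ENNReal.toReal_mono
    (ENNReal.mul_ne_top ENNReal.ofReal_ne_top measure_ball_lt_top.ne)
    (volume_tube_le hij hik hjk a b h0 h1)
  rwa [ENNReal.toReal_mul, ENNReal.toReal_ofReal (sq_nonneg r)] at h

lemma volume_tube_ne_top (i j k : Fin n) (r a b : ℝ) : volume (tube i j k r a b) ≠ ∞ :=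
  ((measure_mono fun _ hx => hx.1).trans_lt (measure_ball_lt_top (x := 0) (r := 1))).ne

lemma contDiff_tubeCutoff (i j k : Fin n) (r a b : ℝ) :
    ContDiff ℝ (⊤ : ℕ∞) (tubeCutoff i j k r a b) := by
  refine Real.smoothTransition.contDiff.comp ?_
  have hi := (offset i k a).contDiff (n := (⊤ : ℕ∞))
  have hj := (offset j k b).contDiff (n := (⊤ : ℕ∞))
  exact (contDiff_const.mul ((hi.pow 2).add (hj.pow 2))).sub contDiff_const

lemma tubeCutoff_nonneg (i j k : Fin n) (r a b : ℝ) (x : EuclideanSpace ℝ (Fin n)) :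
    0 ≤ tubeCutoff i j k r a b x := Real.smoothTransition.nonneg _

lemma tubeCutoff_le_one (i j k : Fin n) (r a b : ℝ) (x : EuclideanSpace ℝ (Fin n)) :
    tubeCutoff i j k r a b x ≤ 1 := Real.smoothTransition.le_one _

lemma tubeCutoff_eq_zero_iff {i j k : Fin n} {r a b : ℝ} (hr : 0 < r)
    {x : EuclideanSpace ℝ (Fin n)} :
    tubeCutoff i j k r a b x = 0 ↔ offset i k a x ^ 2 + offset j k b x ^ 2 ≤ 3 / 4 * r ^ 2 := by
  rw [tubeCutoff, Real.smoothTransition.zero_iff_nonpos, sub_nonpos, div_mul_eq_mul_div,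
    div_le_iff₀ (by positivity)]
  constructor <;> intro h <;> linarith

lemma tubeCutoff_eq_one {i j k : Fin n} {r a b : ℝ} (hr : 0 < r)
    {x : EuclideanSpace ℝ (Fin n)} (hx : r ^ 2 ≤ offset i k a x ^ 2 + offset j k b x ^ 2) :
    tubeCutoff i j k r a b x = 1 := by
  apply Real.smoothTransition.one_of_one_le
  rw [le_sub_iff_add_le, div_mul_eq_mul_div, le_div_iff₀ (by positivity)]
  linarith

lemma lt_sq_add_sq_of_notMem_tube {i j k : Fin n} {r a b : ℝ} (hr : 0 < r)
    {x : EuclideanSpace ℝ (Fin n)} (hx : x ∈ ball (0 : EuclideanSpace ℝ (Fin n)) 1)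
    (hxt : x ∉ tube i j k r a b) : r ^ 2 < offset i k a x ^ 2 + offset j k b x ^ 2 := by
  by_contra! h
  exact hxt ⟨hx, abs_le_of_sq_le_sq (by nlinarith [sq_nonneg (offset j k b x)]) hr.le,
    abs_le_of_sq_le_sq (by nlinarith [sq_nonneg (offset i k a x)]) hr.le⟩

lemma norm_fderiv_tubeCutoff_le {i j k : Fin n} {r a b B D : ℝ} (hr : 0 < r) (ha : |a| ≤ B)
    (hb : |b| ≤ B) (hD : ∀ t ∈ Icc (-3 : ℝ) 1, |deriv Real.smoothTransition t| ≤ D)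
    {x : EuclideanSpace ℝ (Fin n)} (hx : x ∈ ball (0 : EuclideanSpace ℝ (Fin n)) 1) :
    ‖fderiv ℝ (tubeCutoff i j k r a b) x‖ ≤
      (tube i j k r a b).indicator (fun _ => 16 * D * (1 + B) / r) x := by
  have hB : 0 ≤ B := (abs_nonneg a).trans ha
  have hD0 : 0 ≤ D := (abs_nonneg _).trans (hD 0 (by norm_num))
  have hcq : Continuous fun x => offset i k a x ^ 2 + offset j k b x ^ 2 := by fun_prop
  by_cases hq : r ^ 2 < offset i k a x ^ 2 + offset j k b x ^ 2
  · have heq : tubeCutoff i j k r a b =ᶠ[𝓝 x] fun _ => 1 := by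
      filter_upwards [(isOpen_lt continuous_const hcq).mem_nhds hq] with y hy
      exact tubeCutoff_eq_one hr (le_of_lt hy)
    rw [heq.fderiv_eq, fderiv_fun_const, Pi.zero_apply, norm_zero]
    exact indicator_nonneg (fun _ _ => by positivity) x
  · have hxt : x ∈ tube i j k r a b := by
      by_contra hxt
      exact hq (lt_sq_add_sq_of_notMem_tube hr hx hxt)
    rw [indicator_of_mem hxt]
    push Not at hq
    have hqd : HasFDerivAt
        (fun x => 4 / r ^ 2 * (offset i k a x ^ 2 + offset j k b x ^ 2) - 3)
        ((4 / r ^ 2) • ((2 * offset i k a x) • offset i k a +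
          (2 * offset j k b x) • offset j k b)) x := by
      have hi := ((offset i k a).hasFDerivAt (x := x)).pow 2
      have hj := ((offset j k b).hasFDerivAt (x := x)).pow 2
      simpa using ((hi.add hj).const_mul (4 / r ^ 2)).sub_const 3
    have hS : HasDerivAt Real.smoothTransition
        (deriv Real.smoothTransition
          (4 / r ^ 2 * (offset i k a x ^ 2 + offset j k b x ^ 2) - 3))
        (4 / r ^ 2 * (offset i k a x ^ 2 + offset j k b x ^ 2) - 3) :=
      ((Real.smoothTransition.contDiff (n := 1)).differentiable one_ne_zero _).hasDerivAt
    have hcomp : HasFDerivAt (tubeCutoff i j k r a b) _ x := hS.comp_hasFDerivAt x hqd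
    rw [hcomp.fderiv, norm_smul, Real.norm_eq_abs, norm_smul, Real.norm_of_nonneg (by positivity)]
    have hDb : |deriv Real.smoothTransition
        (4 / r ^ 2 * (offset i k a x ^ 2 + offset j k b x ^ 2) - 3)| ≤ D := by
      apply hD
      have h0 : 0 ≤ 4 / r ^ 2 * (offset i k a x ^ 2 + offset j k b x ^ 2) := by positivity
      have h4 : 4 / r ^ 2 * (offset i k a x ^ 2 + offset j k b x ^ 2) ≤ 4 := by
        rw [div_mul_eq_mul_div, div_le_iff₀ (by positivity)]
        linarith
      constructor <;> linarith
    have hterm : ∀ (l : Fin n) (c : ℝ), |c| ≤ B → |offset l k c x| ≤ r →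
        ‖(2 * offset l k c x) • offset l k c‖ ≤ 2 * r * (1 + B) := by
      intro l c hc hl
      rw [norm_smul, Real.norm_eq_abs, abs_mul, abs_two]
      have := norm_offset_le l k c
      gcongr
      linarith
    calc _ ≤ D * (4 / r ^ 2 * (2 * r * (1 + B) + 2 * r * (1 + B))) := by
          gcongr
          exact (norm_add_le _ _).trans (add_le_add (hterm i a ha hxt.2.1) (hterm j b hb hxt.2.2))
      _ = _ := by field_simp; ring

end Cutoff

section Products

variable {E : Type*} [NormedAddCommGroup E] [NormedSpace ℝ E]

lemma norm_fderiv_mul_le {f g : E → ℝ} {x : E} (hf : DifferentiableAt ℝ f x)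
    (hg : DifferentiableAt ℝ g x) (hf1 : |f x| ≤ 1) (hg1 : |g x| ≤ 1) :
    ‖fderiv ℝ (fun y => f y * g y) x‖ ≤ ‖fderiv ℝ f x‖ + ‖fderiv ℝ g x‖ := by
  rw [fderiv_fun_mul hf hg]
  refine (norm_add_le _ _).trans ?_
  rw [norm_smul, norm_smul, Real.norm_eq_abs, Real.norm_eq_abs, add_comm]
  gcongr
  · exact mul_le_of_le_one_left (norm_nonneg _) hg1
  · exact mul_le_of_le_one_left (norm_nonneg _) hf1

lemma norm_fderiv_prod_le {ι : Type*} (S : Finset ι) {f : ι → E → ℝ} {x : E}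
    (hf : ∀ p, Differentiable ℝ (f p)) (hf0 : ∀ p y, 0 ≤ f p y) (hf1 : ∀ p y, f p y ≤ 1) :
    ‖fderiv ℝ (fun y => ∏ p ∈ S, f p y) x‖ ≤ ∑ p ∈ S, ‖fderiv ℝ (f p) x‖ := by
  classical
  induction S using Finset.induction_on with
  | empty => simp
  | insert p S hp ih =>
    simp only [Finset.prod_insert hp, Finset.sum_insert hp]
    refine (norm_fderiv_mul_le (hf p x) ?_ ?_ ?_).trans (by gcongr)
    · exact (HasFDerivAt.finsetProd fun q _ => (hf q x).hasFDerivAt).differentiableAt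
    · rw [abs_of_nonneg (hf0 p x)]
      exact hf1 p x
    · rw [abs_of_nonneg (Finset.prod_nonneg fun q _ => hf0 q x)]
      exact Finset.prod_le_one (fun q _ => hf0 q x) fun q _ => hf1 q x

end Products

section PerforatedBump

variable {n : ℕ}

/-- A bump function of the half-radius ball, cut off near the axes of the spikes. -/
def perforatedBump (ψ : ContDiffBump (0 : EuclideanSpace ℝ (Fin n))) (i j k : Fin n) (r ε : ℝ)
    (S : Finset (ℤ × ℤ)) (x : EuclideanSpace ℝ (Fin n)) : ℝ :=
  ψ x * ∏ p ∈ S, tubeCutoff i j k r (ε * p.1) (ε * p.2) x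

variable {ψ : ContDiffBump (0 : EuclideanSpace ℝ (Fin n))} {i j k : Fin n} {δ ε σ r B D : ℝ}
  {S : Finset (ℤ × ℤ)}

lemma contDiff_perforatedBump : ContDiff ℝ (⊤ : ℕ∞) (perforatedBump ψ i j k r ε S) :=
  ψ.contDiff.mul (contDiff_prod fun _ _ => contDiff_tubeCutoff _ _ _ _ _ _)

lemma testFun_perforatedBump (hψ : ψ.rOut < 1) (hδ : 0 < δ) (hσ : 0 < σ) :
    TestFun (spikedBall i j k δ ε σ S) (perforatedBump ψ i j k (2 * σ) ε S) := by
  refine ⟨contDiff_perforatedBump, ψ.hasCompactSupport.mul_right, fun x hx => ?_⟩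
  have hxψ : x ∈ closedBall (0 : EuclideanSpace ℝ (Fin n)) ψ.rOut :=
    ψ.tsupport_eq ▸ tsupport_mul_subset_left hx
  have hx1 : x ∈ ball (0 : EuclideanSpace ℝ (Fin n)) 1 := closedBall_subset_ball hψ hxψ
  refine ⟨hx1, ?_⟩
  simp only [mem_iUnion, not_exists]
  rintro p hp ⟨hk, hi, hj⟩
  have hq : 3 / 4 * (2 * σ) ^ 2 ≤ offset i k (ε * p.1) x ^ 2 + offset j k (ε * p.2) x ^ 2 := by
    have hcl : IsClosed {x : EuclideanSpace ℝ (Fin n) | 3 / 4 * (2 * σ) ^ 2 ≤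
        offset i k (ε * p.1) x ^ 2 + offset j k (ε * p.2) x ^ 2} :=
      isClosed_le continuous_const (by fun_prop)
    refine closure_minimal (fun y hy => ?_) hcl hx
    by_contra hlt
    refine hy (mul_eq_zero_of_right _ (Finset.prod_eq_zero hp ?_))
    exact (tubeCutoff_eq_zero_iff (by positivity)).2 (not_le.1 hlt).le
  have hxk : |x k| ≤ 1 := (PiLp.norm_apply_le x k).trans (mem_ball_zero_iff.1 hx1).le
  have hle : σ * (|x k| - δ) ≤ σ := mul_le_of_le_one_right hσ.le (by linarith)
  have h1 := sq_le_sq' (abs_le.1 (hi.trans hle)).1 (abs_le.1 (hi.trans hle)).2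
  have h2 := sq_le_sq' (abs_le.1 (hj.trans hle)).1 (abs_le.1 (hj.trans hle)).2
  nlinarith

lemma perforatedBump_nonneg (x : EuclideanSpace ℝ (Fin n)) :
    0 ≤ perforatedBump ψ i j k r ε S x :=
  mul_nonneg ψ.nonneg (Finset.prod_nonneg fun _ _ => tubeCutoff_nonneg _ _ _ _ _ _ _)

lemma integrable_indicator_tube (r a b c : ℝ) :
    Integrable ((tube i j k r a b).indicator fun _ => c) :=
  (integrable_indicator_iff (measurableSet_tube _ _ _ _ _ _)).2
    (integrableOn_const (volume_tube_ne_top _ _ _ _ _ _))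

lemma integral_sum_indicator_tube_le (hij : i ≠ j) (hik : i ≠ k) (hjk : j ≠ k) (h0 : 0 < r)
    (h1 : r ≤ 1) {c : ℝ} (hc : 0 ≤ c) :
    ∫ x, ∑ p ∈ S, (tube i j k r (ε * p.1) (ε * p.2)).indicator (fun _ => c) x ≤
      S.card * (r ^ 2 * volume.real (ball (0 : EuclideanSpace ℝ (Fin n)) 3) * c) := by
  rw [integral_finsetSum _ fun p _ => integrable_indicator_tube _ _ _ _, ← nsmul_eq_mul]
  refine Finset.sum_le_card_nsmul _ _ _ fun p _ => ?_
  rw [integral_indicator_const _ (measurableSet_tube _ _ _ _ _ _), smul_eq_mul]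
  exact mul_le_mul_of_nonneg_right (volume_real_tube_le hij hik hjk _ _ h0 h1) hc

lemma norm_fderiv_perforatedBump_le (hr : 0 < r) (hS : ∀ p ∈ S, |ε * p.1| ≤ B ∧ |ε * p.2| ≤ B)
    (hD : ∀ t ∈ Icc (-3 : ℝ) 1, |deriv Real.smoothTransition t| ≤ D)
    {x : EuclideanSpace ℝ (Fin n)} (hx : x ∈ ball (0 : EuclideanSpace ℝ (Fin n)) 1) :
    ‖fderiv ℝ (perforatedBump ψ i j k r ε S) x‖ ≤ ‖fderiv ℝ ψ x‖ +
      ∑ p ∈ S, (tube i j k r (ε * p.1) (ε * p.2)).indicator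
        (fun _ => 16 * D * (1 + B) / r) x := by
  have hd : ∀ p : ℤ × ℤ, Differentiable ℝ (tubeCutoff i j k r (ε * p.1) (ε * p.2)) := fun p =>
    (contDiff_tubeCutoff _ _ _ _ _ _).differentiable (by simp)
  have hprod0 : 0 ≤ ∏ p ∈ S, tubeCutoff i j k r (ε * p.1) (ε * p.2) x :=
    Finset.prod_nonneg fun _ _ => tubeCutoff_nonneg _ _ _ _ _ _ _
  refine (norm_fderiv_mul_le ((ψ.contDiff (n := 1)).differentiable one_ne_zero x)
    (HasFDerivAt.finsetProd fun p _ => (hd p x).hasFDerivAt).differentiableAt ?_ ?_).trans ?_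
  · rw [abs_of_nonneg ψ.nonneg]
    exact ψ.le_one
  · rw [abs_of_nonneg hprod0]
    exact Finset.prod_le_one (fun _ _ => tubeCutoff_nonneg _ _ _ _ _ _ _)
      fun _ _ => tubeCutoff_le_one _ _ _ _ _ _ _
  · gcongr
    refine (norm_fderiv_prod_le S hd (fun _ _ => tubeCutoff_nonneg _ _ _ _ _ _ _)
      fun _ _ => tubeCutoff_le_one _ _ _ _ _ _ _).trans ?_
    exact Finset.sum_le_sum fun p hp =>
      norm_fderiv_tubeCutoff_le hr (hS p hp).1 (hS p hp).2 hD hx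

lemma setIntegral_norm_fderiv_perforatedBump_le (hij : i ≠ j) (hik : i ≠ k) (hjk : j ≠ k)
    (h0 : 0 < r) (h1 : r ≤ 1) (hB : 0 ≤ B) (hS : ∀ p ∈ S, |ε * p.1| ≤ B ∧ |ε * p.2| ≤ B)
    (hD : ∀ t ∈ Icc (-3 : ℝ) 1, |deriv Real.smoothTransition t| ≤ D)
    {Ω : Set (EuclideanSpace ℝ (Fin n))} (hΩm : MeasurableSet Ω) (hΩ : Ω ⊆ ball 0 1) :
    ∫ x in Ω, ‖fderiv ℝ (perforatedBump ψ i j k r ε S) x‖ ≤ (∫ x, ‖fderiv ℝ ψ x‖) +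
      S.card * r * (16 * D * (1 + B) * volume.real (ball (0 : EuclideanSpace ℝ (Fin n)) 3)) := by
  have hD0 : 0 ≤ D := (abs_nonneg _).trans (hD 0 (by norm_num))
  have hψi : Integrable fun x => ‖fderiv ℝ ψ x‖ :=
    ((ψ.contDiff (n := 1)).continuous_fderiv one_ne_zero).norm.integrable_of_hasCompactSupport
      (ψ.hasCompactSupport.fderiv ℝ).norm
  have hSi : Integrable fun x => ∑ p ∈ S, (tube i j k r (ε * p.1) (ε * p.2)).indicator
      (fun _ => 16 * D * (1 + B) / r) x :=
    integrable_finsetSum _ fun p _ => integrable_indicator_tube _ _ _ _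
  calc ∫ x in Ω, ‖fderiv ℝ (perforatedBump ψ i j k r ε S) x‖
      ≤ ∫ x in Ω, (‖fderiv ℝ ψ x‖ + ∑ p ∈ S,
          (tube i j k r (ε * p.1) (ε * p.2)).indicator (fun _ => 16 * D * (1 + B) / r) x) := by
        refine integral_mono_of_nonneg (Eventually.of_forall fun x => norm_nonneg _)
          (hψi.add hSi).integrableOn ?_
        filter_upwards [ae_restrict_mem hΩm] with x hx
        exact norm_fderiv_perforatedBump_le h0 hS hD (hΩ hx)
    _ ≤ ∫ x, (‖fderiv ℝ ψ x‖ + ∑ p ∈ S,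
          (tube i j k r (ε * p.1) (ε * p.2)).indicator (fun _ => 16 * D * (1 + B) / r) x) := by
        refine setIntegral_le_integral (hψi.add hSi) (Eventually.of_forall fun x => ?_)
        exact add_nonneg (norm_nonneg _) (Finset.sum_nonneg fun p _ =>
          indicator_nonneg (fun _ _ => by positivity) x)
    _ ≤ (∫ x, ‖fderiv ℝ ψ x‖) + S.card * (r ^ 2 *
          volume.real (ball (0 : EuclideanSpace ℝ (Fin n)) 3) * (16 * D * (1 + B) / r)) := by
        rw [integral_add hψi hSi]
        gcongr
        exact integral_sum_indicator_tube_le hij hik hjk h0 h1 (by positivity)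
    _ = _ := by field_simp

lemma le_perforatedBump (h0 : 0 < r) (hψ : ψ.rIn ≤ 1) (x : EuclideanSpace ℝ (Fin n)) :
    (ball (0 : EuclideanSpace ℝ (Fin n)) ψ.rIn).indicator (fun _ => (1 : ℝ)) x -
      ∑ p ∈ S, (tube i j k r (ε * p.1) (ε * p.2)).indicator (fun _ => (1 : ℝ)) x ≤
      perforatedBump ψ i j k r ε S x := by
  have hpos : ∀ p : ℤ × ℤ, 0 ≤ (tube i j k r (ε * p.1) (ε * p.2)).indicator (fun _ => (1 : ℝ)) x :=
    fun p => indicator_nonneg (fun _ _ => zero_le_one) x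
  by_cases hx : x ∈ ball (0 : EuclideanSpace ℝ (Fin n)) ψ.rIn
  · rw [indicator_of_mem hx]
    by_cases ht : ∃ p ∈ S, x ∈ tube i j k r (ε * p.1) (ε * p.2)
    · obtain ⟨p, hp, hxp⟩ := ht
      have h := Finset.single_le_sum (fun p _ => hpos p) hp
      rw [indicator_of_mem hxp] at h
      linarith [perforatedBump_nonneg (ψ := ψ) (i := i) (j := j) (k := k) (r := r) (ε := ε)
        (S := S) x]
    · push Not at ht
      have h1 : perforatedBump ψ i j k r ε S x = 1 := by
        rw [perforatedBump, ψ.one_of_mem_closedBall (ball_subset_closedBall hx), one_mul]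
        exact Finset.prod_eq_one fun p hp => tubeCutoff_eq_one h0
          (lt_sq_add_sq_of_notMem_tube h0 (ball_subset_ball hψ hx) (ht p hp)).le
      linarith [Finset.sum_nonneg fun p (_ : p ∈ S) => hpos p]
  · rw [indicator_of_notMem hx]
    linarith [Finset.sum_nonneg fun p (_ : p ∈ S) => hpos p,
      perforatedBump_nonneg (ψ := ψ) (i := i) (j := j) (k := k) (r := r) (ε := ε) (S := S) x]

lemma le_integral_perforatedBump (hij : i ≠ j) (hik : i ≠ k) (hjk : j ≠ k) (h0 : 0 < r)
    (h1 : r ≤ 1) (hψ : ψ.rIn ≤ 1) :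
    volume.real (ball (0 : EuclideanSpace ℝ (Fin n)) ψ.rIn) -
      S.card * (r ^ 2 * volume.real (ball (0 : EuclideanSpace ℝ (Fin n)) 3)) ≤
      ∫ x, perforatedBump ψ i j k r ε S x := by
  have hbi : Integrable ((ball (0 : EuclideanSpace ℝ (Fin n)) ψ.rIn).indicator fun _ => (1 : ℝ)) :=
    (integrable_indicator_iff measurableSet_ball).2 (integrableOn_const measure_ball_lt_top.ne)
  have hSi : Integrable fun x => ∑ p ∈ S,
      (tube i j k r (ε * p.1) (ε * p.2)).indicator (fun _ => (1 : ℝ)) x :=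
    integrable_finsetSum _ fun p _ => integrable_indicator_tube _ _ _ _
  have hui : Integrable (perforatedBump ψ i j k r ε S) :=
    (contDiff_perforatedBump (ψ := ψ)).continuous.integrable_of_hasCompactSupport
      ψ.hasCompactSupport.mul_right
  have hle := integral_mono (hbi.sub hSi) hui (le_perforatedBump h0 hψ)
  have hsum := integral_sum_indicator_tube_le (S := S) (ε := ε) hij hik hjk h0 h1 zero_le_one
  simp only [Pi.sub_apply] at hle
  rw [integral_sub hbi hSi, integral_indicator_const _ measurableSet_ball, smul_eq_mul,
    mul_one] at hle
  rw [mul_one] at hsum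
  linarith

/-- If the spikes are thin and few enough, the Cheeger constant of the spiked ball is bounded
independently of them. -/
lemma exists_testFun_cheegerConst_spikedBall_le (ψ : ContDiffBump (0 : EuclideanSpace ℝ (Fin n)))
    (hψ : ψ.rOut < 1) (hij : i ≠ j) (hik : i ≠ k) (hjk : j ≠ k) (hδ : 0 < δ) (hσ : 0 < σ)
    (hσ1 : 2 * σ ≤ 1) (hB : 0 ≤ B) (hS : ∀ p ∈ S, |ε * p.1| ≤ B ∧ |ε * p.2| ≤ B)
    (hD : ∀ t ∈ Icc (-3 : ℝ) 1, |deriv Real.smoothTransition t| ≤ D)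
    (hper : S.card * (2 * σ) *
      (16 * D * (1 + B) * volume.real (ball (0 : EuclideanSpace ℝ (Fin n)) 3)) ≤ 1)
    (hvol : S.card * (2 * σ) * volume.real (ball (0 : EuclideanSpace ℝ (Fin n)) 3) ≤
      volume.real (ball (0 : EuclideanSpace ℝ (Fin n)) ψ.rIn) / 2) :
    (∃ u, TestFun (spikedBall i j k δ ε σ S) u ∧ u ≠ 0) ∧
      cheegerConst (spikedBall i j k δ ε σ S) ≤ ((∫ x, ‖fderiv ℝ ψ x‖) + 1) /
        (volume.real (ball (0 : EuclideanSpace ℝ (Fin n)) ψ.rIn) / 2) := by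
  have hV : 0 < volume.real (ball (0 : EuclideanSpace ℝ (Fin n)) ψ.rIn) :=
    ENNReal.toReal_pos (measure_ball_pos _ _ ψ.rIn_pos).ne' measure_ball_lt_top.ne
  have hr : 0 < 2 * σ := by positivity
  have hu : TestFun (spikedBall i j k δ ε σ S) (perforatedBump ψ i j k (2 * σ) ε S) :=
    testFun_perforatedBump hψ hδ hσ
  have hmass : volume.real (ball (0 : EuclideanSpace ℝ (Fin n)) ψ.rIn) / 2 ≤
      ∫ x, perforatedBump ψ i j k (2 * σ) ε S x := by
    have h := le_integral_perforatedBump (S := S) (ε := ε) (ψ := ψ) hij hik hjk hr hσ1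
      (ψ.rIn_lt_rOut.trans hψ).le
    have h2 : S.card * ((2 * σ) ^ 2 * volume.real (ball (0 : EuclideanSpace ℝ (Fin n)) 3)) ≤
        S.card * (2 * σ) * volume.real (ball (0 : EuclideanSpace ℝ (Fin n)) 3) := by
      rw [mul_assoc]
      gcongr
      exact pow_le_of_le_one hr.le hσ1 two_ne_zero
    linarith
  have hne : perforatedBump ψ i j k (2 * σ) ε S ≠ 0 := by
    intro h
    simp only [h, Pi.zero_apply, integral_zero] at hmass
    linarith
  refine ⟨⟨_, hu, hne⟩, (cheegerConst_le hu hne).trans ?_⟩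
  have habs : ∫ x in spikedBall i j k δ ε σ S, |perforatedBump ψ i j k (2 * σ) ε S x| =
      ∫ x, perforatedBump ψ i j k (2 * σ) ε S x := by
    simp only [abs_of_nonneg (perforatedBump_nonneg _)]
    exact setIntegral_eq_integral_of_forall_compl_eq_zero fun x hx => hu.eq_zero hx
  rw [habs]
  have hgrad := setIntegral_norm_fderiv_perforatedBump_le (ψ := ψ) hij hik hjk hr hσ1 hB hS hD
    (isOpen_spikedBall i j k δ ε σ S).measurableSet (fun x hx => hx.1)
  have hI : 0 ≤ ∫ x, ‖fderiv ℝ ψ x‖ := integral_nonneg fun x => norm_nonneg _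
  gcongr
  linarith

end PerforatedBump

/-- for `n ≥ 3` and any `C > 0` there is an open set `Ω` inside the unit
ball of `ℝⁿ`, starshaped with respect to a ball `B(0,ρ)` with `ρ > 0`, such that
`Λ(Ω) > C·γ(Ω)²`. -/
theorem stmt_1 (n : ℕ) (hn : 3 ≤ n) (C : ℝ) (hC : 0 < C) :
    ∃ ρ : ℝ, 0 < ρ ∧ ∃ Ω : Set (EuclideanSpace ℝ (Fin n)),
      IsOpen Ω ∧ Ω ⊆ ball (0 : EuclideanSpace ℝ (Fin n)) 1 ∧
      (∀ x ∈ Ω, convexHull ℝ ({x} ∪ ball (0 : EuclideanSpace ℝ (Fin n)) ρ) ⊆ Ω) ∧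
      C * cheegerConst Ω ^ 2 < Lambda Ω := by
  have hij : (⟨0, by lia⟩ : Fin n) ≠ ⟨1, by lia⟩ := by simp
  have hik : (⟨0, by lia⟩ : Fin n) ≠ ⟨2, by lia⟩ := by simp
  have hjk : (⟨1, by lia⟩ : Fin n) ≠ ⟨2, by lia⟩ := by simp
  generalize (⟨0, by lia⟩ : Fin n) = i at hij hik
  generalize (⟨1, by lia⟩ : Fin n) = j at hij hjk
  generalize (⟨2, by lia⟩ : Fin n) = k at hik hjk
  let ψ : ContDiffBump (0 : EuclideanSpace ℝ (Fin n)) := ⟨1 / 4, 1 / 2, by norm_num, by norm_num⟩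
  obtain ⟨D, hD0, hD⟩ := exists_bound_deriv_smoothTransition
  set V := volume.real (ball (0 : EuclideanSpace ℝ (Fin n)) ψ.rIn)
  set W := volume.real (ball (0 : EuclideanSpace ℝ (Fin n)) 3)
  have hV : 0 < V :=
    ENNReal.toReal_pos (measure_ball_pos _ _ ψ.rIn_pos).ne' measure_ball_lt_top.ne
  have hW : 0 < W :=
    ENNReal.toReal_pos (measure_ball_pos _ _ (by norm_num)).ne' measure_ball_lt_top.ne
  set Γ := ((∫ x, ‖fderiv ℝ ψ x‖) + 1) / (V / 2)
  obtain ⟨Q, hQ⟩ : ∃ Q, Q = C * Γ ^ 2 + 1 := ⟨_, rfl⟩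
  have hQ0 : 0 < Q := by rw [hQ]; positivity
  obtain ⟨d, hd⟩ := exists_nat_ge (64 * Q + 1)
  have hd1 : (1 : ℝ) ≤ d := by linarith
  have hd0 : (0 : ℝ) < d := by linarith
  obtain ⟨η, hη0, hη1, hηper, hηvol⟩ : ∃ η : ℝ, 0 < η ∧ η ≤ 1 / 2 ∧
      18 * d ^ 2 * η * (16 * D * (1 + d) * W) ≤ 1 ∧ 18 * d ^ 2 * η * W ≤ V / 2 := by
    refine ⟨min (1 / 2) (min (1 / (18 * d ^ 2 * (16 * D * (1 + d) * W)))
      (V / 2 / (18 * d ^ 2 * W))), by positivity, min_le_left _ _, ?_, ?_⟩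
    · have h := (min_le_right (1 / 2) _).trans (min_le_left (1 / (18 * d ^ 2 *
        (16 * D * (1 + d) * W))) (V / 2 / (18 * d ^ 2 * W)))
      rw [le_div_iff₀ (by positivity)] at h
      linarith
    · have h := (min_le_right (1 / 2) _).trans (min_le_right (1 / (18 * d ^ 2 *
        (16 * D * (1 + d) * W))) (V / 2 / (18 * d ^ 2 * W)))
      rw [le_div_iff₀ (by positivity)] at h
      linarith
  obtain ⟨m, hm⟩ := exists_nat_ge (6 * Q / η + 1)
  have hm1 : (1 : ℝ) ≤ m := by
    have : 0 ≤ 6 * Q / η := by positivity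
    linarith
  have hm0 : (0 : ℝ) < m := by linarith
  set δ : ℝ := 1 / d with hδ
  set ε : ℝ := 1 / m with hε
  set σ : ℝ := η / m ^ 2 with hσ
  have hδ0 : 0 < δ := by positivity
  have hσ0 : 0 < σ := by positivity
  set M : ℕ := m * d with hM
  set S : Finset (ℤ × ℤ) := Finset.Icc (-(M : ℤ)) M ×ˢ Finset.Icc (-(M : ℤ)) M with hSdef
  have hMR : (M : ℝ) = m * d := by simp [hM]
  have hM1 : 1 ≤ M := by
    have : (1 : ℝ) ≤ M := by rw [hMR]; nlinarith
    exact_mod_cast this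
  have hσε : σ ≤ ε := by
    rw [hσ, hε, div_le_div_iff₀ (by positivity) hm0]
    nlinarith
  have hS : ∀ p ∈ S, |ε * p.1| ≤ d ∧ |ε * p.2| ≤ d := by
    have key : ∀ z : ℤ, z ∈ Finset.Icc (-(M : ℤ)) M → |ε * z| ≤ d := by
      intro z hz
      have hz' : |(z : ℝ)| ≤ M := by
        exact_mod_cast abs_le.2 (Finset.mem_Icc.1 hz)
      rw [abs_mul, abs_of_pos (by positivity), hε, one_div_mul_eq_div, div_le_iff₀ hm0]
      linarith
    intro p hp
    exact ⟨key _ (Finset.mem_product.1 hp).1, key _ (Finset.mem_product.1 hp).2⟩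
  have hcard : (S.card : ℝ) * (2 * σ) ≤ 18 * d ^ 2 * η := by
    have hc : (S.card : ℝ) = (2 * (m * d) + 1) ^ 2 := by
      rw [hSdef, Finset.card_product, Int.card_Icc, ← sq, Nat.cast_pow]
      congr 1
      have : ((((M : ℤ) + 1 - -(M : ℤ)).toNat : ℤ) : ℝ) = ((2 * (M : ℤ) + 1 : ℤ) : ℝ) := by
        rw [Int.toNat_of_nonneg (by lia)]
        congr 1
        ring
      rw [← hMR]
      exact_mod_cast this
    have hmd : (1 : ℝ) ≤ m * d := by nlinarith
    have hle : (S.card : ℝ) ≤ 9 * (m * d) ^ 2 := by rw [hc]; nlinarith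
    calc (S.card : ℝ) * (2 * σ) ≤ 9 * (m * d) ^ 2 * (2 * σ) := by gcongr
      _ = _ := by rw [hσ]; field_simp; ring
  obtain ⟨ρ, hρ, hstar⟩ := convexHull_subset_spikedBall (i := i) (j := j) (k := k) hδ0
    (div_le_one_of_le₀ hd1 hd0.le) hσ0 hd0.le hS
  have hσ1 : 2 * σ ≤ 1 := by
    rw [hσ, mul_div_assoc', div_le_one (by positivity)]
    nlinarith
  obtain ⟨hex, hcheeger⟩ := exists_testFun_cheegerConst_spikedBall_le ψ (by norm_num [ψ]) hij hik
    hjk hδ0 hσ0 hσ1 hd0.le hS hD ((mul_le_mul_of_nonneg_right hcard (by positivity)).trans hηper)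
    ((mul_le_mul_of_nonneg_right hcard hW.le).trans hηvol)
  refine ⟨ρ, hρ, spikedBall i j k δ ε σ S, isOpen_spikedBall _ _ _ _ _ _ _, fun x hx => hx.1,
    hstar, ?_⟩
  have hK : 3 * (ε ^ 3 / σ) + 32 * δ ^ 2 ≤ 1 / Q := by
    have h1 : 3 * (ε ^ 3 / σ) ≤ 1 / (2 * Q) := by
      have e : 3 * (ε ^ 3 / σ) = 3 / (m * η) := by rw [hε, hσ]; field_simp
      have : 6 * Q ≤ m * η := by rw [← div_le_iff₀ hη0]; linarith
      rw [e, div_le_div_iff₀ (by positivity) (by positivity)]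
      linarith
    have h2 : 32 * δ ^ 2 ≤ 1 / (2 * Q) := by
      rw [hδ, div_pow, one_pow, mul_one_div, div_le_div_iff₀ (by positivity) (by positivity)]
      nlinarith
    calc _ ≤ 1 / (2 * Q) + 1 / (2 * Q) := add_le_add h1 h2
      _ = _ := by field_simp; norm_num
  have hΛ : (3 * (ε ^ 3 / σ) + 32 * δ ^ 2)⁻¹ ≤ Lambda (spikedBall i j k δ ε σ S) :=
    inv_le_Lambda (by positivity) hex fun u hu =>
      lintegral_sq_le_of_eq_zero_off_spikedBall hij hik hjk hδ0 hσ0 hσε hM1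
        (by rw [hMR, hδ, hε]; field_simp; exact le_rfl) hu.contDiff_one fun x hx => hu.eq_zero hx
  calc C * cheegerConst (spikedBall i j k δ ε σ S) ^ 2
      ≤ C * Γ ^ 2 := by
        have := cheegerConst_nonneg (Ω := spikedBall i j k δ ε σ S)
        gcongr
    _ < Q := by linarith
    _ = (1 / Q)⁻¹ := by simp
    _ ≤ (3 * (ε ^ 3 / σ) + 32 * δ ^ 2)⁻¹ := by gcongr
    _ ≤ _ := hΛ
end
end

section
/- Let n > 2, let Ω ⊆ ℝⁿ be open, let R > 0, and let κ > 0 be a constant such that for every locally absolutely continuous function w on (0,R] with w(R) = 0 one has κ·∫_0^R w(ρ)² ρ^{n−1} dρ ≤ ∫_0^R w′(ρ)² ρ^{n−1} dρ (the best such κ is (j_{(n−2)/2}/R)², where j_ν is the first positive root of the Bessel function J_ν). Then for every u ∈ C_0^∞(Ω), writing N_t = {x ∈ Ω : |u(x)| ≥ t} and c_R = (n−2)·σ_{n−1}·R^{n−2}, one has κ · m_n(B_R) · ∫_0^∞ ( cap(N_t;Ω) / (c_R + cap(N_t;Ω)) )^{n/(n−2)} · 2t dt ≤ ∫_Ω |∇u|²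 dx, where m_n(B_R) is the Lebesgue measure of a ball of radius R in ℝⁿ. -/
open MeasureTheory Metric Set Filter
open scoped ENNReal Topology MeasureTheory

noncomputable section

/-- Relative harmonic capacity
`cap(F;Ω) = inf { ∫_Ω |∇u|² : u ∈ C_0^∞(Ω), u ≥ 1 on F }`. -/
def harmCap {n : ℕ} (F Ω : Set (EuclideanSpace ℝ (Fin n))) : ℝ :=
  sInf {r : ℝ | ∃ u : EuclideanSpace ℝ (Fin n) → ℝ, TestFun Ω u ∧
    (∀ x ∈ F, 1 ≤ u x) ∧ r = ∫ x in Ω, ‖fderiv ℝ u x‖ ^ 2}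

/-- A smooth mollifier supported away from the origin in `(0, δ)`. -/
structure IsMollifier (δ : ℝ) (η : ℝ → ℝ) : Prop where
  contDiff : ContDiff ℝ (⊤ : ℕ∞) η
  hasCompactSupport : HasCompactSupport η
  nonneg : ∀ x, 0 ≤ η x
  integral_eq_one : ∫ x, η x = 1
  eq_zero_of_le : ∀ x ≤ δ / 4, η x = 0
  eq_zero_of_ge : ∀ x, δ ≤ x → η x = 0

theorem exists_isMollifier {δ : ℝ} (hδ : 0 < δ) : ∃ η, IsMollifier δ η := by
  let b : ContDiffBump (δ / 2) := ⟨δ / 8, δ / 4, by linarith, by linarith⟩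
  have hsupp : ∀ x, x ∉ ball (δ / 2) (δ / 4) → b.normed volume x = 0 := fun x hx => by
    rw [← Function.notMem_support, b.support_normed_eq]
    exact hx
  refine ⟨b.normed volume, b.contDiff_normed, b.hasCompactSupport_normed, b.nonneg_normed,
    b.integral_normed, fun x hx => hsupp x ?_, fun x hx => hsupp x ?_⟩
  · rw [Real.ball_eq_Ioo]
    intro h
    linarith [h.1]
  · rw [Real.ball_eq_Ioo]
    intro h
    linarith [h.2]

namespace IsMollifier

variable {δ : ℝ} {η : ℝ → ℝ}

theorem integrable (hη : IsMollifier δ η) : Integrable η :=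
  hη.contDiff.continuous.integrable_of_hasCompactSupport hη.hasCompactSupport

theorem exists_bound (hη : IsMollifier δ η) : ∃ C, ∀ x, η x ≤ C := by
  obtain ⟨C, hC⟩ := hη.hasCompactSupport.exists_bound_of_continuous hη.contDiff.continuous
  exact ⟨C, fun x => (le_abs_self _).trans (hC x)⟩

/-- Jensen's inequality for averages against a mollifier. -/
theorem sq_integral_mul_le (hη : IsMollifier δ η) {φ : ℝ → ℝ} (hφ : Measurable φ) {B : ℝ}
    (hB : ∀ x, |φ x| ≤ B) (y : ℝ) :
    ENNReal.ofReal ((∫ x, φ x * η (y - x)) ^ 2) ≤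
      ∫⁻ x, ENNReal.ofReal (φ x ^ 2) * ENNReal.ofReal (η (y - x)) := by
  have hint : Integrable fun x => η (y - x) := hη.integrable.comp_sub_left y
  have h1 : ∫ x, η (y - x) = 1 := by rw [integral_sub_left_eq_self, hη.integral_eq_one]
  have hi1 : Integrable fun x => φ x * η (y - x) :=
    hint.bdd_mul hφ.aestronglyMeasurable (.of_forall hB)
  have hi2 : Integrable fun x => φ x ^ 2 * η (y - x) :=
    hint.bdd_mul (c := B ^ 2) (hφ.pow_const 2).aestronglyMeasurable (.of_forall fun x => by
      rw [Real.norm_eq_abs, abs_pow]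
      exact pow_le_pow_left₀ (abs_nonneg _) (hB x) 2)
  set p := ∫ x, φ x * η (y - x) with hp
  have key : 0 ≤ ∫ x, (φ x - p) ^ 2 * η (y - x) :=
    integral_nonneg fun x => mul_nonneg (sq_nonneg _) (hη.nonneg _)
  have hexp : ∫ x, (φ x - p) ^ 2 * η (y - x) =
      (∫ x, φ x ^ 2 * η (y - x)) - 2 * p * p + p ^ 2 := by
    calc ∫ x, (φ x - p) ^ 2 * η (y - x)
        = ∫ x, (φ x ^ 2 * η (y - x) - 2 * p * (φ x * η (y - x)) + p ^ 2 * η (y - x)) := by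
          congr 1 with x
          ring
      _ = _ := by
          have hi3 : Integrable fun x => φ x ^ 2 * η (y - x) - 2 * p * (φ x * η (y - x)) :=
            hi2.sub (hi1.const_mul _)
          rw [integral_add hi3 (hint.const_mul _), integral_sub hi2 (hi1.const_mul _),
            integral_const_mul, integral_const_mul, h1, ← hp,
            mul_one]
  have hle : p ^ 2 ≤ ∫ x, φ x ^ 2 * η (y - x) := by nlinarith
  calc ENNReal.ofReal (p ^ 2) ≤ ENNReal.ofReal (∫ x, φ x ^ 2 * η (y - x)) :=
        ENNReal.ofReal_le_ofReal hle
    _ = ∫⁻ x, ENNReal.ofReal (φ x ^ 2 * η (y - x)) :=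
        ofReal_integral_eq_lintegral_ofReal hi2
          (.of_forall fun x => mul_nonneg (sq_nonneg _) (hη.nonneg _))
    _ = _ := by simp_rw [ENNReal.ofReal_mul (sq_nonneg _)]

open scoped Convolution in
/-- Mollifying a density `φ` on `[0, t]` gives a smooth even profile which vanishes near the origin,
is at least one beyond `t + δ`, and whose energy density is controlled by that of `φ`. -/
theorem exists_profile (hη : IsMollifier δ η) (hδ : 0 < δ) {φ : ℝ → ℝ} (hφ : Measurable φ) {B : ℝ}
    (hB : ∀ x, |φ x| ≤ B) (hφ0 : ∀ x, 0 ≤ φ x) {t : ℝ} (hsupp : ∀ x ∉ Icc 0 t, φ x = 0)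
    (hone : ∫ x, φ x = 1) :
    ∃ P : ℝ → ℝ, ContDiff ℝ (⊤ : ℕ∞) P ∧ (∀ x, |x| < δ / 4 → P x = 0) ∧
      (∀ x, t + δ ≤ |x| → 1 ≤ P x) ∧ ∀ x, ENNReal.ofReal (deriv P x ^ 2) ≤
        ∫⁻ s, ENNReal.ofReal (φ s ^ 2) * ENNReal.ofReal (η (|x| - s)) := by
  have hφi : Integrable φ := by
    by_contra h
    rw [integral_undef h] at hone
    norm_num at hone
  set p : ℝ → ℝ := φ ⋆[ContinuousLinearMap.mul ℝ ℝ, volume] η with hp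
  have hpx : ∀ x, p x = ∫ s, φ s * η (x - s) := fun x => rfl
  have hps : ContDiff ℝ (⊤ : ℕ∞) p :=
    hη.hasCompactSupport.contDiff_convolution_right _ hφi.locallyIntegrable hη.contDiff
  have hp0 : ∀ x, 0 ≤ p x := fun x => integral_nonneg fun s => mul_nonneg (hφ0 s) (hη.nonneg _)
  have hplow : ∀ x ≤ δ / 4, p x = 0 := fun x hx => by
    rw [hpx, integral_eq_zero_of_ae]
    refine .of_forall fun s => ?_
    by_cases hs : s ∈ Icc 0 t
    · simp [hη.eq_zero_of_le (x - s) (by linarith [hs.1])]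
    · simp [hsupp s hs]
  have hphigh : ∀ x, t + δ ≤ x → p x = 0 := fun x hx => by
    rw [hpx, integral_eq_zero_of_ae]
    refine .of_forall fun s => ?_
    by_cases hs : s ∈ Icc 0 t
    · simp [hη.eq_zero_of_ge (x - s) (by linarith [hs.2])]
    · simp [hsupp s hs]
  have hpone : ∫ x, p x = 1 := by
    rw [hp, integral_convolution _ hφi hη.integrable, hone, hη.integral_eq_one]
    simp
  set Q : ℝ → ℝ := fun x => ∫ s in 0..x, p s with hQ
  have hQd : ∀ x, HasDerivAt Q (p x) x := fun x =>
    (hps.continuous.integral_hasStrictDerivAt 0 x).hasDerivAt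
  have hQs : ContDiff ℝ (⊤ : ℕ∞) Q := by
    rw [contDiff_infty_iff_deriv]
    refine ⟨fun x => (hQd x).differentiableAt, ?_⟩
    rwa [show deriv Q = p from funext fun x => (hQd x).deriv]
  have hQlow : ∀ x ≤ δ / 4, Q x = 0 := fun x hx => by
    refine intervalIntegral.integral_zero_ae (.of_forall fun s hs => hplow s ?_)
    rcases le_total 0 x with h | h
    · rw [uIoc_of_le h] at hs
      linarith [hs.2]
    · rw [uIoc_of_ge h] at hs
      linarith [hs.2]
  have hQhigh : ∀ x, t + δ ≤ x → 0 ≤ x → Q x = 1 := fun x hx h0 => by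
    rw [hQ, ← hpone]
    simp only
    rw [intervalIntegral.integral_of_le h0]
    refine setIntegral_eq_integral_of_forall_compl_eq_zero fun s hs => ?_
    by_cases h : s ≤ 0
    · exact hplow s (by linarith)
    · exact hphigh s (by
        by_contra h'
        exact hs ⟨by linarith, by linarith⟩)
  have hQnn : ∀ x, 0 ≤ Q x := fun x => by
    rcases le_total 0 x with h | h
    · exact intervalIntegral.integral_nonneg h fun s _ => hp0 s
    · exact (hQlow x (by linarith)).ge
  have hPd : ∀ x, HasDerivAt (fun x => Q x + Q (-x)) (p x - p (-x)) x := fun x => by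
    have := (hQd x).add ((hQd (-x)).comp x (hasDerivAt_neg x))
    convert! this using 1
    ring
  refine ⟨fun x => Q x + Q (-x), hQs.add (hQs.comp contDiff_neg), fun x hx => ?_, fun x hx => ?_,
    fun x => ?_⟩
  · obtain ⟨h1, h2⟩ := abs_lt.1 hx
    dsimp only
    rw [hQlow x h2.le, hQlow (-x) (by linarith), add_zero]
  · dsimp only
    rcases le_total 0 x with h | h
    · rw [abs_of_nonneg h] at hx
      rw [hQhigh x hx h]
      linarith [hQnn (-x)]
    · rw [abs_of_nonpos h] at hx
      rw [hQhigh (-x) hx (by linarith)]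
      linarith [hQnn x]
  · have : deriv (fun x => Q x + Q (-x)) x ^ 2 = p |x| ^ 2 := by
      rw [(hPd x).deriv]
      rcases le_total 0 x with h | h
      · rw [abs_of_nonneg h, hplow (-x) (by linarith), sub_zero]
      · rw [abs_of_nonpos h, hplow x (by linarith), zero_sub, neg_sq]
    rw [this, hpx]
    exact hη.sq_integral_mul_le hφ hB |x|

end IsMollifier

section Capacity

variable {n : ℕ} {Ω : Set (EuclideanSpace ℝ (Fin n))} {u : EuclideanSpace ℝ (Fin n) → ℝ}

theorem TestFun.hasCompactSupport_sq_norm_fderiv (hu : TestFun Ω u) :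
    HasCompactSupport fun x => ‖fderiv ℝ u x‖ ^ 2 :=
  (hu.2.1.fderiv (𝕜 := ℝ)).comp_left (g := fun L => ‖L‖ ^ 2) (by simp)

theorem TestFun.continuous_sq_norm_fderiv (hu : TestFun Ω u) :
    Continuous fun x => ‖fderiv ℝ u x‖ ^ 2 :=
  ((hu.1.continuous_fderiv (by simp)).norm).pow 2

theorem TestFun.integrable_sq_norm_fderiv (hu : TestFun Ω u) :
    Integrable fun x => ‖fderiv ℝ u x‖ ^ 2 :=
  hu.continuous_sq_norm_fderiv.integrable_of_hasCompactSupport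
    hu.hasCompactSupport_sq_norm_fderiv

theorem TestFun.comp_left (hu : TestFun Ω u) {P : ℝ → ℝ}
    (hP : ContDiff ℝ (⊤ : ℕ∞) P) (h0 : P 0 = 0) : TestFun Ω (P ∘ u) :=
  ⟨hP.comp hu.1, hu.2.1.comp_left h0, (closure_mono (Function.support_comp_subset h0 u)).trans hu.2.2⟩

theorem norm_fderiv_comp_real_sq {P : ℝ → ℝ} (hP : Differentiable ℝ P) (hu : Differentiable ℝ u)
    (x : EuclideanSpace ℝ (Fin n)) :
    ‖fderiv ℝ (P ∘ u) x‖ ^ 2 = deriv P (u x) ^ 2 * ‖fderiv ℝ u x‖ ^ 2 := by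
  rw [((hP (u x)).hasDerivAt.comp_hasFDerivAt x (hu x).hasFDerivAt).fderiv, norm_smul, mul_pow,
    Real.norm_eq_abs, sq_abs]

theorem bddBelow_harmCap_set (F Ω : Set (EuclideanSpace ℝ (Fin n))) :
    BddBelow {r : ℝ | ∃ u : EuclideanSpace ℝ (Fin n) → ℝ, TestFun Ω u ∧
      (∀ x ∈ F, 1 ≤ u x) ∧ r = ∫ x in Ω, ‖fderiv ℝ u x‖ ^ 2} := by
  refine ⟨0, ?_⟩
  rintro r ⟨u, -, -, rfl⟩
  exact integral_nonneg fun x => sq_nonneg _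

theorem harmCap_nonneg (F Ω : Set (EuclideanSpace ℝ (Fin n))) : 0 ≤ harmCap F Ω := by
  refine Real.sInf_nonneg ?_
  rintro r ⟨u, -, -, rfl⟩
  exact integral_nonneg fun x => sq_nonneg _

theorem ofReal_harmCap_le {F : Set (EuclideanSpace ℝ (Fin n))} (hu : TestFun Ω u)
    (hF : ∀ x ∈ F, 1 ≤ u x) :
    ENNReal.ofReal (harmCap F Ω) ≤ ∫⁻ x in Ω, ENNReal.ofReal (‖fderiv ℝ u x‖ ^ 2) := by
  rw [← ofReal_integral_eq_lintegral_ofReal hu.integrable_sq_norm_fderiv.integrableOn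
    (.of_forall fun x => sq_nonneg _)]
  exact ENNReal.ofReal_le_ofReal (csInf_le (bddBelow_harmCap_set F Ω) ⟨u, hu, hF, rfl⟩)

/-- The capacity of the closed superlevel sets of `|u|` is nonincreasing in the level. -/
theorem TestFun.antitoneOn_harmCap (hu : TestFun Ω u) :
    AntitoneOn (fun t => harmCap {x ∈ Ω | t ≤ |u x|} Ω) (Ioi 0) := by
  intro s hs t ht hst
  refine csInf_le_csInf (bddBelow_harmCap_set _ Ω) ?_ ?_
  · refine ⟨_, fun x => u x ^ 2 / s ^ 2, ?_, fun x hx => ?_, rfl⟩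
    · exact hu.comp_left (P := fun x => x ^ 2 / s ^ 2) (by fun_prop) (by simp)
    · rw [one_le_div (pow_pos hs 2), ← sq_abs (u x)]
      exact pow_le_pow_left₀ (le_of_lt hs) hx.2 2
  · rintro r ⟨v, hv, hv1, rfl⟩
    exact ⟨v, hv, fun x hx => hv1 x ⟨hx.1, hst.trans hx.2⟩, rfl⟩

/-- If `G` dominates the mollified energy density of `u` along its level sets, then the capacity of
a superlevel set is at most the reciprocal of `∫ 1 / G`. -/
theorem TestFun.harmCap_le_inv_integral (hu : TestFun Ω u) {δ : ℝ} (hδ : 0 < δ) {η : ℝ → ℝ}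
    (hη : IsMollifier δ η) {G : ℝ → ℝ} (hG : Continuous G) (hG0 : ∀ s, 0 < G s)
    (hle : ∀ s, ∫⁻ x in Ω, ENNReal.ofReal (η (|u x| - s)) * ENNReal.ofReal (‖fderiv ℝ u x‖ ^ 2) ≤
      ENNReal.ofReal (G s)) {t : ℝ} (ht : 0 < t) :
    harmCap {x ∈ Ω | t + δ ≤ |u x|} Ω ≤ (∫ s in 0..t, (G s)⁻¹)⁻¹ := by
  have hGi : Continuous fun s => (G s)⁻¹ := hG.inv₀ fun s => (hG0 s).ne'
  set ψ := ∫ s in 0..t, (G s)⁻¹ with hψ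
  have hψ0 : 0 < ψ :=
    intervalIntegral.intervalIntegral_pos_of_pos (hGi.intervalIntegrable _ _)
      (fun s => inv_pos.2 (hG0 s)) ht
  set φ : ℝ → ℝ := (Icc 0 t).indicator fun s => (G s)⁻¹ / ψ with hφ
  have hφm : Measurable φ := (hGi.div_const ψ).measurable.indicator measurableSet_Icc
  have hφ0 : ∀ s, 0 ≤ φ s := fun s =>
    indicator_nonneg (fun s _ => div_nonneg (inv_pos.2 (hG0 s)).le hψ0.le) s
  obtain ⟨B, hB⟩ : ∃ B, ∀ s, |φ s| ≤ B := by
    obtain ⟨B, hB⟩ := (isCompact_Icc (a := 0) (b := t)).exists_bound_of_continuousOn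
      (hGi.div_const ψ).continuousOn
    refine ⟨max B 0, fun s => ?_⟩
    by_cases hs : s ∈ Icc 0 t
    · rw [hφ, indicator_of_mem hs]
      exact (hB s hs).trans (le_max_left _ _)
    · rw [hφ, indicator_of_notMem hs, abs_zero]
      exact le_max_right _ _
  have hone : ∫ s, φ s = 1 := by
    rw [hφ, integral_indicator measurableSet_Icc, integral_Icc_eq_integral_Ioc,
      ← intervalIntegral.integral_of_le ht.le, intervalIntegral.integral_div, ← hψ,
      div_self hψ0.ne']
  obtain ⟨P, hPs, hP0, hP1, hPd⟩ := hη.exists_profile hδ hφm hB hφ0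
    (fun s hs => indicator_of_notMem hs _) hone
  have hv : TestFun Ω (P ∘ u) := hu.comp_left hPs (hP0 0 (by simpa using hδ))
  have hum : Measurable fun x => |u x| := hu.1.continuous.abs.measurable
  have hηm : Measurable η := hη.contDiff.continuous.measurable
  have hDm : Measurable fun x => ENNReal.ofReal (‖fderiv ℝ u x‖ ^ 2) :=
    hu.continuous_sq_norm_fderiv.measurable.ennreal_ofReal
  have key : ENNReal.ofReal (harmCap {x ∈ Ω | t + δ ≤ |u x|} Ω) ≤ ENNReal.ofReal ψ⁻¹ := by
    calc ENNReal.ofReal (harmCap {x ∈ Ω | t + δ ≤ |u x|} Ω)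
        ≤ ∫⁻ x in Ω, ENNReal.ofReal (‖fderiv ℝ (P ∘ u) x‖ ^ 2) :=
          ofReal_harmCap_le hv fun x hx => hP1 _ hx.2
      _ ≤ ∫⁻ x in Ω, ∫⁻ s, ENNReal.ofReal (φ s ^ 2) *
            (ENNReal.ofReal (η (|u x| - s)) * ENNReal.ofReal (‖fderiv ℝ u x‖ ^ 2)) := by
          refine lintegral_mono fun x => ?_
          rw [norm_fderiv_comp_real_sq (hPs.differentiable (by simp))
            (hu.1.differentiable (by simp)), ENNReal.ofReal_mul (sq_nonneg _)]
          simp_rw [← mul_assoc]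
          rw [lintegral_mul_const _ (by fun_prop)]
          gcongr
          exact hPd (u x)
      _ = ∫⁻ s, ∫⁻ x in Ω, ENNReal.ofReal (φ s ^ 2) *
            (ENNReal.ofReal (η (|u x| - s)) * ENNReal.ofReal (‖fderiv ℝ u x‖ ^ 2)) := by
          refine lintegral_lintegral_swap (Measurable.aemeasurable ?_)
          exact ((hφm.comp measurable_snd).pow_const 2).ennreal_ofReal.mul
            (((hηm.comp ((hum.comp measurable_fst).sub measurable_snd)).ennreal_ofReal).mul
              (hDm.comp measurable_fst))
      _ ≤ ∫⁻ s, ENNReal.ofReal (φ s / ψ) := by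
          refine lintegral_mono fun s => ?_
          rw [lintegral_const_mul _ (by fun_prop)]
          refine (mul_le_mul_right (hle s) _).trans ?_
          rw [← ENNReal.ofReal_mul (sq_nonneg _)]
          refine ENNReal.ofReal_le_ofReal (le_of_eq ?_)
          by_cases hs : s ∈ Icc 0 t
          · have := (hG0 s).ne'
            rw [hφ, indicator_of_mem hs]
            field_simp
          · simp [hφ, indicator_of_notMem hs]
      _ = ENNReal.ofReal ψ⁻¹ := by
          rw [← ofReal_integral_eq_lintegral_ofReal, integral_div, hone, one_div]
          · refine Integrable.div_const ?_ _
            by_contra h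
            rw [integral_undef h] at hone
            norm_num at hone
          · exact .of_forall fun s => div_nonneg (hφ0 s) hψ0.le
  exact (ENNReal.ofReal_le_ofReal_iff (inv_pos.2 hψ0).le).1 key

end Capacity

/-- A continuous positive majorant of the mollified energy density of `u` along its level sets, with
almost the same total mass. -/
theorem TestFun.exists_energyDensity {n : ℕ} {Ω : Set (EuclideanSpace ℝ (Fin n))}
    {u : EuclideanSpace ℝ (Fin n) → ℝ} (hu : TestFun Ω u) {δ : ℝ} {η : ℝ → ℝ}
    (hη : IsMollifier δ η) {ε : ℝ} (hε : 0 < ε) :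
    ∃ G : ℝ → ℝ, Continuous G ∧ (∀ s, 0 < G s) ∧ (∃ K, ∀ s, G s ≤ K) ∧
      (∀ s, ∫⁻ x in Ω, ENNReal.ofReal (η (|u x| - s)) * ENNReal.ofReal (‖fderiv ℝ u x‖ ^ 2) ≤
        ENNReal.ofReal (G s)) ∧
      ∫⁻ s in Ioi (0 : ℝ), ENNReal.ofReal (G s) ≤
        (∫⁻ x in Ω, ENNReal.ofReal (‖fderiv ℝ u x‖ ^ 2)) + ENNReal.ofReal ε := by
  obtain ⟨C, hC⟩ := hη.exists_bound
  have hηc : Continuous η := hη.contDiff.continuous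
  have huc : Continuous u := hu.1.continuous
  have hDi : IntegrableOn (fun x => ‖fderiv ℝ u x‖ ^ 2) Ω :=
    hu.integrable_sq_norm_fderiv.integrableOn
  have hDc := hu.continuous_sq_norm_fderiv
  have hnn : ∀ s x, 0 ≤ η (|u x| - s) * ‖fderiv ℝ u x‖ ^ 2 := fun s x =>
    mul_nonneg (hη.nonneg _) (sq_nonneg _)
  have hbd : ∀ s x, η (|u x| - s) * ‖fderiv ℝ u x‖ ^ 2 ≤ C * ‖fderiv ℝ u x‖ ^ 2 := fun s x =>
    mul_le_mul_of_nonneg_right (hC _) (sq_nonneg _)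
  have hmeas : ∀ s, AEStronglyMeasurable (fun x => η (|u x| - s) * ‖fderiv ℝ u x‖ ^ 2)
      (volume.restrict Ω) := fun s =>
    ((hηc.comp (huc.abs.sub continuous_const)).mul hDc).aestronglyMeasurable
  have hint : ∀ s, IntegrableOn (fun x => η (|u x| - s) * ‖fderiv ℝ u x‖ ^ 2) Ω := fun s =>
    (hDi.const_mul C).mono' (hmeas s) (.of_forall fun x => by
      rw [Real.norm_of_nonneg (hnn s x)]
      exact hbd s x)
  set g : ℝ → ℝ := fun s => ∫ x in Ω, η (|u x| - s) * ‖fderiv ℝ u x‖ ^ 2 with hg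
  have hg0 : ∀ s, 0 ≤ g s := fun s => integral_nonneg (hnn s)
  have hgc : Continuous g := by
    refine continuous_of_dominated hmeas (bound := fun x => C * ‖fderiv ℝ u x‖ ^ 2)
      (fun s => .of_forall fun x => ?_) (hDi.const_mul C) (.of_forall fun x => ?_)
    · rw [Real.norm_of_nonneg (hnn s x)]
      exact hbd s x
    · exact (hηc.comp (continuous_const.sub continuous_id)).mul continuous_const
  have hgl : ∀ s, ∫⁻ x in Ω, ENNReal.ofReal (η (|u x| - s)) *
      ENNReal.ofReal (‖fderiv ℝ u x‖ ^ 2) = ENNReal.ofReal (g s) := fun s => by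
    rw [hg, ofReal_integral_eq_lintegral_ofReal (hint s) (.of_forall (hnn s))]
    simp_rw [ENNReal.ofReal_mul (hη.nonneg _)]
  refine ⟨fun s => g s + ε * Real.exp (-|s|), by fun_prop, fun s => ?_,
    ⟨(∫ x in Ω, C * ‖fderiv ℝ u x‖ ^ 2) + ε, fun s => ?_⟩, fun s => ?_, ?_⟩
  · exact add_pos_of_nonneg_of_pos (hg0 s) (mul_pos hε (Real.exp_pos _))
  · refine add_le_add (integral_mono (hint s) (hDi.const_mul C) (hbd s)) ?_
    exact mul_le_of_le_one_right hε.le (Real.exp_le_one_iff.2 (neg_nonpos.2 (abs_nonneg s)))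
  · rw [hgl]
    exact ENNReal.ofReal_le_ofReal (le_add_of_nonneg_right (mul_nonneg hε.le (Real.exp_pos _).le))
  · have h1 : ∫⁻ s in Ioi (0 : ℝ), ENNReal.ofReal (g s) ≤
        ∫⁻ x in Ω, ENNReal.ofReal (‖fderiv ℝ u x‖ ^ 2) := by
      calc ∫⁻ s in Ioi (0 : ℝ), ENNReal.ofReal (g s) ≤ ∫⁻ s, ENNReal.ofReal (g s) :=
            setLIntegral_le_lintegral _ _
        _ = ∫⁻ s, ∫⁻ x in Ω, ENNReal.ofReal (η (|u x| - s)) *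
              ENNReal.ofReal (‖fderiv ℝ u x‖ ^ 2) := by simp_rw [hgl]
        _ = ∫⁻ x in Ω, ∫⁻ s, ENNReal.ofReal (η (|u x| - s)) *
              ENNReal.ofReal (‖fderiv ℝ u x‖ ^ 2) := by
            refine lintegral_lintegral_swap (Measurable.aemeasurable ?_)
            exact ((hηc.comp ((huc.abs.comp continuous_snd).sub
              continuous_fst)).measurable.ennreal_ofReal).mul
              (hDc.measurable.ennreal_ofReal.comp measurable_snd)
        _ = ∫⁻ x in Ω, ENNReal.ofReal (‖fderiv ℝ u x‖ ^ 2) := by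
            refine lintegral_congr fun x => ?_
            have hi : Integrable fun s => η (|u x| - s) := hη.integrable.comp_sub_left _
            rw [lintegral_mul_const _ (by fun_prop), ← ofReal_integral_eq_lintegral_ofReal hi
              (.of_forall fun s => hη.nonneg _), integral_sub_left_eq_self, hη.integral_eq_one,
              ENNReal.ofReal_one, one_mul]
    have h2 : ∫⁻ s in Ioi (0 : ℝ), ENNReal.ofReal (ε * Real.exp (-|s|)) = ENNReal.ofReal ε := by
      calc ∫⁻ s in Ioi (0 : ℝ), ENNReal.ofReal (ε * Real.exp (-|s|))
          = ∫⁻ s in Ioi (0 : ℝ), ENNReal.ofReal (ε * Real.exp (-s)) :=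
            setLIntegral_congr_fun measurableSet_Ioi fun s hs => by
              rw [abs_of_pos (show (0 : ℝ) < s from hs)]
        _ = ENNReal.ofReal ε := by
            rw [← ofReal_integral_eq_lintegral_ofReal, integral_const_mul,
              integral_exp_neg_Ioi_zero, mul_one]
            · exact (integrableOn_exp_neg_Ioi 0).const_mul ε
            · exact .of_forall fun s => mul_nonneg hε.le (Real.exp_pos _).le
    calc ∫⁻ s in Ioi (0 : ℝ), ENNReal.ofReal (g s + ε * Real.exp (-|s|))
        = ∫⁻ s in Ioi (0 : ℝ), (ENNReal.ofReal (g s) + ENNReal.ofReal (ε * Real.exp (-|s|))) := by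
          refine lintegral_congr fun s => ?_
          rw [ENNReal.ofReal_add (hg0 s) (mul_nonneg hε.le (Real.exp_pos _).le)]
      _ ≤ _ := by
          rw [lintegral_add_left hgc.measurable.ennreal_ofReal, h2]
          gcongr

section RadialComparison

variable {m : ℕ} {R κ : ℝ}

/-- The global inverse of an antiderivative of `1 / G`, for `G` continuous, positive and bounded. -/
theorem exists_inverse_of_integral_inv {G : ℝ → ℝ} (hG : Continuous G) (hG0 : ∀ s, 0 < G s)
    {K : ℝ} (hK : ∀ s, G s ≤ K) :
    ∃ T : ℝ → ℝ, StrictMono T ∧ (∀ t, T (∫ s in 0..t, (G s)⁻¹) = t) ∧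
      ∀ y, HasDerivAt T (G (T y)) y := by
  have hGi : Continuous fun s => (G s)⁻¹ := hG.inv₀ fun s => (hG0 s).ne'
  have hK0 : 0 < K := (hG0 0).trans_le (hK 0)
  set Ψ : ℝ → ℝ := fun t => ∫ s in 0..t, (G s)⁻¹ with hΨ
  have hd : ∀ t, HasDerivAt Ψ (G t)⁻¹ t := fun t => (hGi.integral_hasStrictDerivAt 0 t).hasDerivAt
  have hmono : StrictMono Ψ :=
    strictMono_of_deriv_pos fun t => by
      rw [(hd t).deriv]
      exact inv_pos.2 (hG0 t)
  have hlow : Monotone fun t => Ψ t - K⁻¹ * t := by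
    have h : ∀ t, HasDerivAt (fun t => Ψ t - K⁻¹ * t) ((G t)⁻¹ - K⁻¹ * 1) t := fun t =>
      (hd t).sub ((hasDerivAt_id t).const_mul _)
    refine monotone_of_deriv_nonneg (fun t => (h t).differentiableAt) fun t => ?_
    rw [(h t).deriv, mul_one, sub_nonneg]
    exact inv_anti₀ (hG0 t) (hK t)
  have hΨ0 : Ψ 0 = 0 := intervalIntegral.integral_same
  have hcont : Continuous Ψ := continuous_iff_continuousAt.2 fun t => (hd t).continuousAt
  have hlin : Tendsto (fun t : ℝ => K⁻¹ * t) atTop atTop :=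
    tendsto_id.const_mul_atTop (inv_pos.2 hK0)
  have hlin' : Tendsto (fun t : ℝ => K⁻¹ * t) atBot atBot :=
    tendsto_id.const_mul_atBot (inv_pos.2 hK0)
  have hsurj : Function.Surjective Ψ := by
    refine hcont.surjective (tendsto_atTop_mono' _ ?_ hlin) (tendsto_atBot_mono' _ ?_ hlin')
    · filter_upwards [eventually_ge_atTop 0] with t ht
      have := hlow ht
      simp only [hΨ0] at this
      linarith
    · filter_upwards [eventually_le_atBot 0] with t ht
      have := hlow ht
      simp only [hΨ0] at this
      linarith
  let e := hmono.orderIsoOfSurjective Ψ hsurj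
  have he : ∀ y, Ψ (e.symm y) = y := fun y => e.apply_symm_apply y
  refine ⟨e.symm, e.symm.strictMono, fun t => e.symm_apply_apply t, fun y => ?_⟩
  have := HasDerivAt.of_local_left_inverse e.symm.continuous.continuousAt (hd (e.symm y))
    (inv_ne_zero (hG0 _).ne') (.of_forall he)
  rwa [inv_inv] at this

theorem setLIntegral_Ioo_pow (k : ℕ) {r : ℝ} (hr : 0 ≤ r) :
    ∫⁻ ρ in Ioo 0 r, ENNReal.ofReal (ρ ^ k) = ENNReal.ofReal (r ^ (k + 1) / (k + 1)) := by
  rw [← ofReal_integral_eq_lintegral_ofReal, ← integral_Ioc_eq_integral_Ioo,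
    ← intervalIntegral.integral_of_le hr, integral_pow]
  · simp
  · exact (continuous_pow k).integrableOn_Icc.mono_set Ioo_subset_Icc_self
  · exact (ae_restrict_iff' measurableSet_Ioo).2 (.of_forall fun x hx => pow_nonneg hx.1.le k)

/-- Transplanting the energy density `G` onto the ball of radius `R`, by matching `∫ 1 / G` with the
reciprocal capacities of concentric balls, and applying the radial Hardy inequality. -/
theorem lintegral_rearranged_le (hm : 0 < m)
    (hHardy : ∀ w w' : ℝ → ℝ,
      (∀ a b : ℝ, 0 < a → a ≤ b → b ≤ R →
        IntervalIntegrable w' volume a b ∧ w b - w a = ∫ s in a..b, w' s) →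
      w R = 0 →
      ENNReal.ofReal κ * ∫⁻ ρ in Ioo (0:ℝ) R, ENNReal.ofReal (w ρ ^ 2 * ρ ^ (m + 1)) ≤
        ∫⁻ ρ in Ioo (0:ℝ) R, ENNReal.ofReal (w' ρ ^ 2 * ρ ^ (m + 1)))
    {G : ℝ → ℝ} (hG : Continuous G) (hG0 : ∀ s, 0 < G s) {K : ℝ} (hK : ∀ s, G s ≤ K)
    {σ : ℝ} (hσ : 0 < σ) {r : ℝ → ℝ} (hr0 : ∀ t, 0 < t → 0 ≤ r t) (hrR : ∀ t, 0 < t → r t ≤ R)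
    (hr : ∀ t, 0 < t → 0 < r t → ∫ s in 0..t, (G s)⁻¹ ≤ ((r t ^ m)⁻¹ - (R ^ m)⁻¹) / (m * σ)) :
    ENNReal.ofReal κ * ∫⁻ t in Ioi (0 : ℝ),
        ENNReal.ofReal (r t ^ (m + 2) / (m + 2)) * ENNReal.ofReal (2 * t) ≤
      ENNReal.ofReal σ⁻¹ * ∫⁻ s in Ioi (0 : ℝ), ENNReal.ofReal (G s) := by
  obtain ⟨T, hTm, hTΨ, hTd⟩ := exists_inverse_of_integral_inv hG hG0 hK
  have hT0 : T 0 = 0 := by simpa using hTΨ 0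
  have hTc : Continuous T := continuous_iff_continuousAt.2 fun y => (hTd y).continuousAt
  have hm' : (m : ℝ) ≠ 0 := by exact_mod_cast hm.ne'
  have hmσ : 0 < m * σ := mul_pos (by exact_mod_cast hm) hσ
  set q : ℝ → ℝ := fun ρ => ((ρ ^ m)⁻¹ - (R ^ m)⁻¹) / (m * σ) with hq
  have hqm : Measurable q := by fun_prop
  have hqR : q R = 0 := by simp [hq]
  have hqlt : ∀ a b, 0 < a → a < b → q b < q a := fun a b ha hab => by
    have h1 : (b ^ m)⁻¹ < (a ^ m)⁻¹ :=
      inv_strictAnti₀ (pow_pos ha m) (pow_lt_pow_left₀ hab ha.le hm.ne')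
    exact div_lt_div_of_pos_right (by linarith) hmσ
  have hqd : ∀ ρ, 0 < ρ → HasDerivAt q (-(σ * ρ ^ (m + 1))⁻¹) ρ := fun ρ hρ => by
    have h := (((hasDerivAt_pow m ρ).inv (pow_pos hρ m).ne').sub_const
      ((R ^ m)⁻¹)).div_const (m * σ)
    convert! h using 1
    obtain ⟨k, rfl⟩ : ∃ k, m = k + 1 := ⟨m - 1, by omega⟩
    have := hρ.ne'
    have := hσ.ne'
    simp only [Nat.add_sub_cancel]
    field_simp
    ring
  set w : ℝ → ℝ := fun ρ => T (q ρ) with hw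
  set w' : ℝ → ℝ := fun ρ => G (w ρ) * -(σ * ρ ^ (m + 1))⁻¹ with hw'
  have hwd : ∀ ρ, 0 < ρ → HasDerivAt w (w' ρ) ρ := fun ρ hρ =>
    (hTd (q ρ)).comp ρ (hqd ρ hρ)
  have hwm : Measurable w := hTc.measurable.comp hqm
  have hwpos : ∀ ρ ∈ Ioo 0 R, 0 < w ρ := fun ρ hρ => by
    rw [← hT0]
    refine hTm ?_
    rw [← hqR]
    exact hqlt ρ R hρ.1 hρ.2
  have hw'c : ContinuousOn w' (Ioi 0) := by
    refine (hG.comp_continuousOn fun ρ hρ => (hwd ρ hρ).continuousAt.continuousWithinAt).mul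
      (ContinuousOn.neg (ContinuousOn.inv₀ (by fun_prop) fun ρ hρ => ?_))
    exact (mul_pos hσ (pow_pos (show (0 : ℝ) < ρ from hρ) _)).ne'
  have hinj : InjOn w (Ioo 0 R) := by
    refine StrictAntiOn.injOn (fun a ha b _ hab => hTm (hqlt a b ha.1 hab))
  have hmain := hHardy w w' (fun a b ha hab hbR => by
      have hsub : uIcc a b ⊆ Ioi 0 := by
        rw [uIcc_of_le hab]
        exact fun x hx => ha.trans_le hx.1
      have hi : IntervalIntegrable w' volume a b := (hw'c.mono hsub).intervalIntegrable
      exact ⟨hi, (intervalIntegral.integral_eq_sub_of_hasDerivAt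
        (fun x hx => hwd x (hsub hx)) hi).symm⟩) (by simp only [hw, hqR, hT0])
  have hright : ∫⁻ ρ in Ioo (0:ℝ) R, ENNReal.ofReal (w' ρ ^ 2 * ρ ^ (m + 1)) ≤
      ENNReal.ofReal σ⁻¹ * ∫⁻ s in Ioi (0 : ℝ), ENNReal.ofReal (G s) := by
    calc ∫⁻ ρ in Ioo (0:ℝ) R, ENNReal.ofReal (w' ρ ^ 2 * ρ ^ (m + 1))
        = ∫⁻ ρ in Ioo (0:ℝ) R,
            ENNReal.ofReal |w' ρ| * (ENNReal.ofReal σ⁻¹ * ENNReal.ofReal (G (w ρ))) := by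
          refine setLIntegral_congr_fun measurableSet_Ioo fun ρ hρ => ?_
          have hρ0 : 0 < ρ := hρ.1
          have hp : 0 < σ * ρ ^ (m + 1) := mul_pos hσ (pow_pos hρ0 _)
          rw [← ENNReal.ofReal_mul (inv_pos.2 hσ).le, ← ENNReal.ofReal_mul (abs_nonneg _)]
          congr 1
          rw [hw']
          simp only
          rw [abs_mul, abs_neg, abs_of_pos (hG0 _), abs_of_pos (inv_pos.2 hp)]
          have := hσ.ne'
          field_simp
      _ = ∫⁻ s in w '' Ioo 0 R, ENNReal.ofReal σ⁻¹ * ENNReal.ofReal (G s) :=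
          (lintegral_image_eq_lintegral_abs_deriv_mul measurableSet_Ioo
            (fun ρ hρ => (hwd ρ hρ.1).hasDerivWithinAt) hinj
            fun s => ENNReal.ofReal σ⁻¹ * ENNReal.ofReal (G s)).symm
      _ ≤ ∫⁻ s in Ioi (0 : ℝ), ENNReal.ofReal σ⁻¹ * ENNReal.ofReal (G s) :=
          lintegral_mono_set (image_subset_iff.2 hwpos)
      _ = _ := lintegral_const_mul _ hG.measurable.ennreal_ofReal
  have hleft : ∫⁻ t in Ioi (0 : ℝ),
      ENNReal.ofReal (r t ^ (m + 2) / (m + 2)) * ENNReal.ofReal (2 * t) ≤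
      ∫⁻ ρ in Ioo (0:ℝ) R, ENNReal.ofReal (w ρ ^ 2 * ρ ^ (m + 1)) := by
    set μ : Measure ℝ :=
      (volume.restrict (Ioo 0 R)).withDensity fun ρ => ENNReal.ofReal (ρ ^ (m + 1)) with hμ
    have hdm : Measurable fun ρ : ℝ => ENNReal.ofReal (ρ ^ (m + 1)) := by fun_prop
    have hpos : ∀ᵐ ρ ∂μ, 0 ≤ w ρ :=
      (withDensity_absolutelyContinuous _ _).ae_le
        ((ae_restrict_iff' measurableSet_Ioo).2 (.of_forall fun ρ hρ => (hwpos ρ hρ).le))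
    calc ∫⁻ t in Ioi (0 : ℝ), ENNReal.ofReal (r t ^ (m + 2) / (m + 2)) * ENNReal.ofReal (2 * t)
        ≤ ∫⁻ t in Ioi (0 : ℝ), μ {ρ | t < w ρ} * ENNReal.ofReal (2 * t) := by
          refine setLIntegral_mono' measurableSet_Ioi fun t ht => ?_
          gcongr
          have h1 : ENNReal.ofReal (r t ^ (m + 2) / (m + 2)) = μ (Ioo 0 (r t)) := by
            rw [hμ, withDensity_apply _ measurableSet_Ioo, Measure.restrict_restrict
              measurableSet_Ioo, inter_eq_left.2 (Ioo_subset_Ioo_right (hrR t ht)),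
              setLIntegral_Ioo_pow _ (hr0 t ht)]
            congr 2
            push_cast
            ring
          rw [h1]
          refine measure_mono fun ρ hρ => ?_
          have hrt : 0 < r t := hρ.1.trans hρ.2
          calc t = T (∫ s in 0..t, (G s)⁻¹) := (hTΨ t).symm
            _ < T (q ρ) := hTm ((hr t ht hrt).trans_lt (hqlt ρ (r t) hρ.1 hρ.2))
      _ = ∫⁻ ρ, ENNReal.ofReal (∫ t in 0..w ρ, 2 * t) ∂μ :=
          (lintegral_comp_eq_lintegral_meas_lt_mul μ hpos hwm.aemeasurable
            (fun t _ => (by fun_prop : Continuous fun t : ℝ => 2 * t).intervalIntegrable _ _)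
            ((ae_restrict_iff' measurableSet_Ioi).2
              (.of_forall fun t ht => mul_nonneg two_pos.le (le_of_lt ht)))).symm
      _ = ∫⁻ ρ, ENNReal.ofReal (w ρ ^ 2) ∂μ := by
          refine lintegral_congr fun ρ => ?_
          rw [intervalIntegral.integral_const_mul, integral_id]
          congr 1
          ring
      _ = ∫⁻ ρ in Ioo (0:ℝ) R, ENNReal.ofReal (w ρ ^ 2 * ρ ^ (m + 1)) := by
          rw [hμ, lintegral_withDensity_eq_lintegral_mul _ hdm (by fun_prop)]
          refine lintegral_congr fun ρ => ?_
          rw [ENNReal.ofReal_mul (sq_nonneg _), mul_comm]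
          rfl
  exact (mul_le_mul_right hleft _).trans (hmain.trans hright)

end RadialComparison

section HausdorffSphere

open NormedSpace

theorem lipschitzOnWith_normalize {E : Type*} [NormedAddCommGroup E] [NormedSpace ℝ E] :
    LipschitzOnWith 2 (NormedSpace.normalize : E → E) {x | 1 ≤ ‖x‖} := by
  refine LipschitzOnWith.of_dist_le_mul fun x hx y hy => ?_
  have hx0 : 0 < ‖x‖ := one_pos.trans_le hx
  have hdec : NormedSpace.normalize x - NormedSpace.normalize y =
      ‖x‖⁻¹ • ((x - y) + (‖y‖ - ‖x‖) • NormedSpace.normalize y) := by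
    have h1 : ‖y‖ • NormedSpace.normalize y = y := norm_smul_normalize y
    rw [sub_smul, h1, sub_add_sub_cancel, smul_sub, smul_smul, inv_mul_cancel₀ hx0.ne', one_smul]
    rfl
  have hny : ‖NormedSpace.normalize y‖ = 1 := norm_normalize (norm_pos_iff.1 (one_pos.trans_le hy))
  rw [dist_eq_norm, dist_eq_norm, hdec, norm_smul, norm_inv, norm_norm]
  calc ‖x‖⁻¹ * ‖(x - y) + (‖y‖ - ‖x‖) • NormedSpace.normalize y‖
      ≤ 1 * (‖x - y‖ + ‖x - y‖) := by
        gcongr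
        · exact inv_le_one_of_one_le₀ hx
        · refine (norm_add_le _ _).trans ?_
          rw [norm_smul, hny, mul_one]
          gcongr
          rw [norm_sub_rev x y]
          exact abs_norm_sub_norm_le y x
    _ = ((2 : NNReal) : ℝ) * ‖x - y‖ := by
        push_cast
        ring

theorem hausdorffMeasure_sphere_lt_top (k : ℕ) :
    μH[(k : ℝ)] (sphere (0 : EuclideanSpace ℝ (Fin (k + 1))) 1) < ⊤ := by
  let f : Fin (k + 1) → ℝ → (Fin k → ℝ) → EuclideanSpace ℝ (Fin (k + 1)) := fun i s z =>
    NormedSpace.normalize (WithLp.toLp 2 (i.insertNth s z))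
  have hlip : ∀ i s, |s| = 1 → ∃ K, LipschitzWith K (f i s) := fun i s hs => by
    have h1 : LipschitzWith 1 fun z : Fin k → ℝ => (i.insertNth s z : Fin (k + 1) → ℝ) :=
      LipschitzWith.of_dist_le_mul fun z z' => by simp [Fin.dist_insertNth_insertNth]
    have h2 := (PiLp.lipschitzWith_toLp 2 fun _ : Fin (k + 1) => ℝ).comp h1
    have h3 := (lipschitzOnWith_normalize (E := EuclideanSpace ℝ (Fin (k + 1)))).comp
      (h2.lipschitzOnWith (s := univ)) (fun z _ => by
        have := PiLp.norm_apply_le (WithLp.toLp 2 (i.insertNth s z : Fin (k + 1) → ℝ)) i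
        simpa [hs] using this)
    exact ⟨_, lipschitzOnWith_univ.1 h3⟩
  have hfin : ∀ i s, |s| = 1 → μH[(k : ℝ)] (f i s '' closedBall 0 1) < ⊤ := fun i s hs => by
    obtain ⟨K, hK⟩ := hlip i s hs
    refine (hK.hausdorffMeasure_image_le k.cast_nonneg _).trans_lt (ENNReal.mul_lt_top ?_ ?_)
    · exact ENNReal.rpow_lt_top_of_nonneg k.cast_nonneg ENNReal.coe_ne_top
    · have := hausdorffMeasure_pi_real (ι := Fin k)
      rw [Fintype.card_fin] at this
      rw [this]
      exact measure_closedBall_lt_top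
  have hcover : sphere (0 : EuclideanSpace ℝ (Fin (k + 1))) 1 ⊆
      ⋃ i, (f i 1 '' closedBall 0 1 ∪ f i (-1) '' closedBall 0 1) := by
    intro x hx
    have hx1 : ‖x‖ = 1 := by simpa using hx
    obtain ⟨i, hi⟩ := Finite.exists_max fun i => |x i|
    have hi0 : 0 < |x i| := by
      by_contra h
      have h0 : |x i| = 0 := le_antisymm (not_lt.1 h) (abs_nonneg _)
      have : x = 0 := by
        ext j
        exact abs_eq_zero.1 (le_antisymm ((hi j).trans h0.le) (abs_nonneg _))
      simp [this] at hx1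
    have hz : ∃ z ∈ closedBall (0 : Fin k → ℝ) 1, f i (x i / |x i|) z = x := by
      refine ⟨fun j => x (i.succAbove j) / |x i|, ?_, ?_⟩
      · rw [mem_closedBall_zero_iff, pi_norm_le_iff_of_nonneg zero_le_one]
        intro j
        rw [Real.norm_eq_abs, abs_div, abs_abs, div_le_one hi0]
        exact hi _
      · have : WithLp.toLp 2 (i.insertNth (x i / |x i|) fun j => x (i.succAbove j) / |x i|) =
            |x i|⁻¹ • x := by
          ext j
          refine Fin.succAboveCases i ?_ (fun j => ?_) j
          · simp [div_eq_inv_mul]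
          · simp [div_eq_inv_mul]
        simp only [f]
        rw [this, normalize_smul_of_pos (inv_pos.2 hi0), normalize_eq_self_of_norm_eq_one hx1]
    obtain ⟨z, hz, hzx⟩ := hz
    refine mem_iUnion.2 ⟨i, ?_⟩
    rcases lt_or_gt_of_ne (abs_pos.1 hi0) with h | h
    · rw [abs_of_neg h, div_neg, div_self h.ne] at hzx
      exact Or.inr ⟨z, hz, hzx⟩
    · rw [abs_of_pos h, div_self h.ne'] at hzx
      exact Or.inl ⟨z, hz, hzx⟩
  refine (measure_mono hcover).trans_lt ((measure_iUnion_fintype_le _ _).trans_lt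
    (ENNReal.sum_lt_top.2 fun i _ => ?_))
  exact (measure_union_le _ _).trans_lt
    (ENNReal.add_lt_top.2 ⟨hfin i 1 (by simp), hfin i (-1) (by simp)⟩)

/-- Volume of the part of a thin spherical shell lying over a small subset of the sphere. -/
theorem volume_shell_inter_preimage_normalize_le {k : ℕ} {h : ℝ} (h0 : 0 < h) (hh1 : h ≤ 1)
    {t : Set (EuclideanSpace ℝ (Fin (k + 1)))} (ht : ediam t ≤ ENNReal.ofReal h) :
    volume ({x | 1 < ‖x‖ ∧ ‖x‖ < 1 + h} ∩
    NormedSpace.normalize ⁻¹' t) ≤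
      ENNReal.ofReal (h * (1 + 2 * h) ^ (k + 1)) * ediam t ^ k := by
  set B := {x : EuclideanSpace ℝ (Fin (k + 1)) | 1 < ‖x‖ ∧ ‖x‖ < 1 + h} ∩
    NormedSpace.normalize ⁻¹' t with hB
  rcases B.eq_empty_or_nonempty with hemp | ⟨x₀, hx₀⟩
  · simp [hemp]
  have hne : ∀ x ∈ B, x ≠ 0 := fun x hx => norm_pos_iff.1 (one_pos.trans hx.1.1)
  set y₀ := NormedSpace.normalize x₀ with hy₀
  have hy₀1 : ‖y₀‖ = 1 := norm_normalize (hne x₀ hx₀)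
  obtain ⟨b, hb⟩ : ∃ b : OrthonormalBasis (Fin (k + 1)) ℝ (EuclideanSpace ℝ (Fin (k + 1))),
      b 0 = y₀ := by
    have hon : Orthonormal ℝ (Set.domRestrict {(0 : Fin (k + 1))} fun _ => y₀) := by
      refine ⟨fun _ => hy₀1, fun i j hij => (hij (Subsingleton.elim i j)).elim⟩
    obtain ⟨b, hb⟩ := hon.exists_orthonormalBasis_extension_of_card_eq (by simp)
    exact ⟨b, hb 0 rfl⟩
  have htop : ediam t ≠ ⊤ := (ht.trans_lt ENNReal.ofReal_lt_top).ne
  set D := (ediam t).toReal with hD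
  have hDt : ENNReal.ofReal D = ediam t := ENNReal.ofReal_toReal htop
  have hD0 : 0 ≤ D := ENNReal.toReal_nonneg
  have hDh : D ≤ h := ENNReal.toReal_le_of_le_ofReal h0.le ht
  have hdist : ∀ y ∈ t, ∀ y' ∈ t, ‖y - y'‖ ≤ D := fun y hy y' hy' => by
    rw [← dist_eq_norm, dist_edist]
    exact ENNReal.toReal_mono htop (edist_le_ediam_of_mem hy hy')
  let e := b.measurableEquiv.trans (MeasurableEquiv.toLp 2 (Fin (k + 1) → ℝ)).symm
  have he : MeasurePreserving e :=
    b.measurePreserving_measurableEquiv.trans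
      (EuclideanSpace.volume_preserving_symm_measurableEquiv_toLp _)
  have hei : ∀ x i, e x i = inner ℝ (b i) x := fun x i => b.repr_apply_apply x i
  have hvol : volume B = volume (e '' B) := by
    rw [← he.measure_preimage_equiv, preimage_image_eq _ e.injective]
  have hx_eq : ∀ x : EuclideanSpace ℝ (Fin (k + 1)), x = ‖x‖ • NormedSpace.normalize x := fun x =>
    (norm_smul_normalize x).symm
  have hzero : ediam (Function.eval 0 '' (e '' B)) ≤ ENNReal.ofReal (h * (1 + 2 * h)) := by
    have hbd : ∀ x ∈ B, 1 - h ^ 2 / 2 ≤ inner ℝ y₀ x ∧ inner ℝ y₀ x ≤ 1 + h := fun x hx => by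
      have hy1 : ‖NormedSpace.normalize x‖ = 1 := norm_normalize (hne x hx)
      have hle1 : inner ℝ y₀ x ≤ 1 + h :=
        (real_inner_le_norm y₀ x).trans (by rw [hy₀1, one_mul]; exact hx.1.2.le)
      refine ⟨?_, hle1⟩
      have hsq := norm_sub_sq_real y₀ (NormedSpace.normalize x)
      rw [hy₀1, hy1] at hsq
      have hd : ‖y₀ - NormedSpace.normalize x‖ ^ 2 ≤ h ^ 2 :=
        pow_le_pow_left₀ (norm_nonneg _) ((hdist _ hx₀.2 _ hx.2).trans hDh) 2
      have hc : 1 - h ^ 2 / 2 ≤ inner ℝ y₀ (NormedSpace.normalize x) := by linarith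
      rw [hx_eq x, real_inner_smul_right]
      have h1 : 1 < ‖x‖ := hx.1.1
      rcases le_total 0 (inner ℝ y₀ (NormedSpace.normalize x)) with hs | hs
      · nlinarith
      · nlinarith
    refine ediam_le ?_
    rintro _ ⟨_, ⟨x, hx, rfl⟩, rfl⟩ _ ⟨_, ⟨x', hx', rfl⟩, rfl⟩
    rw [edist_dist]
    refine ENNReal.ofReal_le_ofReal ?_
    simp only [Function.eval, hei, hb, Real.dist_eq]
    have := hbd x hx
    have := hbd x' hx'
    rw [abs_le]
    constructor <;> nlinarith
  have hsucc : ∀ i : Fin k, ediam (Function.eval i.succ '' (e '' B)) ≤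
      ENNReal.ofReal (1 + 2 * h) * ediam t := fun i => by
    rw [← hDt, ← ENNReal.ofReal_mul (by linarith)]
    refine ediam_le ?_
    rintro _ ⟨_, ⟨x, hx, rfl⟩, rfl⟩ _ ⟨_, ⟨x', hx', rfl⟩, rfl⟩
    rw [edist_dist]
    refine ENNReal.ofReal_le_ofReal ?_
    simp only [Function.eval, hei, Real.dist_eq]
    have horth : inner ℝ (b i.succ) y₀ = 0 := by
      rw [← hb]
      exact b.orthonormal.2 (Fin.succ_ne_zero i)
    have hbi : ∀ v : EuclideanSpace ℝ (Fin (k + 1)), |inner ℝ (b i.succ) v| ≤ ‖v‖ := fun v => by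
      simpa using abs_real_inner_le_norm (b i.succ) v
    have hdec : inner ℝ (b i.succ) x - inner ℝ (b i.succ) x' =
        ‖x‖ * inner ℝ (b i.succ) (NormedSpace.normalize x - NormedSpace.normalize x') +
          (‖x‖ - ‖x'‖) * inner ℝ (b i.succ) (NormedSpace.normalize x' - y₀) := by
      conv_lhs => rw [hx_eq x, hx_eq x', real_inner_smul_right, real_inner_smul_right]
      rw [inner_sub_right, inner_sub_right, horth]
      ring
    rw [hdec]
    refine (abs_add_le _ _).trans ?_
    rw [abs_mul, abs_mul, abs_norm]
    have h1 := (hbi (NormedSpace.normalize x - NormedSpace.normalize x')).trans (hdist _ hx.2 _ hx'.2)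
    have h2 := (hbi (NormedSpace.normalize x' - y₀)).trans (hdist _ hx'.2 _ hx₀.2)
    have h3 : |‖x‖ - ‖x'‖| ≤ h := by
      rw [abs_le]
      constructor <;> linarith [hx.1.1, hx.1.2, hx'.1.1, hx'.1.2]
    have h4 := mul_le_mul hx.1.2.le h1 (abs_nonneg _) (by linarith)
    have h5 := mul_le_mul h3 h2 (abs_nonneg _) h0.le
    linarith
  calc volume B = volume (e '' B) := hvol
    _ ≤ ∏ i, ediam (Function.eval i '' (e '' B)) := Real.volume_pi_le_prod_diam _
    _ ≤ ENNReal.ofReal (h * (1 + 2 * h)) *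
          ∏ _i : Fin k, (ENNReal.ofReal (1 + 2 * h) * ediam t) := by
        rw [Fin.prod_univ_succ]
        exact mul_le_mul' hzero (Finset.prod_le_prod' fun i _ => hsucc i)
    _ = _ := by
        rw [Finset.prod_const, Finset.card_univ, Fintype.card_fin, mul_pow,
          ← ENNReal.ofReal_pow (by linarith), ← mul_assoc, ← ENNReal.ofReal_mul (by positivity)]
        congr 2
        ring

theorem volume_shell_le {k : ℕ} {h : ℝ} (h0 : 0 < h) (hh1 : h ≤ 1) :
    volume {x : EuclideanSpace ℝ (Fin (k + 1)) | 1 < ‖x‖ ∧ ‖x‖ < 1 + h} ≤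
      ENNReal.ofReal (h * (1 + 2 * h) ^ (k + 1)) *
        μH[(k : ℝ)] (sphere (0 : EuclideanSpace ℝ (Fin (k + 1))) 1) := by
  set A := {x : EuclideanSpace ℝ (Fin (k + 1)) | 1 < ‖x‖ ∧ ‖x‖ < 1 + h} with hA
  have hAm : MeasurableSet A :=
    (measurableSet_lt measurable_const measurable_norm).inter
      (measurableSet_lt measurable_norm measurable_const)
  set c := ENNReal.ofReal (h * (1 + 2 * h) ^ (k + 1)) with hc
  have hc0 : c ≠ 0 := by
    rw [hc, ne_eq, ENNReal.ofReal_eq_zero, not_le]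
    positivity
  have hctop : c ≠ ⊤ := ENNReal.ofReal_ne_top
  have hnm : Measurable (NormedSpace.normalize : EuclideanSpace ℝ (Fin (k + 1)) → _) := by
    unfold NormedSpace.normalize
    fun_prop
  set ν := (volume.restrict A).map NormedSpace.normalize with hν
  have hle : c⁻¹ • ν ≤ μH[(k : ℝ)] := by
    refine Measure.le_hausdorffMeasure _ _ (ENNReal.ofReal h) (ENNReal.ofReal_pos.2 h0)
      fun s hs => ?_
    rw [Measure.smul_apply, smul_eq_mul, ENNReal.rpow_natCast, ENNReal.inv_mul_le_iff hc0 hctop,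
      ← ediam_closure s]
    rw [← ediam_closure s] at hs
    calc ν s ≤ ν (closure s) := measure_mono subset_closure
      _ = volume (A ∩ NormedSpace.normalize ⁻¹' closure s) := by
          rw [hν, Measure.map_apply hnm isClosed_closure.measurableSet,
            Measure.restrict_apply (hnm isClosed_closure.measurableSet), inter_comm]
      _ ≤ _ := volume_shell_inter_preimage_normalize_le h0 hh1 hs
  have hsph : ν (sphere 0 1) = volume A := by
    rw [hν, Measure.map_apply hnm isClosed_sphere.measurableSet,
      Measure.restrict_apply (hnm isClosed_sphere.measurableSet), inter_eq_right.2]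
    intro x hx
    simpa using norm_normalize (norm_pos_iff.1 (one_pos.trans hx.1))
  rw [← hsph, ← ENNReal.inv_mul_le_iff hc0 hctop]
  exact hle (sphere 0 1)

/-- The Hausdorff measure of the unit sphere (without the normalising constant of the Euclidean
Hausdorff measure) is at least the surface area. -/
theorem mul_volume_ball_le_hausdorffMeasure_sphere (k : ℕ) :
    (k + 1) * (volume (ball (0 : EuclideanSpace ℝ (Fin (k + 1))) 1)).toReal ≤
      (μH[(k : ℝ)] (sphere (0 : EuclideanSpace ℝ (Fin (k + 1))) 1)).toReal := by
  set S := (μH[(k : ℝ)] (sphere (0 : EuclideanSpace ℝ (Fin (k + 1))) 1)).toReal with hS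
  set V := (volume (ball (0 : EuclideanSpace ℝ (Fin (k + 1))) 1)).toReal with hV
  have hVt : ENNReal.ofReal V = volume (ball (0 : EuclideanSpace ℝ (Fin (k + 1))) 1) :=
    ENNReal.ofReal_toReal measure_ball_lt_top.ne
  have hSt : ENNReal.ofReal S = μH[(k : ℝ)] (sphere (0 : EuclideanSpace ℝ (Fin (k + 1))) 1) :=
    ENNReal.ofReal_toReal (hausdorffMeasure_sphere_lt_top k).ne
  have hV0 : 0 ≤ V := ENNReal.toReal_nonneg
  have hbound : ∀ h ∈ Ioc (0 : ℝ) 1, (k + 1) * V ≤ (1 + 2 * h) ^ (k + 1) * S :=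
    fun h ⟨h0, hh1⟩ => by
    have hsub : ball (0 : EuclideanSpace ℝ (Fin (k + 1))) (1 + h) ⊆
        {x | 1 < ‖x‖ ∧ ‖x‖ < 1 + h} ∪ closedBall 0 1 := fun x hx => by
      rcases lt_or_ge 1 ‖x‖ with h1 | h1
      · exact Or.inl ⟨h1, by simpa using hx⟩
      · exact Or.inr (by simpa using h1)
    have h1 := (measure_mono hsub).trans (measure_union_le (μ := volume) _ _)
    rw [Measure.addHaar_ball _ _ (by linarith), Measure.addHaar_closedBall _ _ zero_le_one,
      finrank_euclideanSpace_fin, one_pow, ENNReal.ofReal_one, one_mul] at h1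
    replace h1 := h1.trans (add_le_add_left (volume_shell_le h0 hh1) _)
    rw [← hVt, ← hSt, ← ENNReal.ofReal_mul (by positivity), ← ENNReal.ofReal_mul (by positivity),
      ← ENNReal.ofReal_add (by positivity) hV0, ENNReal.ofReal_le_ofReal_iff (by positivity)] at h1
    have h2 : 1 + ((k + 1 : ℕ) : ℝ) * h ≤ (1 + h) ^ (k + 1) :=
      one_add_mul_le_pow (by linarith) (k + 1)
    push_cast at h2
    have h3 := mul_le_mul_of_nonneg_right h2 hV0
    refine le_of_mul_le_mul_left ?_ h0
    linarith
  have hlim : Tendsto (fun h : ℝ => (1 + 2 * h) ^ (k + 1) * S) (𝓝[>] 0) (𝓝 S) := by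
    have : Continuous fun h : ℝ => (1 + 2 * h) ^ (k + 1) * S := by fun_prop
    simpa using (this.tendsto 0).mono_left nhdsWithin_le_nhds
  exact ge_of_tendsto hlim (eventually_of_mem (Ioc_mem_nhdsGT one_pos) hbound)

end HausdorffSphere

/-- Translation of the level variable in an integral over the positive half-line. -/
theorem lintegral_comp_add_mul_eq {F : ℝ → ℝ} (hF0 : ∀ t, 0 ≤ F t) {δ : ℝ} (hδ : 0 < δ) :
    ∫⁻ t in Ioi (0 : ℝ), ENNReal.ofReal (F (t + δ) * (2 * t)) =
      ∫⁻ t in Ioi (0 : ℝ), ENNReal.ofReal (F t * (2 * (t - δ))) := by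
  have key : ∀ t ≤ δ, ENNReal.ofReal (F t * (2 * (t - δ))) = 0 := fun t ht =>
    ENNReal.ofReal_of_nonpos (mul_nonpos_of_nonneg_of_nonpos (hF0 t) (by linarith))
  rw [← lintegral_indicator measurableSet_Ioi, ← lintegral_indicator measurableSet_Ioi,
    ← lintegral_add_right_eq_self ((Ioi 0).indicator fun t =>
      ENNReal.ofReal (F t * (2 * (t - δ)))) δ]
  refine lintegral_congr fun t => ?_
  by_cases ht : 0 < t
  · rw [indicator_of_mem (mem_Ioi.2 ht), indicator_of_mem (mem_Ioi.2 (by linarith)),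
      add_sub_cancel_right]
  · rw [indicator_of_notMem (by simpa using ht)]
    by_cases ht' : 0 < t + δ
    · rw [indicator_of_mem (mem_Ioi.2 ht'), key _ (by linarith)]
    · rw [indicator_of_notMem (by simpa using ht')]

/-- A bound on the shifted integrals passes to the limit of vanishing shift. -/
theorem mul_lintegral_le_of_forall_shift {F : ℝ → ℝ} (hF0 : ∀ t, 0 ≤ F t)
    (hFm : AEMeasurable F (volume.restrict (Ioi 0))) {A E : ℝ≥0∞} (hA : A ≠ ⊤)
    (h : ∀ δ > 0, A * ∫⁻ t in Ioi (0 : ℝ), ENNReal.ofReal (F (t + δ) * (2 * t)) ≤ E) :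
    A * ∫⁻ t in Ioi (0 : ℝ), ENNReal.ofReal (F t * (2 * t)) ≤ E := by
  have hlim : Tendsto
      (fun j : ℕ => ∫⁻ t in Ioi (0 : ℝ), ENNReal.ofReal (F t * (2 * (t - 1 / ((j : ℝ) + 1)))))
      atTop (𝓝 (∫⁻ t in Ioi (0 : ℝ), ENNReal.ofReal (F t * (2 * t)))) := by
    refine lintegral_tendsto_of_tendsto_of_monotone (fun j => by fun_prop)
      (.of_forall fun t i j hij => ?_) (.of_forall fun t => ?_)
    · refine ENNReal.ofReal_le_ofReal (mul_le_mul_of_nonneg_left ?_ (hF0 t))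
      linarith [Nat.one_div_le_one_div (α := ℝ) hij]
    · refine ENNReal.tendsto_ofReal (Tendsto.const_mul _ (Tendsto.const_mul _ ?_))
      simpa using tendsto_one_div_add_atTop_nhds_zero_nat.const_sub t
  refine le_of_tendsto' (ENNReal.Tendsto.const_mul hlim (Or.inr hA)) fun j => ?_
  rw [← lintegral_comp_add_mul_eq hF0 Nat.one_div_pos_of_nat]
  exact h _ Nat.one_div_pos_of_nat

/-- The radius `r` of the ball with `cap(B_r; B_R) = C` satisfies
`r ^ m = R ^ m * (C / (c_R + C))`. -/
theorem capacitary_radius_properties {m : ℕ} (hm : 0 < m) {R c C : ℝ} (hR : 0 < R) (hc : 0 < c)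
    (hC : 0 ≤ C) :
    let r := R * (C / (c + C)) ^ (m : ℝ)⁻¹
    0 ≤ r ∧ r ≤ R ∧ r ^ m = R ^ m * (C / (c + C)) ∧
      r ^ (m + 2) = R ^ (m + 2) * (C / (c + C)) ^ (((m + 2 : ℕ) : ℝ) / m) := by
  have hq0 : 0 ≤ C / (c + C) := by positivity
  have hq1 : C / (c + C) ≤ 1 := div_le_one_of_le₀ (by linarith) (by positivity)
  refine ⟨by positivity, ?_, ?_, ?_⟩
  · exact mul_le_of_le_one_right hR.le (Real.rpow_le_one hq0 hq1 (by positivity))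
  · rw [mul_pow, Real.rpow_inv_natCast_pow hq0 hm.ne']
  · rw [mul_pow, ← Real.rpow_mul_natCast hq0, inv_mul_eq_div]

/-- The capacitary Faber–Krahn inequality with levels shifted by a positive amount. -/
theorem TestFun.capacitary_faberKrahn_shift {m : ℕ} (hm : 0 < m)
    {Ω : Set (EuclideanSpace ℝ (Fin (m + 2)))} {R κ : ℝ} (hR : 0 < R)
    (hHardy : ∀ w w' : ℝ → ℝ,
      (∀ a b : ℝ, 0 < a → a ≤ b → b ≤ R →
        IntervalIntegrable w' volume a b ∧ w b - w a = ∫ s in a..b, w' s) →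
      w R = 0 →
      ENNReal.ofReal κ * ∫⁻ ρ in Ioo (0:ℝ) R, ENNReal.ofReal (w ρ ^ 2 * ρ ^ (m + 1)) ≤
        ∫⁻ ρ in Ioo (0:ℝ) R, ENNReal.ofReal (w' ρ ^ 2 * ρ ^ (m + 1)))
    {S : ℝ} (hS : (m + 2) * (volume (ball (0 : EuclideanSpace ℝ (Fin (m + 2))) 1)).toReal ≤ S)
    {u : EuclideanSpace ℝ (Fin (m + 2)) → ℝ} (hu : TestFun Ω u) {δ : ℝ} (hδ : 0 < δ) :
    ENNReal.ofReal κ * volume (ball (0 : EuclideanSpace ℝ (Fin (m + 2))) R) *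
      ∫⁻ t in Ioi (0:ℝ), ENNReal.ofReal
        ((harmCap {x ∈ Ω | t + δ ≤ |u x|} Ω / (m * S * R ^ m + harmCap {x ∈ Ω | t + δ ≤ |u x|} Ω)) ^
          (((m + 2 : ℕ) : ℝ) / m) * (2 * t)) ≤
      ∫⁻ x in Ω, ENNReal.ofReal (‖fderiv ℝ u x‖ ^ 2) := by
  set V := (volume (ball (0 : EuclideanSpace ℝ (Fin (m + 2))) 1)).toReal with hV
  have hV0 : 0 < V := ENNReal.toReal_pos (measure_ball_pos _ _ one_pos).ne' measure_ball_lt_top.ne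
  have hσ : 0 < (m + 2) * V := by positivity
  have hS0 : 0 < S := hσ.trans_le hS
  have hm0 : (0 : ℝ) < m := by exact_mod_cast hm
  have hc : 0 < m * S * R ^ m := by positivity
  set c := m * S * R ^ m with hcdef
  set C : ℝ → ℝ := fun t => harmCap {x ∈ Ω | t + δ ≤ |u x|} Ω with hC
  have hC0 : ∀ t, 0 ≤ C t := fun t => harmCap_nonneg _ _
  have hprop := fun t => capacitary_radius_properties hm hR hc (hC0 t)
  have hvol : volume (ball (0 : EuclideanSpace ℝ (Fin (m + 2))) R) =
      ENNReal.ofReal (R ^ (m + 2) * V) := by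
    rw [Measure.addHaar_ball _ _ hR.le, finrank_euclideanSpace_fin,
      ENNReal.ofReal_mul (by positivity), hV, ENNReal.ofReal_toReal measure_ball_lt_top.ne]
  obtain ⟨η, hη⟩ := exists_isMollifier hδ
  refine ENNReal.le_of_forall_pos_le_add fun ε hε _ => ?_
  obtain ⟨G, hG, hG0, ⟨K, hK⟩, hle, hGE⟩ := hu.exists_energyDensity hη (NNReal.coe_pos.2 hε)
  rw [ENNReal.ofReal_coe_nnreal] at hGE
  have hmain := lintegral_rearranged_le (R := R) (κ := κ) hm hHardy hG hG0 hK hσ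
    (r := fun t => R * (C t / (c + C t)) ^ (m : ℝ)⁻¹) (fun t _ => (hprop t).1)
    (fun t _ => (hprop t).2.1) fun t ht hr => by
      have hCt : 0 < C t := by
        refine (hC0 t).lt_of_ne fun h0 => ?_
        simp [← h0, Real.zero_rpow (inv_ne_zero hm0.ne')] at hr
      have hcap := hu.harmCap_le_inv_integral hδ hη hG hG0 hle ht
      change C t ≤ _ at hcap
      have hint : ∫ s in 0..t, (G s)⁻¹ ≤ (C t)⁻¹ := by
        simpa using inv_anti₀ hCt hcap
      refine hint.trans ?_
      rw [(hprop t).2.2.1, le_div_iff₀ (by positivity)]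
      have : (R ^ m * (C t / (c + C t)))⁻¹ - (R ^ m)⁻¹ = (C t)⁻¹ * (m * S) := by
        have : c + C t ≠ 0 := by positivity
        field_simp
        rw [hcdef]
        ring
      rw [this]
      gcongr
  refine le_trans (le_of_eq ?_) ((mul_le_mul_right hmain (ENNReal.ofReal ((m + 2) * V))).trans ?_)
  · rw [mul_left_comm, mul_assoc, hvol]
    congr 1
    rw [← lintegral_const_mul' _ _ ENNReal.ofReal_ne_top,
      ← lintegral_const_mul' _ _ ENNReal.ofReal_ne_top]
    refine setLIntegral_congr_fun measurableSet_Ioi fun t ht => ?_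
    have ht0 : (0 : ℝ) < t := ht
    have hr0 := (hprop t).1
    have hq0 : 0 ≤ C t / (c + C t) := div_nonneg (hC0 t) (add_nonneg hc.le (hC0 t))
    rw [(hprop t).2.2.2, ← ENNReal.ofReal_mul (by positivity), ← ENNReal.ofReal_mul (by positivity),
      ← ENNReal.ofReal_mul (by positivity)]
    congr 1
    field_simp
    rfl
  · rw [← mul_assoc, ← ENNReal.ofReal_mul hσ.le, mul_inv_cancel₀ hσ.ne',
      ENNReal.ofReal_one, one_mul]
    exact hGE

/-- the capacitary refinement of the Faber–Krahn inequality, `n > 2`. -/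
theorem stmt_2 (n : ℕ) (hn : 2 < n) (Ω : Set (EuclideanSpace ℝ (Fin n))) (hΩ : IsOpen Ω)
    (R : ℝ) (hR : 0 < R) (κ : ℝ) (hκ : 0 < κ)
    -- `κ` satisfies the one-dimensional weighted Hardy-type inequality for all
    -- locally absolutely continuous `w` on `(0,R]` with `w(R) = 0`
    (hHardy : ∀ w w' : ℝ → ℝ,
      (∀ a b : ℝ, 0 < a → a ≤ b → b ≤ R →
        IntervalIntegrable w' volume a b ∧ w b - w a = ∫ s in a..b, w' s) →
      w R = 0 →
      ENNReal.ofReal κ * ∫⁻ ρ in Ioo (0:ℝ) R, ENNReal.ofReal (w ρ ^ 2 * ρ ^ (n - 1)) ≤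
        ∫⁻ ρ in Ioo (0:ℝ) R, ENNReal.ofReal (w' ρ ^ 2 * ρ ^ (n - 1)))
    (u : EuclideanSpace ℝ (Fin n) → ℝ) (hu : TestFun Ω u) :
    ENNReal.ofReal κ * volume (ball (0 : EuclideanSpace ℝ (Fin n)) R) *
      ∫⁻ t in Ioi (0:ℝ), ENNReal.ofReal
        (((harmCap {x ∈ Ω | t ≤ |u x|} Ω) /
            (((n : ℝ) - 2) * (μH[(n : ℝ) - 1] (sphere (0 : EuclideanSpace ℝ (Fin n)) 1)).toReal
                * R ^ (n - 2) +
              harmCap {x ∈ Ω | t ≤ |u x|} Ω)) ^ ((n : ℝ) / ((n : ℝ) - 2)) * (2 * t)) ≤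
      ∫⁻ x in Ω, ENNReal.ofReal (‖fderiv ℝ u x‖ ^ 2) := by
  obtain ⟨m, rfl⟩ : ∃ m, n = m + 2 := ⟨n - 2, by omega⟩
  have hm : 0 < m := by omega
  have h1 : ((m + 2 : ℕ) : ℝ) - 1 = ((m + 1 : ℕ) : ℝ) := by
    push_cast
    ring
  have h2 : ((m + 2 : ℕ) : ℝ) - 2 = m := by
    push_cast
    ring
  rw [h1, h2]
  change ∀ w w' : ℝ → ℝ, _ → _ → ENNReal.ofReal κ * ∫⁻ ρ in Ioo (0:ℝ) R,
    ENNReal.ofReal (w ρ ^ 2 * ρ ^ (m + 1)) ≤ _ at hHardy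
  have hS := mul_volume_ball_le_hausdorffMeasure_sphere (m + 1)
  set S := (μH[((m + 1 : ℕ) : ℝ)] (sphere (0 : EuclideanSpace ℝ (Fin (m + 2))) 1)).toReal
  replace hS : (m + 2) * (volume (ball (0 : EuclideanSpace ℝ (Fin (m + 2))) 1)).toReal ≤ S := by
    convert hS using 2
    push_cast
    ring
  have hS0 : 0 ≤ S := ENNReal.toReal_nonneg
  refine mul_lintegral_le_of_forall_shift
    (F := fun t => (harmCap {x ∈ Ω | t ≤ |u x|} Ω /
      (m * S * R ^ m + harmCap {x ∈ Ω | t ≤ |u x|} Ω)) ^ (((m + 2 : ℕ) : ℝ) / m))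
    (fun t => ?_) ?_ (ENNReal.mul_ne_top ENNReal.ofReal_ne_top measure_ball_lt_top.ne)
    fun δ hδ => hu.capacitary_faberKrahn_shift hm hR hHardy hS hδ
  · have := harmCap_nonneg {x ∈ Ω | t ≤ |u x|} Ω
    positivity
  · have hmeas : AEMeasurable (fun t => harmCap {x ∈ Ω | t ≤ |u x|} Ω)
        (volume.restrict (Ioi 0)) :=
      aemeasurable_restrict_of_antitoneOn measurableSet_Ioi hu.antitoneOn_harmCap
    fun_prop
end
end

section
/- (Necessity part of the criterion for p = 1.) Let Ω ⊆ ℝⁿ be open, let q ≥ 1, let C ≥ 0, and let μ be a nonnegative measure on Ω×Ω which is locally finite outside the diagonal. Suppose that for every u ∈ C^∞(Ω), ( ∫_Ω ∫_Ω |u(x) − u(y)|^q μ(dx,dy) )^{1/q} ≤ C · ∫_Ω |∇u| dx. Then for every open subset g of Ω one has μ(g × (Ω∖ḡ)) + μ((Ω∖ḡ) × g) ≤ ( C · H^{n−1}(Ω ∩ ∂g) )^q, where ḡ denotes the closure of g and ∂g its topological boundary. -/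
open MeasureTheory Metric Set Filter
open scoped ENNReal Topology MeasureTheory

noncomputable section

section

open scoped NNReal Convolution Manifold

theorem exists_mem_frontier_of_mem_of_notMem {E : Type*} [NormedAddCommGroup E]
    [NormedSpace ℝ E] {g : Set E} (hg : IsOpen g) {x v : E} {h : ℝ}
    (hh : 0 ≤ h) (hx : x ∉ g) (hxg : x - h • v ∈ g) :
    ∃ s ∈ Icc 0 h, x - s • v ∈ frontier g := by
  by_contra! H
  have hcont : Continuous fun s : ℝ => x - s • v := by fun_prop
  have hpre : IsPreconnected ((fun s : ℝ => x - s • v) '' Icc 0 h) :=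
    isPreconnected_Icc.image _ hcont.continuousOn
  have hsub := hpre.subset_of_closure_inter_subset hg
    ⟨_, ⟨h, ⟨hh, le_rfl⟩, rfl⟩, hxg⟩ (by
      rintro y ⟨hy, s, hs, rfl⟩
      by_contra hyg
      exact H s hs (by rw [hg.frontier_eq]; exact ⟨hy, hyg⟩))
  exact hx (by simpa using hsub ⟨0, ⟨le_rfl, hh⟩, rfl⟩)

theorem exists_compact_exhaustion {X : Type*} [TopologicalSpace X] [LocallyCompactSpace X]
    [SecondCountableTopology X] {Ω : Set X} (hΩ : IsOpen Ω) :
    ∃ C : ℕ → Set X, (∀ i, IsCompact (C i)) ∧ (∀ i, C i ⊆ Ω) ∧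
      (∀ i, C i ⊆ interior (C (i + 1))) ∧ ∀ x ∈ Ω, ∃ j, C j ∈ 𝓝 x := by
  have := hΩ.locallyCompactSpace
  let K : CompactExhaustion Ω := default
  have hint : ∀ i, Subtype.val '' K i ⊆ interior (Subtype.val '' K (i + 1)) := fun i =>
    (image_mono (K.subset_interior_succ i)).trans
      (interior_maximal (image_mono interior_subset) (hΩ.isOpenMap_subtype_val _ isOpen_interior))
  refine ⟨fun i => Subtype.val '' K i, fun i => (K.isCompact i).image continuous_subtype_val,
    fun i => by simp, hint, fun x hx => ?_⟩
  obtain ⟨i, hi⟩ := K.exists_mem ⟨x, hx⟩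
  exact ⟨i + 1, mem_interior_iff_mem_nhds.1 (hint i ⟨_, hi, rfl⟩)⟩

/-- An open set carries a smooth compactly supported partition of unity `ζ` such that `ζ i` vanishes
near the `i`-th set of an exhaustion, where the first `i` functions already sum to one. -/
theorem exists_contDiff_exhaustion_partition {E : Type*}
    [NormedAddCommGroup E] [NormedSpace ℝ E] [FiniteDimensional ℝ E] {Ω : Set E} (hΩ : IsOpen Ω) :
    ∃ (ζ : ℕ → E → ℝ) (K : ℕ → Set E), (∀ i, ContDiff ℝ (⊤ : ℕ∞) (ζ i)) ∧
      (∀ i, HasCompactSupport (ζ i)) ∧ (∀ i, tsupport (ζ i) ⊆ Ω) ∧ (∀ i x, 0 ≤ ζ i x) ∧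
      Monotone K ∧ (∀ x ∈ Ω, ∃ j, K j ∈ 𝓝 x) ∧
      (∀ i, ∃ r > 0, ∀ x ∈ K i, ∀ y ∈ ball x r, ζ i y = 0) ∧
      ∀ i, ∀ x ∈ K i, ∑ j ∈ Finset.range i, ζ j x = 1 := by
  obtain ⟨C, hC, hCΩ, hCint, hCx⟩ := exists_compact_exhaustion hΩ
  have hθ (i : ℕ) : ∃ f : E → ℝ, ContDiff ℝ (⊤ : ℕ∞) f ∧ (∀ᶠ x in 𝓝ˢ (C i), f x = 1) ∧
      (∀ x ∉ C (i + 1), f x = 0) ∧ ∀ x, f x ∈ Icc 0 1 := by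
    obtain ⟨f, h1, h2, h3⟩ := exists_contMDiffMap_one_nhds_of_subset_interior 𝓘(ℝ, E) (n := (⊤ : ℕ∞))
      (hC i).isClosed (hCint i)
    exact ⟨f, f.contMDiff.contDiff, h1, h2, h3⟩
  choose θ hθs hθ1 hθ0 hθI using hθ
  have hmono : Monotone C := monotone_nat_of_le_succ fun i => (hCint i).trans interior_subset
  let Θ : ℕ → E → ℝ := fun i => Nat.casesOn i (fun _ => 0) θ
  have hΘs : ∀ i, ContDiff ℝ (⊤ : ℕ∞) (Θ i) := by
    rintro (_ | i)
    · exact contDiff_const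
    · exact hθs i
  have hΘ0 : ∀ i, ∀ x ∉ C i, Θ i x = 0 := by
    rintro (_ | i) x hx
    · rfl
    · exact hθ0 i x hx
  let K : ℕ → Set E := fun i => Nat.casesOn i ∅ C
  have hsupp : ∀ i, tsupport (fun x => Θ (i + 1) x - Θ i x) ⊆ C (i + 1) := fun i =>
    closure_minimal (fun x hx => by
      by_contra hxC
      exact hx (by
        change Θ (i + 1) x - Θ i x = 0
        rw [hΘ0 _ x hxC, hΘ0 i x fun h => hxC (hmono i.le_succ h), sub_zero])) (hC _).isClosed
  refine ⟨fun i x => Θ (i + 1) x - Θ i x, K, fun i => (hΘs (i + 1)).sub (hΘs i), fun i =>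
    (hC (i + 1)).of_isClosed_subset (isClosed_tsupport _) (hsupp i),
    fun i => (hsupp i).trans (hCΩ _), fun i x => ?_, ?_, fun x hx => ?_, fun i => ?_, ?_⟩
  · by_cases hx : x ∈ C i
    · have h1 : Θ (i + 1) x = 1 := (hθ1 i).self_of_nhdsSet x hx
      have h2 : Θ i x ≤ 1 := by
        rcases i with _ | i
        · exact zero_le_one
        · exact (hθI i x).2
      linarith
    · change 0 ≤ Θ (i + 1) x - Θ i x
      rw [hΘ0 i x hx, sub_zero]
      exact (hθI i x).1
  · refine monotone_nat_of_le_succ ?_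
    rintro (_ | i)
    · exact empty_subset _
    · exact hmono i.le_succ
  · obtain ⟨j, hj⟩ := hCx x hx
    exact ⟨j + 1, hj⟩
  · rcases i with _ | i
    · exact ⟨1, one_pos, fun x hx => hx.elim⟩
    · have h1 : ∀ᶠ x in 𝓝ˢ (C i), Θ (i + 2) x - Θ (i + 1) x = 0 := by
        filter_upwards [hθ1 i, nhdsSet_mono (hmono i.le_succ) (hθ1 (i + 1))] with x hx hx'
        change θ (i + 1) x - θ i x = 0
        rw [hx, hx', sub_self]
      obtain ⟨U, hU, hCU, hUz⟩ := eventually_nhdsSet_iff_exists.1 h1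
      obtain ⟨r, hr, hrU⟩ := (hC i).exists_thickening_subset_open hU hCU
      exact ⟨r, hr, fun x hx y hy => hUz y (hrU (mem_thickening_iff.2 ⟨x, hx, hy⟩))⟩
  · rintro (_ | i) x hx
    · exact hx.elim
    · rw [Finset.sum_range_sub (fun i => Θ i x)]
      change θ i x - 0 = 1
      rw [sub_zero]
      exact (hθ1 i).self_of_nhdsSet x hx

variable {E : Type*} [NormedAddCommGroup E] [InnerProductSpace ℝ E] [FiniteDimensional ℝ E]
  [MeasurableSpace E] [BorelSpace E]

/-- The union of the translates of `S` along the segment from `0` to `h • v`. -/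
def sweep (S : Set E) (v : E) (h : ℝ) : Set E := {x | ∃ s ∈ Icc 0 h, x - s • v ∈ S}

theorem volume_sweep_le_ediam (S : Set E) {v : E} (hv : ‖v‖ = 1) (h : ℝ) :
    volume (sweep S v h) ≤
      (ediam S) ^ ((Module.finrank ℝ E : ℝ) - 1) * (ediam S + ENNReal.ofReal h) := by
  have hpos : 0 < Module.finrank ℝ E := by
    have : Nontrivial E := ⟨v, 0, by rintro rfl; simp at hv⟩
    exact Module.finrank_pos
  set n := Module.finrank ℝ E with hn
  let i0 : Fin n := ⟨0, hpos⟩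
  obtain ⟨b, hb⟩ := Orthonormal.exists_orthonormalBasis_extension_of_card_eq (𝕜 := ℝ) (E := E)
    (ι := Fin n) (by simp [hn]) (v := fun _ => v) (s := {i0}) (by
      rw [orthonormal_iff_ite]
      intro i j
      have : i = j := Subsingleton.elim _ _
      subst this
      simp [hv])
  have hb0 : b i0 = v := hb i0 rfl
  have hmp : MeasurePreserving (fun x => WithLp.ofLp (b.repr x)) volume volume :=
    (PiLp.volume_preserving_ofLp (Fin n)).comp b.measurePreserving_repr
  set F : E → (Fin n → ℝ) := fun x => WithLp.ofLp (b.repr x)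
  have hF : volume (sweep S v h) = volume (F '' sweep S v h) := by
    have e : MeasurableEmbedding F :=
      (MeasurableEquiv.toLp 2 (Fin n → ℝ)).symm.measurableEmbedding.comp
      b.repr.toHomeomorph.measurableEmbedding
    rw [← hmp.measure_preimage_emb e, preimage_image_eq _ e.injective]
  rw [hF]
  refine (Real.volume_pi_le_prod_diam _).trans ?_
  have hcoord : ∀ x i, F x i = inner ℝ (b i) x := fun x i => b.repr_apply_apply x i
  have hc : ∀ x y i, edist (F x i) (F y i) ≤ edist x y := by
    intro x y i
    rw [hcoord, hcoord, edist_dist, edist_dist, dist_eq_norm, dist_eq_norm, ← inner_sub_right]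
    apply ENNReal.ofReal_le_ofReal
    simpa using norm_inner_le_norm (𝕜 := ℝ) (b i) (x - y)
  rw [← Finset.mul_prod_erase _ _ (Finset.mem_univ i0), mul_comm]
  gcongr
  · calc _ ≤ ∏ i ∈ Finset.univ.erase i0, ediam S := by
          refine Finset.prod_le_prod' fun i hi => ?_
          refine ediam_le ?_
          rintro _ ⟨_, ⟨x, ⟨s, hs, hx⟩, rfl⟩, rfl⟩ _ ⟨_, ⟨y, ⟨t, ht, hy⟩, rfl⟩, rfl⟩
          have h0 : inner ℝ (b i) v = 0 := by
            rw [← hb0]; exact b.orthonormal.2 (Finset.ne_of_mem_erase hi)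
          have h1 : ∀ (x : E) (s : ℝ), F x i = F (x - s • v) i := by
            intro x s; simp [hcoord, inner_sub_right, inner_smul_right, h0]
          change edist (F x i) (F y i) ≤ _
          rw [h1 x s, h1 y t]
          exact (hc _ _ _).trans (edist_le_ediam_of_mem hx hy)
      _ = _ := by
          simp [Finset.card_erase_of_mem]
          rw [← ENNReal.rpow_natCast]; congr 1; push_cast [Nat.cast_sub hpos]; ring
  · refine ediam_le ?_
    rintro _ ⟨_, ⟨x, ⟨s, hs, hx⟩, rfl⟩, rfl⟩ _ ⟨_, ⟨y, ⟨t, ht, hy⟩, rfl⟩, rfl⟩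
    have h0 : inner ℝ (b i0) v = 1 := by rw [hb0]; simp [hv]
    have h1 : ∀ (x : E) (s : ℝ), F x i0 = F (x - s • v) i0 + s := by
      intro x s; simp [hcoord, inner_sub_right, inner_smul_right, h0]
    change edist (F x i0) (F y i0) ≤ _
    rw [h1 x s, h1 y t]
    refine (edist_add_add_le _ _ _ _).trans (add_le_add
      ((hc _ _ _).trans (edist_le_ediam_of_mem hx hy)) ?_)
    rw [edist_dist]
    exact ENNReal.ofReal_le_ofReal ((Real.dist_le_of_mem_Icc hs ht).trans (by simp))

theorem volume_sweep_le (S : Set E) {v : E} (hv : ‖v‖ = 1) {h : ℝ} (hh : 0 < h) :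
    volume (sweep S v h) ≤
      ENNReal.ofReal h * μH[(Module.finrank ℝ E : ℝ) - 1] S := by
  have key : ∀ r : ℝ≥0∞, 0 < r → r < ⊤ → volume (sweep S v h) ≤
      (r + ENNReal.ofReal h) * μH[(Module.finrank ℝ E : ℝ) - 1] S := by
    intro r hr hr'
    have h1 := Measure.hausdorffMeasure_apply ((Module.finrank ℝ E : ℝ) - 1) S
    refine le_trans ?_ (mul_le_mul_right (h1 ▸ le_iSup₂ (α := ℝ≥0∞) r hr) _)
    simp_rw [ENNReal.mul_iInf_of_ne (a := r + ENNReal.ofReal h) (by simp [hr.ne']) (by simp [hr'.ne])]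
    refine le_iInf fun t => le_iInf fun ht => le_iInf fun htr => ?_
    rw [← ENNReal.tsum_mul_left]
    have hsub : sweep S v h ⊆ ⋃ i, sweep (t i) v h := by
      rintro x ⟨s, hs, hx⟩
      obtain ⟨i, hi⟩ := mem_iUnion.1 (ht hx)
      exact mem_iUnion.2 ⟨i, s, hs, hi⟩
    refine (measure_mono hsub).trans ((measure_iUnion_le _).trans (ENNReal.tsum_le_tsum fun i => ?_))
    rcases (t i).eq_empty_or_nonempty with h0 | h0
    · simp [sweep, h0]
    · refine (volume_sweep_le_ediam _ hv h).trans ?_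
      simp only [h0, iSup_pos]
      rw [mul_comm]
      gcongr
      exact htr i
  have hlim : Tendsto (fun r : ℝ≥0∞ => (r + ENNReal.ofReal h) *
      μH[(Module.finrank ℝ E : ℝ) - 1] S) (𝓝[>] 0)
      (𝓝 ((0 + ENNReal.ofReal h) * μH[(Module.finrank ℝ E : ℝ) - 1] S)) := by
    refine ENNReal.Tendsto.mul_const ?_ (Or.inl (by simpa using hh))
    exact (tendsto_id.add tendsto_const_nhds).mono_left nhdsWithin_le_nhds
  rw [zero_add] at hlim
  refine ge_of_tendsto hlim ?_
  filter_upwards [self_mem_nhdsWithin, mem_nhdsWithin_of_mem_nhds (Iio_mem_nhds ENNReal.zero_lt_top)]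
    with r hr hr' using key r hr hr'

theorem setLIntegral_crossing_le {Ω g : Set E} (hg : IsOpen g)
    {φ : E → ℝ} {L : ℝ≥0} (hφL : LipschitzWith L φ) (hφ0 : ∀ x, 0 ≤ φ x)
    {v : E} (hv : ‖v‖ = 1) {h : ℝ} (hh : 0 < h)
    (hseg : ∀ x, 0 < φ x → ∀ s ∈ Icc 0 h, x - s • v ∈ Ω) :
    ∫⁻ x in gᶜ ∩ {x | x - h • v ∈ g}, ENNReal.ofReal (φ x) ≤
      ENNReal.ofReal h * ∫⁻ y, ENNReal.ofReal (φ y + L * h)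
        ∂(μH[(Module.finrank ℝ E : ℝ) - 1].restrict (Ω ∩ frontier g)) := by
  have hφc := hφL.continuous
  rw [lintegral_eq_lintegral_meas_lt _ (Eventually.of_forall hφ0) hφc.measurable.aemeasurable,
    lintegral_eq_lintegral_meas_lt _ (Eventually.of_forall fun y => by
      have := hφ0 y; simp only [Pi.zero_apply]; positivity)
      (by fun_prop), ← lintegral_const_mul' _ _ ENNReal.ofReal_ne_top]
  refine setLIntegral_mono' measurableSet_Ioi fun t (ht : 0 < t) => ?_
  rw [Measure.restrict_apply (measurableSet_lt measurable_const hφc.measurable),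
    Measure.restrict_apply (measurableSet_lt measurable_const (by fun_prop))]
  refine le_trans (measure_mono ?_) (volume_sweep_le _ hv hh)
  rintro x ⟨hxt : t < φ x, hxg, hxg' : x - h • v ∈ g⟩
  obtain ⟨s, hs, hsf⟩ := exists_mem_frontier_of_mem_of_notMem hg hh.le hxg hxg'
  refine ⟨s, hs, ?_, hseg x (ht.trans hxt) s hs, hsf⟩
  have h1 := hφL.dist_le_mul x (x - s • v)
  rw [dist_eq_norm x, sub_sub_cancel, norm_smul, hv, mul_one, Real.norm_of_nonneg hs.1] at h1
  have h2 : (L : ℝ) * s ≤ L * h := by gcongr; exact hs.2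
  have h3 := (le_abs_self _).trans h1
  change t < φ (x - s • v) + L * h
  linarith

theorem hasDerivAt_setIntegral_translate {φ : E → ℝ} (hφ : ContDiff ℝ 1 φ)
    (hφc : HasCompactSupport φ) (v : E) (g : Set E) :
    HasDerivAt (fun h : ℝ => ∫ x in g, φ (x + h • v)) (∫ x in g, fderiv ℝ φ x v) 0 := by
  have hfc : Continuous (fderiv ℝ φ) := hφ.continuous_fderiv one_ne_zero
  obtain ⟨C, hC⟩ := (hφc.fderiv ℝ).exists_bound_of_continuous hfc
  set K := cthickening ‖v‖ (tsupport φ)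
  have hK : IsCompact K := hφc.isCompact.cthickening
  have := hasDerivAt_integral_of_dominated_loc_of_deriv_le (μ := volume.restrict g)
    (F := fun (h : ℝ) x => φ (x + h • v)) (F' := fun h x => fderiv ℝ φ (x + h • v) v)
    (x₀ := (0 : ℝ)) (s := ball 0 1) (bound := K.indicator fun _ => C * ‖v‖)
    (ball_mem_nhds _ one_pos)
    (Eventually.of_forall fun h => by
      have := hφ.continuous
      exact Continuous.aestronglyMeasurable (by fun_prop))
    (by simpa [IntegrableOn] using (hφ.continuous.integrable_of_hasCompactSupport hφc).integrableOn)
    (by exact Continuous.aestronglyMeasurable (by fun_prop))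
    (Eventually.of_forall fun x h hh => by
      by_cases hx : x + h • v ∈ tsupport φ
      · have hxK : x ∈ K := by
          refine mem_cthickening_of_dist_le x _ _ _ hx ?_
          rw [dist_eq_norm, sub_add_cancel_left, norm_neg, norm_smul]
          have : ‖h‖ ≤ 1 := by simpa using (mem_ball_zero_iff.1 hh).le
          nlinarith [norm_nonneg v]
        rw [indicator_of_mem hxK]
        exact (ContinuousLinearMap.le_opNorm _ _).trans (by gcongr; exact hC _)
      · have : fderiv ℝ φ (x + h • v) = 0 := by
          by_contra h0
          exact hx (support_fderiv_subset ℝ h0)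
        simp only [this]
        have h0 : 0 ≤ C := (norm_nonneg _).trans (hC 0)
        simpa using indicator_nonneg (fun _ _ => by positivity) x)
    ((integrable_indicator_iff hK.measurableSet).2
      (integrableOn_const (by
        exact ((Measure.restrict_apply_le _ _).trans_lt hK.measure_lt_top).ne)))
    (Eventually.of_forall fun x h _ => by
      have h1 := (hφ.differentiable one_ne_zero (x + h • v)).hasFDerivAt
      have h2 : HasDerivAt (fun h : ℝ => x + h • v) v h := by
        simpa using ((hasDerivAt_id h).smul_const v).const_add x
      exact h1.comp_hasDerivAt h h2)
  simpa using this.2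

theorem setIntegral_translate_sub_le {g : Set E} (hg : MeasurableSet g)
    {φ : E → ℝ} (hφ : Continuous φ) (hφc : HasCompactSupport φ) (hφ0 : ∀ x, 0 ≤ φ x) (w : E) :
    (∫ x in g, φ (x + w)) - ∫ x in g, φ x ≤ ∫ x in gᶜ ∩ {x | x - w ∈ g}, φ x := by
  have hint : Integrable φ := hφ.integrable_of_hasCompactSupport hφc
  have hm : MeasurableSet {x | x - w ∈ g} := (measurable_id.sub_const w) hg
  have h1 : ∫ x in g, φ (x + w) = ∫ x in {x | x - w ∈ g}, φ x := by
    rw [← integral_indicator hg, ← integral_indicator hm,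
      ← integral_add_right_eq_self ({x | x - w ∈ g}.indicator φ) w]
    congr 1; ext x
    by_cases hx : x ∈ g <;> simp [hx]
  rw [h1, sub_le_iff_le_add, ← setIntegral_union
    (disjoint_compl_left.mono_left inter_subset_left) hg hint.integrableOn hint.integrableOn]
  refine setIntegral_mono_set hint.integrableOn (Eventually.of_forall hφ0)
    (LE.le.eventuallyLE fun x hx => ?_)
  by_cases hxg : x ∈ g
  · exact Or.inr hxg
  · exact Or.inl ⟨hxg, hx⟩

/-- The distributional derivative of the indicator of `g` in a unit direction is bounded, inside `Ω`,
by the Hausdorff measure on `Ω ∩ frontier g`. -/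
theorem ofReal_setIntegral_fderiv_le {Ω g : Set E} (hΩ : IsOpen Ω) (hg : IsOpen g)
    (hfin : μH[(Module.finrank ℝ E : ℝ) - 1] (Ω ∩ frontier g) ≠ ⊤)
    {φ : E → ℝ} (hφ : ContDiff ℝ 1 φ) (hφc : HasCompactSupport φ) (hφΩ : tsupport φ ⊆ Ω)
    (hφ0 : ∀ x, 0 ≤ φ x) {v : E} (hv : ‖v‖ = 1) :
    ENNReal.ofReal (∫ x in g, fderiv ℝ φ x v) ≤ ∫⁻ y, ENNReal.ofReal (φ y)
        ∂(μH[(Module.finrank ℝ E : ℝ) - 1].restrict (Ω ∩ frontier g)) := by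
  set ν := (μH[(Module.finrank ℝ E : ℝ) - 1] : Measure E).restrict (Ω ∩ frontier g) with hν
  obtain ⟨L, hL⟩ := hφ.lipschitzWith_of_hasCompactSupport hφc one_ne_zero
  obtain ⟨δ, hδ, hδΩ⟩ := hφc.isCompact.exists_cthickening_subset_open hΩ hφΩ
  have hlim := (hasDerivAt_setIntegral_translate hφ hφc v g).tendsto_slope_zero_right
  have hlim' : Tendsto (fun h : ℝ => ∫⁻ y, ENNReal.ofReal (φ y) ∂ν +
      ENNReal.ofReal (L * h) * ν univ) (𝓝[>] 0)
      (𝓝 (∫⁻ y, ENNReal.ofReal (φ y) ∂ν + ENNReal.ofReal (L * 0) * ν univ)) := by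
    refine tendsto_const_nhds.add (ENNReal.Tendsto.mul_const ?_ (Or.inr (by simpa [hν] using hfin)))
    refine (ENNReal.continuous_ofReal.tendsto _).comp ?_
    exact ((continuous_const.mul continuous_id).tendsto 0).mono_left nhdsWithin_le_nhds
  rw [mul_zero, ENNReal.ofReal_zero, zero_mul, add_zero] at hlim'
  refine le_of_tendsto_of_tendsto ((ENNReal.continuous_ofReal.tendsto _).comp hlim) hlim' ?_
  filter_upwards [self_mem_nhdsWithin, mem_nhdsWithin_of_mem_nhds (Iio_mem_nhds hδ)]
    with h (hh : 0 < h) (hhδ : h < δ)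
  have h1 := setIntegral_translate_sub_le hg.measurableSet hφ.continuous hφc hφ0 (h • v)
  have h2 := setLIntegral_crossing_le (Ω := Ω) hg hL hφ0 hv hh (fun x hx s hs => hδΩ (by
    refine mem_cthickening_of_dist_le _ x _ _ (subset_tsupport _ hx.ne') ?_
    rw [dist_eq_norm, sub_sub_cancel_left, norm_neg, norm_smul, hv, mul_one,
      Real.norm_of_nonneg hs.1]
    exact hs.2.trans hhδ.le))
  rw [← ofReal_integral_eq_lintegral_ofReal
    (hφ.continuous.integrable_of_hasCompactSupport hφc).integrableOn
    (Eventually.of_forall hφ0)] at h2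
  simp only [Function.comp, zero_add, zero_smul, add_zero, smul_eq_mul]
  rw [ENNReal.ofReal_mul (by positivity), ENNReal.ofReal_inv_of_pos hh]
  rw [← ENNReal.div_eq_inv_mul]
  refine ENNReal.div_le_of_le_mul' ((ENNReal.ofReal_le_ofReal h1).trans (h2.trans ?_))
  gcongr
  have : ∀ y, ENNReal.ofReal (φ y + L * h) = ENNReal.ofReal (φ y) + ENNReal.ofReal (L * h) :=
    fun y => ENNReal.ofReal_add (hφ0 y) (by positivity)
  simp_rw [this]
  rw [lintegral_add_right _ measurable_const, lintegral_const]

theorem locallyIntegrable_indicator {F : Type*} [NormedAddCommGroup F] {g : Set E}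
    (hg : MeasurableSet g) {f : E → F} (hf : Continuous f) :
    LocallyIntegrable (g.indicator f) (volume : Measure E) :=
  hf.locallyIntegrable.indicator hg

open ContinuousLinearMap in
theorem fderiv_convolution_sub_apply {g : Set E} (hg : MeasurableSet g) (φ : ContDiffBump (0 : E))
    {ζ : E → ℝ} (hζ : ContDiff ℝ 1 ζ) (x v : E) :
    (fderiv ℝ (φ.normed volume ⋆[lsmul ℝ ℝ] g.indicator ζ) x -
      (φ.normed volume ⋆[lsmul ℝ ℝ] g.indicator (fderiv ℝ ζ)) x) v =
    ∫ y in g, fderiv ℝ (fun y => φ.normed volume (x - y) * ζ y) y (-v) := by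
  have hη : ContDiff ℝ 1 (φ.normed (volume : Measure E)) := φ.contDiff_normed
  have hηc : HasCompactSupport (φ.normed (volume : Measure E)) := φ.hasCompactSupport_normed
  have hζi := locallyIntegrable_indicator hg hζ.continuous
  have hdζi := locallyIntegrable_indicator hg (hζ.continuous_fderiv one_ne_zero)
  rw [(hηc.hasFDerivAt_convolution_left (lsmul ℝ ℝ) hη hζi x).fderiv, convolution_eq_swap,
    convolution_eq_swap]
  have i1 := (((hηc.fderiv ℝ).convolutionExists_left ((lsmul ℝ ℝ).precompL E)
    (hη.continuous_fderiv one_ne_zero) hζi) x).integrable_swap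
  have i2 := ((hηc.convolutionExists_left (lsmul ℝ ℝ) hη.continuous hdζi) x).integrable_swap
  rw [← integral_sub i1 i2, ContinuousLinearMap.integral_apply (by exact i1.sub i2),
    ← integral_indicator hg]
  congr 1
  ext y
  by_cases hy : y ∈ g
  · have h1 : HasFDerivAt (fun y => φ.normed volume (x - y))
        (-fderiv ℝ (φ.normed (volume : Measure E)) (x - y)) y := by
      have := (hη.differentiable one_ne_zero (x - y)).hasFDerivAt.comp y
        ((hasFDerivAt_id y).const_sub x)
      simpa [Function.comp_def] using this
    have h2 : fderiv ℝ (fun y => φ.normed volume (x - y) * ζ y) y = _ :=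
      (h1.mul (hζ.differentiable one_ne_zero y).hasFDerivAt).fderiv
    simp [hy, precompL_apply, h2]
    ring
  · simp [hy]

open ContinuousLinearMap in
theorem enorm_fderiv_convolution_sub_le {Ω g : Set E} (hΩ : IsOpen Ω) (hg : IsOpen g)
    (hfin : μH[(Module.finrank ℝ E : ℝ) - 1] (Ω ∩ frontier g) ≠ ⊤) (φ : ContDiffBump (0 : E))
    {ζ : E → ℝ} (hζ : ContDiff ℝ 1 ζ) (hζc : HasCompactSupport ζ) (hζΩ : tsupport ζ ⊆ Ω)
    (hζ0 : ∀ x, 0 ≤ ζ x) (x : E) :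
    ‖fderiv ℝ (φ.normed volume ⋆[lsmul ℝ ℝ] g.indicator ζ) x -
      (φ.normed volume ⋆[lsmul ℝ ℝ] g.indicator (fderiv ℝ ζ)) x‖ₑ ≤
    ∫⁻ y, ENNReal.ofReal (φ.normed volume (x - y) * ζ y)
        ∂(μH[(Module.finrank ℝ E : ℝ) - 1].restrict (Ω ∩ frontier g)) := by
  set m := ∫⁻ y, ENNReal.ofReal (φ.normed volume (x - y) * ζ y)
        ∂(μH[(Module.finrank ℝ E : ℝ) - 1].restrict (Ω ∩ frontier g)) with hm
  by_cases hmt : m = ⊤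
  · simp [hmt]
  set T := fderiv ℝ (φ.normed volume ⋆[lsmul ℝ ℝ] g.indicator ζ) x -
      (φ.normed volume ⋆[lsmul ℝ ℝ] g.indicator (fderiv ℝ ζ)) x with hT
  have hη : ContDiff ℝ 1 (φ.normed (volume : Measure E)) := φ.contDiff_normed
  have key : ∀ v : E, ‖v‖ = 1 → T v ≤ m.toReal := by
    intro v hv
    rw [← ENNReal.ofReal_le_iff_le_toReal hmt, hT,
      fderiv_convolution_sub_apply hg.measurableSet φ hζ]
    refine ofReal_setIntegral_fderiv_le hΩ hg hfin ?_ ?_ ?_ ?_ (by simpa using hv)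
    · exact (hη.comp (contDiff_const.sub contDiff_id)).mul hζ
    · exact hζc.mul_left
    · exact (closure_mono (Function.support_mul_subset_right _ _)).trans hζΩ
    · exact fun y => mul_nonneg (φ.nonneg_normed _) (hζ0 y)
  rw [← ofReal_norm, ENNReal.ofReal_le_iff_le_toReal hmt]
  refine opNorm_le_of_unit_norm (𝕜 := ℝ) ENNReal.toReal_nonneg fun v hv => ?_
  rw [Real.norm_eq_abs, abs_le']
  exact ⟨key v hv, by simpa using key (-v) (by simpa using hv)⟩

theorem lintegral_convolution_measure (ν : Measure E) [SFinite ν] (φ : ContDiffBump (0 : E))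
    {ζ : E → ℝ} (hζ : Continuous ζ) :
    ∫⁻ x, ∫⁻ y, ENNReal.ofReal (φ.normed volume (x - y) * ζ y) ∂ν =
      ∫⁻ y, ENNReal.ofReal (ζ y) ∂ν := by
  have hη := φ.continuous_normed (μ := (volume : Measure E))
  rw [lintegral_lintegral_swap
    (by exact (ENNReal.continuous_ofReal.comp (by fun_prop)).measurable.aemeasurable)]
  refine lintegral_congr fun y => ?_
  simp_rw [ENNReal.ofReal_mul (φ.nonneg_normed _)]
  rw [lintegral_mul_const' _ _ ENNReal.ofReal_ne_top,
    lintegral_sub_right_eq_self (fun x => ENNReal.ofReal (φ.normed volume x)) y,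
    ← ofReal_integral_eq_lintegral_ofReal φ.integrable_normed
      (Eventually.of_forall φ.nonneg_normed), φ.integral_normed]
  simp

theorem exists_lintegral_convolution_sub_le {g : Set E} (hg : MeasurableSet g)
    {F : Type*} [NormedAddCommGroup F] [NormedSpace ℝ F] [CompleteSpace F] {f : E → F}
    (hf : Continuous f) (hfc : HasCompactSupport f) {δ : ℝ≥0∞} (hδ : 0 < δ) :
    ∃ r₀ > 0, ∀ φ : ContDiffBump (0 : E), φ.rOut = 2 * φ.rIn → φ.rOut < r₀ →
      ∫⁻ x, ‖(φ.normed volume ⋆[ContinuousLinearMap.lsmul ℝ ℝ] g.indicator f) x -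
        g.indicator f x‖ₑ ≤ δ := by
  have hloc := locallyIntegrable_indicator hg hf
  obtain ⟨M, hM⟩ := hfc.exists_bound_of_continuous hf
  have hM' : ∀ x, ‖g.indicator f x‖ ≤ M := fun x => (norm_indicator_le_norm_self _ _).trans (hM x)
  set K := cthickening 1 (tsupport f)
  have hK : IsCompact K := hfc.isCompact.cthickening
  by_contra! H
  choose φ hφ1 hφ2 hφ3 using fun k : ℕ => H (1 / ((k : ℝ) + 1)) (by positivity)
  have hlim : Tendsto (fun k => (φ k).rOut) atTop (𝓝 0) :=
    squeeze_zero (fun k => (φ k).rOut_pos.le) (fun k => (hφ2 k).le) tendsto_one_div_add_atTop_nhds_zero_nat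
  have hae := ContDiffBump.ae_convolution_tendsto_right_of_locallyIntegrable (φ := φ) hlim
    (K := 2) (Eventually.of_forall fun k => (hφ1 k).le) hloc
  have hlt := tendsto_lintegral_of_dominated_convergence' (μ := volume) (f := fun _ => 0)
    (F := fun k x => ‖((φ k).normed volume ⋆[ContinuousLinearMap.lsmul ℝ ℝ] g.indicator f) x -
        g.indicator f x‖ₑ) (K.indicator fun _ => ENNReal.ofReal (2 * M))
    (fun k => by
      refine AEStronglyMeasurable.enorm ?_
      refine AEStronglyMeasurable.sub ?_ hloc.aestronglyMeasurable
      exact ((φ k).hasCompactSupport_normed.continuous_convolution_left _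
        (φ k).continuous_normed hloc).aestronglyMeasurable)
    (fun k => Eventually.of_forall fun x => by
      beta_reduce
      rw [← ofReal_norm, ← dist_eq_norm]
      by_cases hx : x ∈ K
      · rw [indicator_of_mem hx]
        refine ENNReal.ofReal_le_ofReal (ContDiffBump.dist_normed_convolution_le
          hloc.aestronglyMeasurable fun y _ => ?_)
        rw [dist_eq_norm]
        linarith [norm_sub_le (g.indicator f y) (g.indicator f x), hM' x, hM' y]
      · rw [indicator_of_notMem hx]
        have h0 : ∀ y ∈ ball x (φ k).rOut, g.indicator f y = 0 := fun y hy => by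
          have : f y = 0 := by
            by_contra hne
            refine hx (mem_cthickening_of_dist_le x y _ _ (subset_tsupport _ hne) ?_)
            rw [dist_comm]
            refine (mem_ball.1 hy).le.trans ((hφ2 k).le.trans ?_)
            rw [div_le_one (by positivity)]
            linarith [(Nat.cast_nonneg k : (0 : ℝ) ≤ k)]
          simp [indicator, this]
        rw [nonpos_iff_eq_zero, ENNReal.ofReal_eq_zero]
        refine ContDiffBump.dist_normed_convolution_le hloc.aestronglyMeasurable fun y hy => ?_
        rw [h0 y hy, h0 x (mem_ball_self (φ k).rOut_pos), dist_self])
    (by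
      rw [lintegral_indicator hK.measurableSet, lintegral_const]
      exact ENNReal.mul_ne_top ENNReal.ofReal_ne_top (by simpa using hK.measure_lt_top.ne))
    (by
      filter_upwards [hae] with x hx
      have := (hx.sub_const (g.indicator f x)).enorm
      simpa using this)
  rw [lintegral_zero] at hlt
  exact absurd (ge_of_tendsto hlt (Eventually.of_forall fun k => (hφ3 k).le)) (not_le.2 hδ)

/-- Smooth approximation of the indicator of an open set `g` inside `Ω` whose total variation is at
most the Hausdorff measure of `Ω ∩ frontier g`, up to `δ`. -/
theorem exists_contDiffOn_approx_indicator {Ω g : Set E} (hΩ : IsOpen Ω) (hg : IsOpen g)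
    (hfin : μH[(Module.finrank ℝ E : ℝ) - 1] (Ω ∩ frontier g) ≠ ⊤) {δ : ℝ} (hδ : 0 < δ) :
    ∃ u : E → ℝ, ContDiffOn ℝ (⊤ : ℕ∞) u Ω ∧
      ∫⁻ x in Ω, ‖fderiv ℝ u x‖ₑ ≤
        μH[(Module.finrank ℝ E : ℝ) - 1] (Ω ∩ frontier g) + ENNReal.ofReal δ ∧
      (∀ x ∈ Ω, ball x δ ⊆ g → |u x - 1| ≤ δ) ∧
      ∀ x ∈ Ω, Disjoint (ball x δ) g → u x = 0 := by
  set ν := (μH[(Module.finrank ℝ E : ℝ) - 1] : Measure E).restrict (Ω ∩ frontier g) with hν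
  have : IsFiniteMeasure ν := ⟨by simpa [hν] using hfin.lt_top⟩
  obtain ⟨ζ, K, hζs, hζc, hζΩ, hζ0, hKmono, hKΩ, hζK, hζsum⟩ :=
    exists_contDiff_exhaustion_partition hΩ
  obtain ⟨ε, hε, hεsum⟩ := ENNReal.exists_pos_sum_of_countable
    (ENNReal.ofReal_pos.2 hδ).ne' ℕ
  have hφ (i : ℕ) : ∃ φ : ContDiffBump (0 : E),
      (∀ x ∈ K i, ∀ y ∈ ball x φ.rOut, ζ i y = 0) ∧ φ.rOut ≤ δ ∧
      (∀ x, ∀ y ∈ ball x φ.rOut, dist (ζ i y) (ζ i x) ≤ ε i) ∧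
      ∫⁻ x, ‖(φ.normed volume ⋆[ContinuousLinearMap.lsmul ℝ ℝ] g.indicator (fderiv ℝ (ζ i))) x -
        g.indicator (fderiv ℝ (ζ i)) x‖ₑ ≤ ε i := by
    obtain ⟨r₁, hr₁, h₁⟩ := hζK i
    obtain ⟨r₂, hr₂, h₂⟩ := Metric.uniformContinuous_iff.1
      (ContDiff.lipschitzWith_of_hasCompactSupport (hζc i) (hζs i)
        (by simp)).choose_spec.uniformContinuous (ε i) (hε i)
    obtain ⟨r₃, hr₃, h₃⟩ := exists_lintegral_convolution_sub_le hg.measurableSet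
      ((hζs i).continuous_fderiv (by simp)) ((hζc i).fderiv ℝ) (ENNReal.coe_pos.2 (hε i))
    set r := min (min r₁ r₂) (min (r₃ / 2) δ)
    have hr : 0 < r := by positivity
    have hr1 : r ≤ r₁ := (min_le_left _ _).trans (min_le_left _ _)
    have hr2 : r ≤ r₂ := (min_le_left _ _).trans (min_le_right _ _)
    have hr3 : r ≤ r₃ / 2 := (min_le_right _ _).trans (min_le_left _ _)
    have hr4 : r ≤ δ := (min_le_right _ _).trans (min_le_right _ _)
    exact ⟨⟨r / 2, r, half_pos hr, half_lt_self hr⟩,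
      fun x hx y hy => h₁ x hx y (ball_subset_ball hr1 hy), hr4,
      fun x y hy => (h₂ (hy.trans_le hr2)).le,
      h₃ _ (by ring) (by change r < r₃; linarith)⟩
  choose φ hφK hφδ hφζ hφint using hφ
  set u : ℕ → E → ℝ := fun i =>
    (φ i).normed volume ⋆[ContinuousLinearMap.lsmul ℝ ℝ] g.indicator (ζ i) with hu
  have hloc : ∀ i, LocallyIntegrable (g.indicator (ζ i)) (volume : Measure E) := fun i =>
    locallyIntegrable_indicator hg.measurableSet (hζs i).continuous
  have hus : ∀ i, ContDiff ℝ (⊤ : ℕ∞) (u i) := fun i =>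
    (φ i).hasCompactSupport_normed.contDiff_convolution_left _ (φ i).contDiff_normed (hloc i)
  have hu0 : ∀ i x, (∀ y ∈ ball x (φ i).rOut, g.indicator (ζ i) y = 0) → u i x = 0 := by
    intro i x h
    have hx := h x (mem_ball_self (φ i).rOut_pos)
    rw [← hx]
    exact ContDiffBump.normed_convolution_eq_right fun y hy => by rw [h y hy, hx]
  have huK : ∀ j, ∀ x ∈ K j, ∑' i, u i x = ∑ i ∈ Finset.range j, u i x := by
    intro j x hx
    refine tsum_eq_sum fun i hi => hu0 i x fun y hy => ?_
    have hij : j ≤ i := by simpa using hi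
    rw [indicator_apply_eq_zero]
    exact fun _ => hφK i x (hKmono hij hx) y hy
  have hux : ∀ x ∈ Ω, ∃ j, K j ∈ 𝓝 x ∧
      (fun x => ∑' i, u i x) =ᶠ[𝓝 x] fun x => ∑ i ∈ Finset.range j, u i x := by
    intro x hx
    obtain ⟨j, hj⟩ := hKΩ x hx
    exact ⟨j, hj, by filter_upwards [hj] with y hy using huK j y hy⟩
  have hεle : ∀ j, ∑ i ∈ Finset.range j, (ε i : ℝ) ≤ δ := by
    intro j
    have h1 := (ENNReal.sum_le_tsum (f := fun i => (ε i : ℝ≥0∞)) (Finset.range j)).trans hεsum.le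
    rw [← ENNReal.ofReal_le_ofReal_iff hδ.le,
      ENNReal.ofReal_sum_of_nonneg fun i _ => (ε i).coe_nonneg]
    simpa using h1
  refine ⟨fun x => ∑' i, u i x, fun x hx => ?_, ?_, fun x hx hxg => ?_, fun x hx hxg => ?_⟩
  · obtain ⟨j, -, hj⟩ := hux x hx
    exact ((ContDiff.sum fun i _ => hus i).contDiffAt.congr_of_eventuallyEq hj).contDiffWithinAt
  · set a : ℕ → E → ℝ≥0∞ := fun i x =>
      ∫⁻ y, ENNReal.ofReal ((φ i).normed volume (x - y) * ζ i y) ∂ν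
    set c : ℕ → E → E →L[ℝ] ℝ := fun i =>
      (φ i).normed volume ⋆[ContinuousLinearMap.lsmul ℝ ℝ] g.indicator (fderiv ℝ (ζ i))
    set b : ℕ → E → ℝ≥0∞ := fun i x => ‖c i x - g.indicator (fderiv ℝ (ζ i)) x‖ₑ
    have hpt : ∀ x ∈ Ω, ‖fderiv ℝ (fun x => ∑' i, u i x) x‖ₑ ≤ (∑' i, a i x) + ∑' i, b i x := by
      intro x hx
      obtain ⟨j, hjK, hj⟩ := hux x hx
      have hz : ∑ i ∈ Finset.range j, g.indicator (fderiv ℝ (ζ i)) x = 0 := by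
        have h1 : ∑ i ∈ Finset.range j, fderiv ℝ (ζ i) x = 0 := by
          rw [← fderiv_fun_sum fun i _ => (hζs i).differentiable (by simp) x]
          have h2 : (fun x => ∑ i ∈ Finset.range j, ζ i x) =ᶠ[𝓝 x] fun _ => 1 := by
            filter_upwards [hjK] with y hy using hζsum j y hy
          rw [h2.fderiv_eq]
          simp
        by_cases hxg : x ∈ g <;> simp [hxg, h1]
      have hsum : fderiv ℝ (fun x => ∑' i, u i x) x =
          ∑ i ∈ Finset.range j, (fderiv ℝ (u i) x - c i x) +
            ∑ i ∈ Finset.range j, (c i x - g.indicator (fderiv ℝ (ζ i)) x) := by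
        rw [hj.fderiv_eq, fderiv_fun_sum fun i _ => (hus i).differentiable (by simp) x,
          Finset.sum_sub_distrib, Finset.sum_sub_distrib, hz]
        abel
      rw [hsum]
      refine (enorm_add_le (E := E →L[ℝ] ℝ) _ _).trans (add_le_add ?_ ?_)
      · refine (enorm_sum_le (ε := E →L[ℝ] ℝ) _ _).trans ((Finset.sum_le_sum fun i _ => ?_).trans
          (ENNReal.sum_le_tsum _))
        exact enorm_fderiv_convolution_sub_le hΩ hg hfin (φ i) ((hζs i).of_le (by simp)) (hζc i)
          (hζΩ i) (hζ0 i) x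
      · exact (enorm_sum_le (ε := E →L[ℝ] ℝ) _ _).trans (ENNReal.sum_le_tsum _)
    have ham : ∀ i, Measurable (a i) := fun i => by
      have h1 := (φ i).continuous_normed (μ := (volume : Measure E))
      have h2 := (hζs i).continuous
      refine Measurable.lintegral_prod_right' (f := fun p : E × E =>
        ENNReal.ofReal ((φ i).normed volume (p.1 - p.2) * ζ i p.2)) ?_
      exact (ENNReal.continuous_ofReal.comp (by fun_prop)).measurable
    have hbm : ∀ i, AEMeasurable (b i) := fun i => by
      have hl := locallyIntegrable_indicator hg.measurableSet
        ((hζs i).continuous_fderiv (by simp))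
      refine AEStronglyMeasurable.enorm (AEStronglyMeasurable.sub ?_ hl.aestronglyMeasurable)
      exact ((φ i).hasCompactSupport_normed.continuous_convolution_left _
        (φ i).continuous_normed hl).aestronglyMeasurable
    calc ∫⁻ x in Ω, ‖fderiv ℝ (fun x => ∑' i, u i x) x‖ₑ
        ≤ ∫⁻ x in Ω, ((∑' i, a i x) + ∑' i, b i x) := setLIntegral_mono' hΩ.measurableSet hpt
      _ ≤ ∫⁻ x, ((∑' i, a i x) + ∑' i, b i x) := setLIntegral_le_lintegral _ _
      _ = (∑' i, ∫⁻ x, a i x) + ∑' i, ∫⁻ x, b i x := by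
        rw [lintegral_add_left (Measurable.tsum ham),
          lintegral_tsum fun i => (ham i).aemeasurable, lintegral_tsum hbm]
      _ ≤ (∑' i, ∫⁻ y, ENNReal.ofReal (ζ i y) ∂ν) + ∑' i, (ε i : ℝ≥0∞) := by
        exact add_le_add (ENNReal.tsum_le_tsum fun i =>
          (lintegral_convolution_measure ν (φ i) (hζs i).continuous).le)
          (ENNReal.tsum_le_tsum hφint)
      _ ≤ ν univ + ENNReal.ofReal δ := by
        gcongr
        rw [← lintegral_tsum fun i =>
          (hζs i).continuous.measurable.ennreal_ofReal.aemeasurable, ← lintegral_one]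
        refine lintegral_mono_ae ?_
        have hmeas : MeasurableSet (Ω ∩ frontier g) :=
          hΩ.measurableSet.inter isClosed_frontier.measurableSet
        filter_upwards [ae_restrict_mem hmeas] with y hy
        obtain ⟨j, hj⟩ := hKΩ y hy.1
        refine ENNReal.tsum_le_of_sum_range_le fun N => ?_
        rw [← ENNReal.ofReal_sum_of_nonneg fun i _ => hζ0 i y]
        refine ENNReal.ofReal_le_one.2 ?_
        rw [← hζsum (max N j) y (hKmono (le_max_right N j) (mem_of_mem_nhds hj))]
        exact Finset.sum_le_sum_of_subset_of_nonneg
          (Finset.range_mono (le_max_left N j)) fun i _ _ => hζ0 i y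
      _ = _ := by simp [hν]
  · obtain ⟨j, hj⟩ := hKΩ x hx
    have hxK := mem_of_mem_nhds hj
    change |(∑' i, u i x) - 1| ≤ δ
    rw [huK j x hxK, ← hζsum j x hxK, ← Finset.sum_sub_distrib]
    refine (Finset.abs_sum_le_sum_abs _ _).trans ((Finset.sum_le_sum fun i _ => ?_).trans (hεle j))
    rw [← Real.dist_eq]
    have hxmem := hxg (mem_ball_self hδ)
    have h1 : g.indicator (ζ i) x = ζ i x := indicator_of_mem hxmem _
    rw [← h1]
    refine ContDiffBump.dist_normed_convolution_le (hloc i).aestronglyMeasurable fun y hy => ?_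
    rw [h1, indicator_of_mem (hxg (ball_subset_ball (hφδ i) hy))]
    exact hφζ i x y hy
  · have : ∀ i, u i x = 0 := fun i => hu0 i x fun y hy =>
      indicator_of_notMem (disjoint_left.1 hxg (ball_subset_ball (hφδ i) hy)) _
    simp [this]

theorem measure_separated_add_le_of_tendsto {X : Type*} [MeasurableSpace X] {μ : Measure (X × X)}
    {Ω A B : Set X} (hA : MeasurableSet A) (hB : MeasurableSet B) (hAΩ : A ⊆ Ω) (hBΩ : B ⊆ Ω)
    (hAB : Disjoint A B) {q : ℝ} (hq : 0 < q) {u : ℕ → X → ℝ}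
    (hu : ∀ k, AEMeasurable (fun z : X × X => u k z.1 - u k z.2) (μ.restrict (Ω ×ˢ Ω)))
    (huA : ∀ x ∈ A, Tendsto (u · x) atTop (𝓝 1)) (huB : ∀ x ∈ B, Tendsto (u · x) atTop (𝓝 0))
    {b : ℕ → ℝ≥0∞} {l : ℝ≥0∞} (hb : Tendsto b atTop (𝓝 l))
    (hub : ∀ k, ∫⁻ z in Ω ×ˢ Ω, ENNReal.ofReal (|u k z.1 - u k z.2| ^ q) ∂μ ≤ b k) :
    μ (A ×ˢ B) + μ (B ×ˢ A) ≤ l := by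
  have hdisj : Disjoint (A ×ˢ B) (B ×ˢ A) := hAB.set_prod_left _ _
  have hmeas : MeasurableSet (A ×ˢ B ∪ B ×ˢ A) := (hA.prod hB).union (hB.prod hA)
  have hsub : A ×ˢ B ∪ B ×ˢ A ⊆ Ω ×ˢ Ω :=
    union_subset (prod_mono hAΩ hBΩ) (prod_mono hBΩ hAΩ)
  have hlim : ∀ z ∈ A ×ˢ B ∪ B ×ˢ A,
      Tendsto (fun k => ENNReal.ofReal (|u k z.1 - u k z.2| ^ q)) atTop (𝓝 1) := by
    intro z hz
    have h1 : Tendsto (fun k => |u k z.1 - u k z.2|) atTop (𝓝 1) := by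
      rcases hz with hz | hz
      · simpa using ((huA _ hz.1).sub (huB _ hz.2)).abs
      · simpa using ((huB _ hz.1).sub (huA _ hz.2)).abs
    simpa using ENNReal.tendsto_ofReal (h1.rpow_const (p := q) (Or.inr hq.le))
  calc μ (A ×ˢ B) + μ (B ×ˢ A)
      = ∫⁻ _ in A ×ˢ B ∪ B ×ˢ A, 1 ∂μ := by
        rw [setLIntegral_one, measure_union hdisj (hB.prod hA)]
    _ ≤ ∫⁻ z in A ×ˢ B ∪ B ×ˢ A,
        liminf (fun k => ENNReal.ofReal (|u k z.1 - u k z.2| ^ q)) atTop ∂μ :=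
      setLIntegral_mono' hmeas fun z hz => (hlim z hz).liminf_eq.ge
    _ ≤ ∫⁻ z in Ω ×ˢ Ω, liminf (fun k => ENNReal.ofReal (|u k z.1 - u k z.2| ^ q)) atTop ∂μ :=
      lintegral_mono_set hsub
    _ ≤ liminf (fun k => ∫⁻ z in Ω ×ˢ Ω, ENNReal.ofReal (|u k z.1 - u k z.2| ^ q) ∂μ) atTop :=
      lintegral_liminf_le' fun k => by
        have := hu k
        simp only [← Real.norm_eq_abs]
        exact (this.norm.pow_const q).ennreal_ofReal
    _ ≤ liminf b atTop := liminf_le_liminf (Eventually.of_forall hub)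
    _ = l := hb.liminf_eq

theorem measure_prod_inter_offDiag_eq_zero {n : ℕ} {Ω : Set (EuclideanSpace ℝ (Fin n))} {q : ℝ}
    (hq : 0 < q) {μ : Measure (EuclideanSpace ℝ (Fin n) × EuclideanSpace ℝ (Fin n))}
    (h : ∀ i, ∫⁻ z in Ω ×ˢ Ω, ENNReal.ofReal (|z.1 i - z.2 i| ^ q) ∂μ = 0) :
    μ.restrict (Ω ×ˢ Ω) {z | z.1 ≠ z.2} = 0 := by
  have hae : ∀ i, ∀ᵐ z ∂μ.restrict (Ω ×ˢ Ω), z.1 i = z.2 i := fun i => by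
    have hmeas : Measurable fun z : EuclideanSpace ℝ (Fin n) × EuclideanSpace ℝ (Fin n) =>
        ENNReal.ofReal (|z.1 i - z.2 i| ^ q) :=
      (ENNReal.continuous_ofReal.comp
        ((by fun_prop : Continuous fun z : EuclideanSpace ℝ (Fin n) × EuclideanSpace ℝ (Fin n) =>
          |z.1 i - z.2 i|).rpow_const fun _ => Or.inr hq.le)).measurable
    filter_upwards [(lintegral_eq_zero_iff hmeas).1 (h i)] with z hz
    have h1 : |z.1 i - z.2 i| ^ q ≤ 0 := ENNReal.ofReal_eq_zero.1 hz
    by_contra hne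
    exact (Real.rpow_pos_of_pos (abs_pos.2 (sub_ne_zero.2 hne)) q).not_ge h1
  exact ae_iff.1 ((ae_all_iff.2 hae).mono fun z hz => PiLp.ext hz)

end

/-- necessity, `p = 1`: if
`(∬_{Ω×Ω} |u(x)−u(y)|^q dμ)^{1/q} ≤ C·∫_Ω |∇u| dx` for every `u ∈ C^∞(Ω)`, then
`μ(g×(Ω∖ḡ)) + μ((Ω∖ḡ)×g) ≤ (C·H^{n−1}(Ω ∩ ∂g))^q` for every open `g ⊆ Ω`. -/
theorem stmt_7 (n : ℕ) (Ω : Set (EuclideanSpace ℝ (Fin n))) (hΩ : IsOpen Ω)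
    (q : ℝ) (hq : 1 ≤ q) (C : ℝ) (hC : 0 ≤ C)
    (μ : Measure (EuclideanSpace ℝ (Fin n) × EuclideanSpace ℝ (Fin n)))
    -- `μ` is locally finite outside the diagonal
    (hloc : ∀ K : Set (EuclideanSpace ℝ (Fin n) × EuclideanSpace ℝ (Fin n)),
      IsCompact K → (∀ z ∈ K, z.1 ≠ z.2) → μ K < ⊤)
    (hineq : ∀ u : EuclideanSpace ℝ (Fin n) → ℝ, ContDiffOn ℝ (⊤ : ℕ∞) u Ω →
      (∫⁻ z in Ω ×ˢ Ω, ENNReal.ofReal (|u z.1 - u z.2| ^ q) ∂μ) ^ (1 / q) ≤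
        ENNReal.ofReal C * ∫⁻ x in Ω, ENNReal.ofReal ‖fderiv ℝ u x‖) :
    ∀ g : Set (EuclideanSpace ℝ (Fin n)), IsOpen g → g ⊆ Ω →
      μ (g ×ˢ (Ω \ closure g)) + μ ((Ω \ closure g) ×ˢ g) ≤
        (ENNReal.ofReal C * μH[(n : ℝ) - 1] (Ω ∩ frontier g)) ^ q := by
  intro g hg hgΩ
  have hq0 : 0 < q := one_pos.trans_le hq
  have hineq' (u : EuclideanSpace ℝ (Fin n) → ℝ) (hu : ContDiffOn ℝ (⊤ : ℕ∞) u Ω) :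
      ∫⁻ z in Ω ×ˢ Ω, ENNReal.ofReal (|u z.1 - u z.2| ^ q) ∂μ ≤
        (ENNReal.ofReal C * ∫⁻ x in Ω, ‖fderiv ℝ u x‖ₑ) ^ q := by
    have := hineq u hu
    rw [one_div, ENNReal.rpow_inv_le_iff hq0] at this
    simpa only [ofReal_norm] using this
  have hdisj : Disjoint g (Ω \ closure g) :=
    disjoint_left.2 fun x hx hx' => hx'.2 (subset_closure hx)
  rcases hC.eq_or_lt with rfl | hC0
  · have h0 := measure_prod_inter_offDiag_eq_zero (Ω := Ω) (μ := μ) hq0 fun i => by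
      simpa [hq0] using hineq' (fun x => x i) (by fun_prop)
    rw [Measure.restrict_apply (isOpen_ne_fun continuous_fst continuous_snd).measurableSet] at h0
    have h1 : μ (g ×ˢ (Ω \ closure g)) = 0 := by
      refine measure_mono_null (fun z hz => ?_) h0
      exact ⟨hdisj.ne_of_mem hz.1 hz.2, hgΩ hz.1, hz.2.1⟩
    have h2 : μ ((Ω \ closure g) ×ˢ g) = 0 := by
      refine measure_mono_null (fun z hz => ?_) h0
      exact ⟨(hdisj.ne_of_mem hz.2 hz.1).symm, hz.1.1, hgΩ hz.2⟩
    simp [h1, h2]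
  by_cases hfin : μH[(n : ℝ) - 1] (Ω ∩ frontier g) = ⊤
  · rw [hfin, ENNReal.mul_top (ENNReal.ofReal_pos.2 hC0).ne', ENNReal.top_rpow_of_pos hq0]
    exact le_top
  have happrox (k : ℕ) := exists_contDiffOn_approx_indicator hΩ hg
    (by rwa [finrank_euclideanSpace_fin]) (Nat.one_div_pos_of_nat (α := ℝ) (n := k))
  simp only [finrank_euclideanSpace_fin] at happrox
  choose u hu hgrad hu1 hu0 using happrox
  have hδ : Tendsto (fun k : ℕ => 1 / ((k : ℝ) + 1)) atTop (𝓝 0) :=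
    tendsto_one_div_add_atTop_nhds_zero_nat
  have hball {U : Set (EuclideanSpace ℝ (Fin n))} (hU : IsOpen U) {x} (hx : x ∈ U) :
      ∀ᶠ k : ℕ in atTop, ball x (1 / ((k : ℝ) + 1)) ⊆ U := by
    obtain ⟨r, hr, hrU⟩ := Metric.isOpen_iff.1 hU x hx
    filter_upwards [hδ.eventually_lt_const hr] with k hk using (ball_subset_ball hk.le).trans hrU
  refine measure_separated_add_le_of_tendsto (u := u) hg.measurableSet
    (hΩ.measurableSet.diff isClosed_closure.measurableSet) hgΩ sdiff_subset hdisj hq0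
    (fun k => ?_) (fun x hx => ?_) (fun x hx => ?_) ?_
    fun k => (hineq' (u k) (hu k)).trans
      (ENNReal.rpow_le_rpow (mul_le_mul_right (hgrad k) _) hq0.le)
  · have h1 := (hu k).continuousOn
    refine ContinuousOn.aemeasurable ?_ (hΩ.prod hΩ).measurableSet
    exact (h1.comp continuousOn_fst fun z hz => hz.1).sub
      (h1.comp continuousOn_snd fun z hz => hz.2)
  · rw [tendsto_iff_dist_tendsto_zero]
    refine squeeze_zero' (Eventually.of_forall fun _ => dist_nonneg) ?_ hδ
    filter_upwards [hball hg hx] with k hk using hu1 k x (hgΩ hx) hk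
  · refine tendsto_const_nhds.congr' ?_
    filter_upwards [hball isClosed_closure.isOpen_compl hx.2] with k hk
    exact (hu0 k x hx.1 (disjoint_left.2 fun y hy hyg => hk hy (subset_closure hyg))).symm
  · have h1 : Tendsto (fun k : ℕ => μH[(n : ℝ) - 1] (Ω ∩ frontier g) +
        ENNReal.ofReal (1 / ((k : ℝ) + 1))) atTop (𝓝 (μH[(n : ℝ) - 1] (Ω ∩ frontier g))) := by
      simpa using (ENNReal.tendsto_ofReal hδ).const_add _
    exact (ENNReal.Tendsto.const_mul h1 (Or.inr ENNReal.ofReal_ne_top)).ennrpow_const q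
end
end
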